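/- Let p be a prime, K a field of characteristic p and m, n ∈ ℕ. The symbol ((a,b))_{p^m,p^n} := [A_{((a,b))_{p^m,p^n}}] ∈ Br(K) satisfies: (i) ((a,b))_{p^m,p^n} = ((a + F^n c, b + F^m d))_{p^m,p^n} for all a, c ∈ W_m(K) and b, d ∈ W_n(K), where F is the Frobenius of truncated Witt vectors; (ii) ((·,·))_{p^m,p^n} : W_m(K) × W_n(K) → Br(K) is additive in each variable; (iii) ((a,b))_{p^m,p^n} = −((b,a))_{p^n,p^m}; in particular ((·,·))_{p^n} := ((·,·))_{p^n,p^n} is skew-symmetric. -/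

import Mathlib

noncomputable section

/-- The product `∏ i, x i ^ e i` over the support of `e`, with factors multiplied in
increasing order of the index. -/
def ordProd {σ M : Type*} [LinearOrder σ] [Monoid M] (x : σ → M) (e : σ →₀ ℕ) : M :=
  ((e.support.sort (· ≤ ·)).map fun i => x i ^ e i).prod

/-- Evaluation of a multivariate polynomial in a (possibly noncommutative) algebra:
each monomial is evaluated as the ordered product of the powers of the substituted
values, the variables being multiplied in increasing order of their (linearly ordered)
index. -/
def pEval {σ R A : Type*} [LinearOrder σ] [CommSemiring R] [Semiring A] [Algebra R A]
    (x : σ → A) (q : MvPolynomial σ R) : A :=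
  q.support.sum fun e => MvPolynomial.coeff e q • ordProd x e

/-- Evaluation of an integral polynomial in the commuting variables `X_d` (`d : ℕ+`, left
summand) and `Y_e` (`e : ℕ+`, right summand), substituting `x d` for `X_d` and `y e` for
`Y_e`; in each monomial all `X`-factors (in increasing index order) are multiplied to the
left of all `Y`-factors (in increasing index order), as appropriate for a polynomial in
`ℤ[X][Y]`. -/
def cEval {A : Type*} [Ring A] (x y : ℕ+ → A) (q : MvPolynomial (ℕ+ ⊕ₗ ℕ+) ℤ) : A :=
  pEval (fun v => Sum.elim x y (ofLex v)) q

/-- The `k`-th ghost value `w_k(g) = ∑_{d ∣ k} d · (g d)^(k/d)`. -/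
def ghost {A : Type*} [Ring A] (g : ℕ+ → A) (k : ℕ+) : A :=
  ∑ d ∈ (k : ℕ).divisors.attach,
    ((d : ℕ) : A) * g ⟨(d : ℕ), Nat.pos_of_mem_divisors d.2⟩ ^ ((k : ℕ) / (d : ℕ))

/-- The generator `x_d` of the free algebra underlying `B(ℚ)`. -/
def bXf (d : ℕ+) : FreeAlgebra ℚ (ℕ+ ⊕ ℕ+) := FreeAlgebra.ι ℚ (Sum.inl d)

/-- The generator `y_e` of the free algebra underlying `B(ℚ)`. -/
def bYf (e : ℕ+) : FreeAlgebra ℚ (ℕ+ ⊕ ℕ+) := FreeAlgebra.ι ℚ (Sum.inr e)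

/-- The defining relations of `B(ℚ)`: `[w_k(x), w_l(x)] = 0`, `[w_k(y), w_l(y)] = 0` and
`[w_l(y), w_k(x)] = δ_{k,l}·k` for all `k, l ≥ 1`. -/
inductive BRel : FreeAlgebra ℚ (ℕ+ ⊕ ℕ+) → FreeAlgebra ℚ (ℕ+ ⊕ ℕ+) → Prop
  | xx (k l : ℕ+) : BRel (ghost bXf k * ghost bXf l) (ghost bXf l * ghost bXf k)
  | yy (k l : ℕ+) : BRel (ghost bYf k * ghost bYf l) (ghost bYf l * ghost bYf k)
  | yx (k l : ℕ+) : BRel (ghost bYf l * ghost bXf k)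
      (ghost bXf k * ghost bYf l + if k = l then ((k : ℕ) : FreeAlgebra ℚ (ℕ+ ⊕ ℕ+)) else 0)

/-- The universal algebra `B(ℚ)`. -/
abbrev BQ : Type := RingQuot BRel

/-- The generator `x_d` of `B(ℚ)`. -/
def bx (d : ℕ+) : BQ := RingQuot.mkAlgHom ℚ BRel (bXf d)

/-- The generator `y_e` of `B(ℚ)`. -/
def by' (e : ℕ+) : BQ := RingQuot.mkAlgHom ℚ BRel (bYf e)

/-- `c` is a family of polynomials `c_{m,n}` as in the paper: `c m n` is an integral
polynomial in the variables `X_d` (`d` a proper divisor of `m`) and `Y_e` (`e` a proper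
divisor of `n`) such that `[y_n, x_m] = c_{m,n}(x, y)` holds in `B(ℚ)`. -/
def IsCFamily (c : ℕ+ → ℕ+ → MvPolynomial (ℕ+ ⊕ₗ ℕ+) ℤ) : Prop :=
  ∀ m n : ℕ+,
    (∀ v ∈ (c m n).vars,
      (∃ d : ℕ+, (d : ℕ) ∣ (m : ℕ) ∧ d ≠ m ∧ ofLex v = Sum.inl d) ∨
      (∃ e : ℕ+, (e : ℕ) ∣ (n : ℕ) ∧ e ≠ n ∧ ofLex v = Sum.inr e)) ∧
    cEval bx by' (c m n) = by' n * bx m - bx m * by' n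


/-- `p ^ i` as a positive natural number. -/
def ppow (p i : ℕ) : ℕ+ := (p ^ i).toPNat'

/-- Substitution of the generators `x_0, …, x_{m-1}` for the variables `X_{p^0}, …, X_{p^{m-1}}`
(the variable `X_{p^r}` is sent to `x_r`). -/
def sxm (R : Type*) [CommRing R] (p m n : ℕ) : ℕ+ → FreeAlgebra R (Fin m ⊕ Fin n) :=
  fun d => if h : padicValNat p (d : ℕ) < m
    then FreeAlgebra.ι R (Sum.inl ⟨padicValNat p (d : ℕ), h⟩) else 0

/-- Substitution of the generators `y_0, …, y_{n-1}` for the variables `Y_{p^0}, …, Y_{p^{n-1}}`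
(the variable `Y_{p^s}` is sent to `y_s`). -/
def syn (R : Type*) [CommRing R] (p m n : ℕ) : ℕ+ → FreeAlgebra R (Fin m ⊕ Fin n) :=
  fun e => if h : padicValNat p (e : ℕ) < n
    then FreeAlgebra.ι R (Sum.inr ⟨padicValNat p (e : ℕ), h⟩) else 0

/-- The defining relations of the truncated `p`-typical algebra `B_{m,n}(R)`:
`[x_i, x_{i'}] = 0`, `[y_j, y_{j'}] = 0` and
`[y_j, x_i] = c_{p^i, p^j}(x_0, …, x_{i-1}, y_0, …, y_{j-1})`. -/
inductive BmnRel (R : Type*) [CommRing R] (p : ℕ)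
    (c : ℕ+ → ℕ+ → MvPolynomial (ℕ+ ⊕ₗ ℕ+) ℤ) (m n : ℕ) :
    FreeAlgebra R (Fin m ⊕ Fin n) → FreeAlgebra R (Fin m ⊕ Fin n) → Prop
  | xx (i i' : Fin m) : BmnRel R p c m n
      (FreeAlgebra.ι R (Sum.inl i) * FreeAlgebra.ι R (Sum.inl i'))
      (FreeAlgebra.ι R (Sum.inl i') * FreeAlgebra.ι R (Sum.inl i))
  | yy (j j' : Fin n) : BmnRel R p c m n
      (FreeAlgebra.ι R (Sum.inr j) * FreeAlgebra.ι R (Sum.inr j'))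
      (FreeAlgebra.ι R (Sum.inr j') * FreeAlgebra.ι R (Sum.inr j))
  | yx (i : Fin m) (j : Fin n) : BmnRel R p c m n
      (FreeAlgebra.ι R (Sum.inr j) * FreeAlgebra.ι R (Sum.inl i))
      (FreeAlgebra.ι R (Sum.inl i) * FreeAlgebra.ι R (Sum.inr j) +
        cEval (sxm R p m n) (syn R p m n) (c (ppow p (i : ℕ)) (ppow p (j : ℕ))))

/-- The truncated `p`-typical algebra `B_{m,n}(R)`. -/
abbrev Bmn (R : Type*) [CommRing R] (p : ℕ) (c : ℕ+ → ℕ+ → MvPolynomial (ℕ+ ⊕ₗ ℕ+) ℤ)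
    (m n : ℕ) : Type _ := RingQuot (BmnRel R p c m n)

/-- The generator `x_i` of `B_{m,n}(R)`. -/
def gx (R : Type*) [CommRing R] (p : ℕ) (c : ℕ+ → ℕ+ → MvPolynomial (ℕ+ ⊕ₗ ℕ+) ℤ)
    (m n : ℕ) (i : Fin m) : Bmn R p c m n :=
  RingQuot.mkAlgHom R (BmnRel R p c m n) (FreeAlgebra.ι R (Sum.inl i))

/-- The generator `y_j` of `B_{m,n}(R)`. -/
def gy (R : Type*) [CommRing R] (p : ℕ) (c : ℕ+ → ℕ+ → MvPolynomial (ℕ+ ⊕ₗ ℕ+) ℤ)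
    (m n : ℕ) (j : Fin n) : Bmn R p c m n :=
  RingQuot.mkAlgHom R (BmnRel R p c m n) (FreeAlgebra.ι R (Sum.inr j))
/-- The relations `x_i^{p^n} = a_i`, `y_j^{p^m} = b_j` defining `A_{((a,b))_{p^m,p^n}}`. -/
inductive ASRel (K : Type*) [Field K] (p : ℕ) [Fact p.Prime]
    (c : ℕ+ → ℕ+ → MvPolynomial (ℕ+ ⊕ₗ ℕ+) ℤ) (m n : ℕ)
    (a : TruncatedWittVector p m K) (b : TruncatedWittVector p n K) :
    Bmn K p c m n → Bmn K p c m n → Prop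
  | xa (i : Fin m) : ASRel K p c m n a b
      (gx K p c m n i ^ p ^ n) (algebraMap K (Bmn K p c m n) (a.coeff i))
  | yb (j : Fin n) : ASRel K p c m n a b
      (gy K p c m n j ^ p ^ m) (algebraMap K (Bmn K p c m n) (b.coeff j))

/-- The central simple algebra `A_{((a,b))_{p^m,p^n}}`. -/
abbrev Asymb (K : Type*) [Field K] (p : ℕ) [Fact p.Prime]
    (c : ℕ+ → ℕ+ → MvPolynomial (ℕ+ ⊕ₗ ℕ+) ℤ) (m n : ℕ)
    (a : TruncatedWittVector p m K) (b : TruncatedWittVector p n K) : Type _ :=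
  RingQuot (ASRel K p c m n a b)

/-- The image of the generator `x_i` in `A_{((a,b))_{p^m,p^n}}`. -/
def aX (K : Type*) [Field K] (p : ℕ) [Fact p.Prime]
    (c : ℕ+ → ℕ+ → MvPolynomial (ℕ+ ⊕ₗ ℕ+) ℤ) (m n : ℕ)
    (a : TruncatedWittVector p m K) (b : TruncatedWittVector p n K) (i : Fin m) :
    Asymb K p c m n a b :=
  RingQuot.mkAlgHom K (ASRel K p c m n a b) (gx K p c m n i)

/-- The image of the generator `y_j` in `A_{((a,b))_{p^m,p^n}}`. -/
def aY (K : Type*) [Field K] (p : ℕ) [Fact p.Prime]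
    (c : ℕ+ → ℕ+ → MvPolynomial (ℕ+ ⊕ₗ ℕ+) ℤ) (m n : ℕ)
    (a : TruncatedWittVector p m K) (b : TruncatedWittVector p n K) (j : Fin n) :
    Asymb K p c m n a b :=
  RingQuot.mkAlgHom K (ASRel K p c m n a b) (gy K p c m n j)

/-- Two `K`-algebras are Brauer equivalent if they become isomorphic after tensoring with
matrix algebras, i.e. `M_r(A) ≅ M_s(B)` for some `r, s ≥ 1`. -/
def BrauerEquiv (K : Type*) [Field K] (A B : Type*) [Ring A] [Algebra K A]
    [Ring B] [Algebra K B] : Prop :=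
  ∃ r s : ℕ, 0 < r ∧ 0 < s ∧
    Nonempty (Matrix (Fin r) (Fin r) A ≃ₐ[K] Matrix (Fin s) (Fin s) B)


open scoped TensorProduct

/-- The Frobenius `F` of truncated `p`-typical Witt vectors over a ring of characteristic
`p`: it raises each component to the `p`-th power. -/
def twFrob {p : ℕ} [Fact p.Prime] {K : Type*} [CommRing K] {k : ℕ}
    (x : TruncatedWittVector p k K) : TruncatedWittVector p k K :=
  TruncatedWittVector.mk p fun i => x.coeff i ^ p

section Evaluation

variable {σ R S : Type*} [Ring R] [Ring S]

/-- Evaluation of an integral polynomial at a family of elements of a possibly noncommutative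
ring, each monomial being expanded in an arbitrary but fixed order. -/
def ncEval (z : σ → R) : MvPolynomial σ ℤ →ₗ[ℤ] R :=
  Finsupp.lsum ℤ (fun e => LinearMap.toSpanSingleton ℤ R (e.toMultiset.toList.map z).prod) ∘ₗ
    (AddMonoidAlgebra.coeffLinearEquiv ℤ).toLinearMap

theorem ncEval_monomial (z : σ → R) (e : σ →₀ ℕ) (a : ℤ) :
    ncEval z (MvPolynomial.monomial e a) = a • (e.toMultiset.toList.map z).prod := by
  simp [ncEval, MvPolynomial.monomial]

theorem ncEval_eq_sum (z : σ → R) (q : MvPolynomial σ ℤ) :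
    ncEval z q = ∑ e ∈ q.support, q.coeff e • (e.toMultiset.toList.map z).prod := by
  conv_lhs => rw [q.as_sum, map_sum]
  simp only [ncEval_monomial]

theorem map_ncEval (f : R →+* S) (z : σ → R) (q : MvPolynomial σ ℤ) :
    f (ncEval z q) = ncEval (fun s => f (z s)) q := by
  simp only [ncEval_eq_sum, map_sum, map_zsmul, map_list_prod, List.map_map]
  rfl

theorem ncEval_congr {z z' : σ → R} {q : MvPolynomial σ ℤ} (h : ∀ v ∈ q.vars, z v = z' v) :
    ncEval z q = ncEval z' q := by
  simp only [ncEval_eq_sum]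
  refine Finset.sum_congr rfl fun e he => ?_
  congr 2
  refine List.map_congr_left fun v hv => h v ?_
  rw [MvPolynomial.mem_vars_iff_mem_support]
  refine ⟨e, he, ?_⟩
  simpa using hv

theorem ncEval_eq_aeval {R : Type*} [CommRing R] (z : σ → R) (q : MvPolynomial σ ℤ) :
    ncEval z q = MvPolynomial.aeval z q := by
  rw [ncEval_eq_sum, MvPolynomial.aeval_def, MvPolynomial.eval₂_eq]
  refine Finset.sum_congr rfl fun e _ => ?_
  rw [Algebra.algebraMap_eq_smul_one, smul_mul_assoc, one_mul]
  congr 1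
  rw [← Multiset.prod_coe, ← Multiset.map_coe, Multiset.coe_toList]
  change _ = e.prod fun i k => z i ^ k
  clear * -
  induction e using Finsupp.induction_linear with
  | zero => simp
  | add f g hf hg =>
    rw [map_add, Multiset.map_add, Multiset.prod_add, hf, hg,
      Finsupp.prod_add_index' (by simp) (by simp [pow_add])]
  | single a k => simp [Multiset.map_nsmul, Multiset.prod_nsmul]

theorem ncEval_mem (T : Subring R) {z : σ → R} {q : MvPolynomial σ ℤ}
    (h : ∀ v ∈ q.vars, z v ∈ T) : ncEval z q ∈ T := by
  rw [ncEval_eq_sum]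
  refine sum_mem fun e he => zsmul_mem (list_prod_mem fun r hr => ?_) _
  obtain ⟨v, hv, rfl⟩ := List.mem_map.1 hr
  exact h v ((MvPolynomial.mem_vars_iff_mem_support v).2 ⟨e, he, by simpa using hv⟩)

open scoped IsMulCommutative in
/-- Evaluation at a commuting family, as a ring homomorphism. -/
def commHom (z : σ → R) (hz : ∀ a b, z a * z b = z b * z a) : MvPolynomial σ ℤ →+* R :=
  have := Algebra.isMulCommutative_adjoin ℤ (s := Set.range z)
    (by rintro _ ⟨a, rfl⟩ _ ⟨b, rfl⟩; exact hz a b)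
  (Algebra.adjoin ℤ (Set.range z)).val.toRingHom.comp
    (MvPolynomial.aeval (R := ℤ) fun s =>
      (⟨z s, Algebra.subset_adjoin ⟨s, rfl⟩⟩ : Algebra.adjoin ℤ (Set.range z))).toRingHom

open scoped IsMulCommutative in
theorem commHom_apply (z : σ → R) (hz : ∀ a b, z a * z b = z b * z a) (q : MvPolynomial σ ℤ) :
    commHom z hz q = ncEval z q := by
  have := Algebra.isMulCommutative_adjoin ℤ (s := Set.range z)
    (by rintro _ ⟨a, rfl⟩ _ ⟨b, rfl⟩; exact hz a b)
  unfold commHom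
  simp only [RingHom.comp_apply]
  have := ncEval_eq_aeval (fun s =>
      (⟨z s, Algebra.subset_adjoin ⟨s, rfl⟩⟩ : Algebra.adjoin ℤ (Set.range z))) q
  erw [← this]
  exact map_ncEval (Algebra.adjoin ℤ (Set.range z)).val.toRingHom _ q

theorem ncEval_X (z : σ → R) (s : σ) : ncEval z (MvPolynomial.X s) = z s := by
  simp [MvPolynomial.X, ncEval_monomial]

theorem ncEval_one (z : σ → R) : ncEval z 1 = 1 := by
  rw [← MvPolynomial.C_1, MvPolynomial.C_apply, ncEval_monomial]; simp

theorem ncEval_mul {z : σ → R} (hz : ∀ a b, z a * z b = z b * z a) (q r : MvPolynomial σ ℤ) :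
    ncEval z (q * r) = ncEval z q * ncEval z r := by
  simp only [← commHom_apply z hz, map_mul]

end Evaluation

section CEval

variable {R S : Type*} [Ring R] [Ring S]

theorem map_pEval {σ : Type*} [LinearOrder σ] (f : R →+* S) (z : σ → R) (q : MvPolynomial σ ℤ) :
    f (pEval z q) = pEval (fun s => f (z s)) q := by
  simp only [pEval, ordProd, map_sum, map_zsmul, map_list_prod, List.map_map]
  refine Finset.sum_congr rfl fun e _ => ?_
  congr 2
  exact List.map_congr_left fun v _ => by simp

theorem pEval_congr {σ : Type*} [LinearOrder σ] {z z' : σ → R} {q : MvPolynomial σ ℤ}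
    (h : ∀ v ∈ q.vars, z v = z' v) : pEval z q = pEval z' q := by
  simp only [pEval, ordProd]
  refine Finset.sum_congr rfl fun e he => ?_
  congr 2
  refine List.map_congr_left fun v hv => ?_
  rw [h v ((MvPolynomial.mem_vars_iff_mem_support v).2 ⟨e, he, by simpa using hv⟩)]

theorem pEval_mem {σ : Type*} [LinearOrder σ] (T : Subring R) {z : σ → R} {q : MvPolynomial σ ℤ}
    (h : ∀ v ∈ q.vars, z v ∈ T) : pEval z q ∈ T := by
  refine sum_mem fun e he => zsmul_mem (list_prod_mem fun r hr => ?_) _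
  obtain ⟨v, hv, rfl⟩ := List.mem_map.1 hr
  exact pow_mem (h v ((MvPolynomial.mem_vars_iff_mem_support v).2 ⟨e, he, by simpa using hv⟩)) _

theorem map_cEval (f : R →+* S) (x y : ℕ+ → R) (q : MvPolynomial (ℕ+ ⊕ₗ ℕ+) ℤ) :
    f (cEval x y q) = cEval (fun d => f (x d)) (fun d => f (y d)) q := by
  rw [cEval, map_pEval, cEval]
  congr 1
  ext v
  rcases h : ofLex v with d | d <;> simp

theorem cEval_congr {x y x' y' : ℕ+ → R} {q : MvPolynomial (ℕ+ ⊕ₗ ℕ+) ℤ}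
    (hx : ∀ d, toLex (Sum.inl d) ∈ q.vars → x d = x' d)
    (hy : ∀ d, toLex (Sum.inr d) ∈ q.vars → y d = y' d) : cEval x y q = cEval x' y' q := by
  refine pEval_congr fun v hv => ?_
  rcases h : ofLex v with d | d
  · exact hx d (by rw [← h]; exact hv)
  · exact hy d (by rw [← h]; exact hv)

theorem cEval_mem (T : Subring R) {x y : ℕ+ → R} {q : MvPolynomial (ℕ+ ⊕ₗ ℕ+) ℤ}
    (hx : ∀ d, toLex (Sum.inl d) ∈ q.vars → x d ∈ T)
    (hy : ∀ d, toLex (Sum.inr d) ∈ q.vars → y d ∈ T) : cEval x y q ∈ T := by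
  refine pEval_mem T fun v hv => ?_
  rcases h : ofLex v with d | d
  · exact hx d (by rw [← h]; exact hv)
  · exact hy d (by rw [← h]; exact hv)

end CEval

section Ghost

theorem ghost_eq_sum {A : Type*} [Ring A] (g : ℕ+ → A) (k : ℕ+) :
    ghost g k = ∑ d ∈ (k : ℕ).divisors, (d : A) * g d.toPNat' ^ ((k : ℕ) / d) := by
  rw [ghost, ← Finset.sum_attach (k : ℕ).divisors
    (fun d => (d : A) * g d.toPNat' ^ ((k : ℕ) / d))]
  refine Finset.sum_congr rfl fun d _ => ?_
  congr 3
  exact PNat.eq (by simp [Nat.toPNat'_coe, Nat.pos_of_mem_divisors d.2])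

theorem ghost_eq_add {A : Type*} [Ring A] (g : ℕ+ → A) (k : ℕ+) :
    ghost g k = (∑ d ∈ (k : ℕ).properDivisors, (d : A) * g d.toPNat' ^ ((k : ℕ) / d)) +
      (k : ℕ) * g k := by
  rw [ghost_eq_sum, ← Nat.cons_self_properDivisors k.pos.ne', Finset.sum_cons, add_comm]
  simp

theorem map_ghost {A B : Type*} [Ring A] [Ring B] (f : A →+* B) (g : ℕ+ → A) (k : ℕ+) :
    f (ghost g k) = ghost (fun d => f (g d)) k := by
  simp [ghost]

/-- The family with prescribed ghost components. -/
def ghostInv {A : Type*} [Ring A] [Algebra ℚ A] (w : ℕ+ → A) (k : ℕ+) : A :=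
  ((k : ℕ) : ℚ)⁻¹ • (w k - ∑ d ∈ (k : ℕ).properDivisors.attach,
    ((d : ℕ) : A) * ghostInv w (d : ℕ).toPNat' ^ ((k : ℕ) / d))
termination_by (k : ℕ)
decreasing_by
  have h := Nat.mem_properDivisors.1 d.2
  rw [Nat.toPNat'_coe, if_pos (Nat.pos_of_dvd_of_pos h.1 k.pos)]
  exact h.2

theorem ghostInv_def {A : Type*} [Ring A] [Algebra ℚ A] (w : ℕ+ → A) (k : ℕ+) :
    ghostInv w k = ((k : ℕ) : ℚ)⁻¹ • (w k - ∑ d ∈ (k : ℕ).properDivisors.attach,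
      ((d : ℕ) : A) * ghostInv w (d : ℕ).toPNat' ^ ((k : ℕ) / d)) := by
  rw [ghostInv]

theorem ghost_ghostInv {A : Type*} [Ring A] [Algebra ℚ A] (w : ℕ+ → A) (k : ℕ+) :
    ghost (ghostInv w) k = w k := by
  rw [ghost_eq_add, ghostInv_def w k, Finset.sum_attach (k : ℕ).properDivisors
    (fun d => (d : A) * ghostInv w d.toPNat' ^ ((k : ℕ) / d))]
  have : ((k : ℕ) : A) = algebraMap ℚ A (k : ℕ) := by simp
  rw [this, ← Algebra.smul_def, smul_smul, mul_inv_cancel₀ (by exact_mod_cast k.pos.ne'), one_smul]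
  abel

variable {R : Type*} [Ring R] (p : ℕ)

/-- The `p`-typical ghost components. -/
def gh (x : ℕ → R) (k : ℕ) : R := ∑ i ∈ Finset.range (k + 1), (p : R) ^ i * x i ^ p ^ (k - i)

theorem gh_eq_add (x : ℕ → R) (k : ℕ) :
    gh p x k = (∑ i ∈ Finset.range k, (p : R) ^ i * x i ^ p ^ (k - i)) + (p : R) ^ k * x k := by
  rw [gh, Finset.sum_range_succ]; simp

theorem gh_zero (x : ℕ → R) : gh p x 0 = x 0 := by simp [gh]

theorem map_gh {S : Type*} [Ring S] (f : R →+* S) (x : ℕ → R) (k : ℕ) :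
    f (gh p x k) = gh p (fun i => f (x i)) k := by
  simp [gh]

theorem coe_ppow [hp : Fact p.Prime] (k : ℕ) : (ppow p k : ℕ) = p ^ k := by
  simp [ppow, Nat.toPNat'_coe, hp.out.pos]

theorem padicValNat_ppow [hp : Fact p.Prime] (k : ℕ) : padicValNat p (ppow p k : ℕ) = k := by
  rw [coe_ppow, padicValNat.prime_pow]

theorem exists_ppow_of_dvd [hp : Fact p.Prime] {d : ℕ+} {k : ℕ} (h : (d : ℕ) ∣ (ppow p k : ℕ)) :
    ∃ i ≤ k, d = ppow p i := by
  rw [coe_ppow] at h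
  obtain ⟨i, hi, h⟩ := (Nat.dvd_prime_pow hp.out).1 h
  exact ⟨i, hi, PNat.eq (by rw [h, coe_ppow])⟩

theorem ghost_ppow [hp : Fact p.Prime] (g : ℕ+ → R) (k : ℕ) :
    ghost g (ppow p k) = gh p (fun i => g (ppow p i)) k := by
  rw [ghost_eq_sum, coe_ppow, Nat.sum_divisors_prime_pow hp.out, gh]
  refine Finset.sum_congr rfl fun i hi => ?_
  rw [Nat.pow_div (by simpa [Nat.lt_succ_iff] using hi) hp.out.pos]
  simp [ppow]

section Rational

variable [Algebra ℚ R] [hp : Fact p.Prime]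
include hp

theorem eq_smul_gh (x : ℕ → R) (k : ℕ) :
    x k = ((p : ℚ) ^ k)⁻¹ •
      (gh p x k - ∑ i ∈ Finset.range k, (p : R) ^ i * x i ^ p ^ (k - i)) := by
  have : (p : R) ^ k = algebraMap ℚ R ((p : ℚ) ^ k) := by simp
  rw [gh_eq_add, add_sub_cancel_left, this, ← Algebra.smul_def, smul_smul, inv_mul_cancel₀,
    one_smul]
  exact pow_ne_zero _ (by exact_mod_cast hp.out.ne_zero)

theorem mem_of_gh_mem (S : Subalgebra ℚ R) {x : ℕ → R} {N : ℕ} (h : ∀ k ≤ N, gh p x k ∈ S) :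
    ∀ k ≤ N, x k ∈ S := by
  intro k
  induction k using Nat.strong_induction_on with
  | _ k ih =>
    intro hk
    rw [eq_smul_gh p x k]
    refine S.smul_mem (S.sub_mem (h k hk) (S.sum_mem fun i hi => ?_)) _
    have hi := Finset.mem_range.1 hi
    exact S.mul_mem (S.pow_mem (S.natCast_mem p) _) (S.pow_mem (ih i hi (by omega)) _)

theorem eq_of_gh_eq {x x' : ℕ → R} {N : ℕ} (h : ∀ k ≤ N, gh p x k = gh p x' k) :
    ∀ k ≤ N, x k = x' k := by
  intro k
  induction k using Nat.strong_induction_on with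
  | _ k ih =>
    intro hk
    rw [eq_smul_gh p x k, eq_smul_gh p x' k, h k hk]
    congr 2
    refine Finset.sum_congr rfl fun i hi => ?_
    have hi := Finset.mem_range.1 hi
    rw [ih i hi (by omega)]

theorem commute_of_gh {z : R} {x : ℕ → R} (h : ∀ k, Commute z (gh p x k)) (k : ℕ) :
    Commute z (x k) := by
  have := mem_of_gh_mem p (Subalgebra.centralizer ℚ {z}) (x := x) (N := k)
    (fun k _ => by
      rw [Subalgebra.mem_centralizer_iff]; rintro _ rfl; exact h k) k le_rfl
  rw [Subalgebra.mem_centralizer_iff] at this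
  exact this z rfl

omit hp in
theorem exists_gh_eq [hp : Fact p.Prime] (w : ℕ → R) : ∃ x : ℕ → R, ∀ k, gh p x k = w k := by
  refine ⟨fun i => ghostInv (fun d => w (padicValNat p d)) (ppow p i), fun k => ?_⟩
  rw [← ghost_ppow, ghost_ghostInv, padicValNat_ppow]

end Rational

theorem gh_commute {x x' : ℕ → R} (h : ∀ i j, Commute (x i) (x' j)) (k l : ℕ) :
    Commute (gh p x k) (gh p x' l) := by
  refine Commute.sum_left _ _ _ fun i _ => Commute.sum_right _ _ _ fun j _ => ?_
  refine Commute.mul_left ?_ (Commute.mul_right ?_ ((h i j).pow_pow _ _))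
  · exact ((Nat.cast_commute p _).pow_left _)
  · exact ((Nat.commute_cast _ p).pow_right _)

end Ghost

section Weyl

variable {J : Type*} (r : J → ℚ)

/-- Multiplication by the first family of variables. -/
def weylW (j : J) : Module.End ℚ (MvPolynomial (J ⊕ J) ℚ) :=
  Algebra.lmul ℚ (MvPolynomial (J ⊕ J) ℚ) (MvPolynomial.X (Sum.inl j))

/-- Multiplication by the second family of variables, twisted by derivations. -/
def weylV (j : J) : Module.End ℚ (MvPolynomial (J ⊕ J) ℚ) :=
  Algebra.lmul ℚ (MvPolynomial (J ⊕ J) ℚ) (MvPolynomial.X (Sum.inr j)) +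
    r j • (MvPolynomial.pderiv (Sum.inl j)).toLinearMap

theorem weylW_apply (j : J) (f : MvPolynomial (J ⊕ J) ℚ) :
    weylW j f = MvPolynomial.X (Sum.inl j) * f := rfl

theorem weylV_apply (j : J) (f : MvPolynomial (J ⊕ J) ℚ) :
    weylV r j f = MvPolynomial.X (Sum.inr j) * f + r j • MvPolynomial.pderiv (Sum.inl j) f := rfl

theorem pderiv_pderiv_comm {σ : Type*} (i j : σ) (f : MvPolynomial σ ℚ) :
    MvPolynomial.pderiv i (MvPolynomial.pderiv j f) =
      MvPolynomial.pderiv j (MvPolynomial.pderiv i f) := by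
  classical
  have : ⁅(MvPolynomial.pderiv i : Derivation ℚ (MvPolynomial σ ℚ) (MvPolynomial σ ℚ)),
      (MvPolynomial.pderiv j : Derivation ℚ (MvPolynomial σ ℚ) (MvPolynomial σ ℚ))⁆ = 0 := by
    refine MvPolynomial.derivation_ext fun k => ?_
    rw [Derivation.commutator_apply, MvPolynomial.pderiv_X, MvPolynomial.pderiv_X]
    simp only [Pi.single_apply]
    split_ifs <;> simp
  have := DFunLike.congr_fun this f
  rw [Derivation.commutator_apply] at this
  exact sub_eq_zero.1 this

theorem weylW_comm (j k : J) : weylW j * weylW k = weylW k * weylW j := by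
  simp only [weylW, ← map_mul, mul_comm]

theorem weylV_comm (j k : J) : weylV r j * weylV r k = weylV r k * weylV r j := by
  classical
  refine LinearMap.ext fun f => ?_
  simp only [Module.End.mul_apply, weylV_apply, map_add, Derivation.leibniz,
    MvPolynomial.pderiv_X, Pi.single_apply, map_smul, pderiv_pderiv_comm (Sum.inl k) (Sum.inl j)]
  simp only [reduceCtorEq, if_false, mul_zero, add_zero, smul_eq_mul, smul_add]
  rw [smul_comm (r k) (r j)]
  ring

theorem weylV_weylW [DecidableEq J] (j k : J) :
    weylV r j * weylW k = weylW k * weylV r j + if j = k then algebraMap ℚ _ (r j) else 0 := by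
  refine LinearMap.ext fun f => ?_
  simp only [Module.End.mul_apply, weylV_apply, weylW_apply, Derivation.leibniz,
    MvPolynomial.pderiv_X, Pi.single_apply, LinearMap.add_apply]
  by_cases h : j = k
  · subst h
    simp only [if_true, smul_eq_mul, mul_one, smul_add, Module.algebraMap_end_apply,
      mul_add, mul_smul_comm]
    ring
  · simp only [h, Sum.inl.injEq, Ne.symm h, if_false, mul_zero, add_zero, smul_eq_mul, mul_add,
      mul_smul_comm, LinearMap.zero_apply]
    ring

end Weyl

/-- Images of the generators of `BQ`. -/
theorem exists_BQ_hom {E : Type*} [Ring E] [Algebra ℚ E] (x y : ℕ+ → E)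
    (hx : ∀ k l, ghost x k * ghost x l = ghost x l * ghost x k)
    (hy : ∀ k l, ghost y k * ghost y l = ghost y l * ghost y k)
    (hyx : ∀ k l, ghost y l * ghost x k =
      ghost x k * ghost y l + if k = l then ((k : ℕ) : E) else 0) :
    ∃ f : BQ →ₐ[ℚ] E, (∀ d, f (bx d) = x d) ∧ ∀ d, f (by' d) = y d := by
  let g : FreeAlgebra ℚ (ℕ+ ⊕ ℕ+) →ₐ[ℚ] E := FreeAlgebra.lift ℚ (Sum.elim x y)
  have gx (k) : g (ghost bXf k) = ghost x k := by
    rw [← AlgHom.coe_toRingHom, map_ghost]; congr 1; ext d; simp [g, bXf]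
  have gy (k) : g (ghost bYf k) = ghost y k := by
    rw [← AlgHom.coe_toRingHom, map_ghost]; congr 1; ext d; simp [g, bYf]
  refine ⟨RingQuot.liftAlgHom ℚ ⟨g, ?_⟩, ?_, ?_⟩
  · intro a b h
    cases h with
    | xx k l => simp only [map_mul, gx, hx]
    | yy k l => simp only [map_mul, gy]; exact hy k l
    | yx k l =>
      simp only [map_mul, map_add, gx, gy, hyx]
      split_ifs <;> simp
  · intro d
    rw [bx, RingQuot.liftAlgHom_mkAlgHom_apply]; simp [g, bXf]
  · intro d
    rw [by', RingQuot.liftAlgHom_mkAlgHom_apply]; simp [g, bYf]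

instance BQ_nontrivial : Nontrivial BQ := by
  obtain ⟨f, -⟩ := exists_BQ_hom (E := Module.End ℚ (MvPolynomial (ℕ+ ⊕ ℕ+) ℚ))
    (ghostInv weylW) (ghostInv (weylV fun k : ℕ+ => (k : ℕ)))
    (fun k l => by simp only [ghost_ghostInv]; exact weylW_comm k l)
    (fun k l => by simp only [ghost_ghostInv]; exact weylV_comm _ k l)
    (fun k l => by
      simp only [ghost_ghostInv]
      rw [weylV_weylW]
      simp only [eq_comm (a := k)]
      split_ifs with h
      · subst h; simp
      · rfl)
  exact f.toRingHom.domain_nontrivial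

theorem ghost_bx_comm (k l : ℕ+) : ghost bx k * ghost bx l = ghost bx l * ghost bx k := by
  have (k : ℕ+) : ghost bx k = RingQuot.mkAlgHom ℚ BRel (ghost bXf k) :=
    (map_ghost (RingQuot.mkAlgHom ℚ BRel).toRingHom bXf k).symm
  simp only [this, ← map_mul]
  exact RingQuot.mkAlgHom_rel ℚ (BRel.xx k l)

theorem ghost_by_comm (k l : ℕ+) : ghost by' k * ghost by' l = ghost by' l * ghost by' k := by
  have (k : ℕ+) : ghost by' k = RingQuot.mkAlgHom ℚ BRel (ghost bYf k) :=
    (map_ghost (RingQuot.mkAlgHom ℚ BRel).toRingHom bYf k).symm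
  simp only [this, ← map_mul]
  exact RingQuot.mkAlgHom_rel ℚ (BRel.yy k l)

theorem ghost_by_bx (k l : ℕ+) : ghost by' l * ghost bx k =
    ghost bx k * ghost by' l + if k = l then ((k : ℕ) : BQ) else 0 := by
  have h1 (k : ℕ+) : ghost by' k = RingQuot.mkAlgHom ℚ BRel (ghost bYf k) :=
    (map_ghost (RingQuot.mkAlgHom ℚ BRel).toRingHom bYf k).symm
  have h2 (k : ℕ+) : ghost bx k = RingQuot.mkAlgHom ℚ BRel (ghost bXf k) :=
    (map_ghost (RingQuot.mkAlgHom ℚ BRel).toRingHom bXf k).symm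
  simp only [h1, h2, ← map_mul]
  rw [RingQuot.mkAlgHom_rel ℚ (BRel.yx k l)]
  split_ifs <;> simp

/-- The relations of `B_{m,n}` for sequences of elements of a ring. -/
structure IsB {R : Type*} [Ring R] (p : ℕ) (c : ℕ+ → ℕ+ → MvPolynomial (ℕ+ ⊕ₗ ℕ+) ℤ) (m n : ℕ)
    (x y : ℕ → R) : Prop where
  xx : ∀ i i', i < m → i' < m → Commute (x i) (x i')
  yy : ∀ j j', j < n → j' < n → Commute (y j) (y j')
  yx : ∀ i j, i < m → j < n → y j * x i = x i * y j +
    cEval (fun d => x (padicValNat p d)) (fun e => y (padicValNat p e)) (c (ppow p i) (ppow p j))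

/-- The Heisenberg relations between ghost components. -/
structure HeisP {R : Type*} [Ring R] (p : ℕ) (x y : ℕ → R) : Prop where
  xx : ∀ k l, Commute (gh p x k) (gh p x l)
  yy : ∀ k l, Commute (gh p y k) (gh p y l)
  yx : ∀ k l, gh p y l * gh p x k = gh p x k * gh p y l + if k = l then (p : R) ^ k else 0

section Heisenberg

variable {p : ℕ} [hp : Fact p.Prime] {c : ℕ+ → ℕ+ → MvPolynomial (ℕ+ ⊕ₗ ℕ+) ℤ}

theorem commute_of_gh_gh {R : Type*} [Ring R] [Algebra ℚ R] {x y : ℕ → R}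
    (h : ∀ k l, Commute (gh p x k) (gh p y l)) (i j : ℕ) : Commute (x i) (y j) :=
  (commute_of_gh p (fun l => (commute_of_gh p (fun k => (h k l).symm) i).symm) j)

theorem IsCFamily.x_dvd (hc : IsCFamily c) {m n d : ℕ+}
    (hd : toLex (Sum.inl d) ∈ (c m n).vars) : (d : ℕ) ∣ m ∧ d ≠ m := by
  rcases (hc m n).1 _ hd with ⟨e, h1, h2, h3⟩ | ⟨e, h1, h2, h3⟩
  · simp at h3; subst h3; exact ⟨h1, h2⟩
  · simp at h3

theorem IsCFamily.y_dvd (hc : IsCFamily c) {m n d : ℕ+}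
    (hd : toLex (Sum.inr d) ∈ (c m n).vars) : (d : ℕ) ∣ n ∧ d ≠ n := by
  rcases (hc m n).1 _ hd with ⟨e, h1, h2, h3⟩ | ⟨e, h1, h2, h3⟩
  · simp at h3
  · simp at h3; subst h3; exact ⟨h1, h2⟩

theorem IsCFamily.x_lt (hc : IsCFamily c) {i j : ℕ} {d : ℕ+}
    (hd : toLex (Sum.inl d) ∈ (c (ppow p i) (ppow p j)).vars) : padicValNat p d < i := by
  obtain ⟨h1, h2⟩ := hc.x_dvd hd
  obtain ⟨k, hk, rfl⟩ := exists_ppow_of_dvd p h1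
  rw [padicValNat_ppow]
  exact lt_of_le_of_ne hk fun h => h2 (h ▸ rfl)

theorem IsCFamily.y_lt (hc : IsCFamily c) {i j : ℕ} {d : ℕ+}
    (hd : toLex (Sum.inr d) ∈ (c (ppow p i) (ppow p j)).vars) : padicValNat p d < j := by
  obtain ⟨h1, h2⟩ := hc.y_dvd hd
  obtain ⟨k, hk, rfl⟩ := exists_ppow_of_dvd p h1
  rw [padicValNat_ppow]
  exact lt_of_le_of_ne hk fun h => h2 (h ▸ rfl)

theorem HeisP.isB (hc : IsCFamily c) {R : Type*} [Ring R] [Algebra ℚ R] {x y : ℕ → R}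
    (h : HeisP p x y) (m n : ℕ) : IsB p c m n x y := by
  refine ⟨fun i i' _ _ => commute_of_gh_gh h.xx i i', fun i i' _ _ => commute_of_gh_gh h.yy i i',
    fun i j _ _ => ?_⟩
  classical
  let ι : R →ₐ[ℚ] R ⊗[ℚ] BQ := Algebra.TensorProduct.includeLeft
  have hι : Function.Injective ι :=
    Algebra.TensorProduct.includeLeft_injective (S := ℚ) (algebraMap ℚ BQ).injective
  let W (u : ℕ → R) (b : ℕ+ → BQ) (k : ℕ+) : R ⊗[ℚ] BQ :=
    if k = ppow p (padicValNat p k) then ι (gh p u (padicValNat p k)) else 1 ⊗ₜ ghost b k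
  have hW (u : ℕ → R) (b : ℕ+ → BQ) (i : ℕ) : ghostInv (W u b) (ppow p i) = ι (u i) := by
    refine eq_of_gh_eq p (x := fun i => ghostInv (W u b) (ppow p i)) (x' := fun i => ι (u i))
      (N := i) (fun k _ => ?_) i le_rfl
    rw [← ghost_ppow, ghost_ghostInv]
    simp only [W, padicValNat_ppow, if_true]
    exact map_gh p ι.toRingHom u k
  have comm (u u' : R) (b b' : BQ) (hu : u * u' = u' * u) (hb : b * b' = b' * b) :
      (u ⊗ₜ[ℚ] b) * (u' ⊗ₜ[ℚ] b') = (u' ⊗ₜ b') * (u ⊗ₜ b) := by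
    simp [hu, hb]
  obtain ⟨f, fx, fy⟩ := exists_BQ_hom (ghostInv (W x bx)) (ghostInv (W y by'))
    (fun k l => by
      simp only [ghost_ghostInv, W]
      split_ifs
      · exact comm _ _ _ _ (h.xx _ _) rfl
      · exact comm _ _ _ _ (by simp) (by simp)
      · exact comm _ _ _ _ (by simp) (by simp)
      · exact comm _ _ _ _ rfl (ghost_bx_comm _ _))
    (fun k l => by
      simp only [ghost_ghostInv, W]
      split_ifs
      · exact comm _ _ _ _ (h.yy _ _) rfl
      · exact comm _ _ _ _ (by simp) (by simp)
      · exact comm _ _ _ _ (by simp) (by simp)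
      · exact comm _ _ _ _ rfl (ghost_by_comm _ _))
    (fun k l => by
      simp only [ghost_ghostInv, W]
      by_cases hk : k = ppow p (padicValNat p k) <;> by_cases hl : l = ppow p (padicValNat p l)
      · rw [if_pos hk, if_pos hl, ← map_mul, h.yx, map_add, map_mul]
        congr 1
        by_cases e : k = l
        · subst e
          rw [if_pos rfl, if_pos rfl, hk, padicValNat_ppow, coe_ppow]; simp
        · rw [if_neg e, if_neg, map_zero]
          intro e'; apply e; rw [hk, hl, e']
      · rw [if_pos hk, if_neg hl, if_neg (by rintro rfl; exact hl hk), add_zero]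
        exact comm _ _ _ _ (by simp) (by simp)
      · rw [if_neg hk, if_pos hl, if_neg (by rintro rfl; exact hk hl), add_zero]
        exact comm _ _ _ _ (by simp) (by simp)
      · rw [if_neg hk, if_neg hl]
        simp only [Algebra.TensorProduct.tmul_mul_tmul, mul_one]
        rw [ghost_by_bx, TensorProduct.tmul_add]
        congr 1
        split_ifs
        · exact (map_natCast (Algebra.TensorProduct.includeRight : BQ →ₐ[ℚ] R ⊗[ℚ] BQ) _)
        · simp)
  have key := congrArg f (hc (ppow p i) (ppow p j)).2
  rw [← AlgHom.coe_toRingHom, map_cEval] at key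
  simp only [AlgHom.coe_toRingHom, map_sub, map_mul, fx, fy, hW] at key
  apply hι
  rw [map_add, map_mul, map_mul, ← AlgHom.coe_toRingHom ι, map_cEval]
  simp only [AlgHom.coe_toRingHom]
  rw [← sub_eq_iff_eq_add', ← key]
  refine cEval_congr (fun d hd => ?_) fun d hd => ?_
  · obtain ⟨k, -, rfl⟩ := exists_ppow_of_dvd p (hc.x_dvd hd).1
    rw [hW, padicValNat_ppow]
  · obtain ⟨k, -, rfl⟩ := exists_ppow_of_dvd p (hc.y_dvd hd).1
    rw [hW, padicValNat_ppow]

end Heisenberg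

section Spanning

variable {σ τ R S : Type*} [Ring R] [Ring S]

theorem tensorEquivSum_tmul (f : MvPolynomial σ ℤ) (g : MvPolynomial τ ℤ) :
    MvPolynomial.tensorEquivSum ℤ σ τ ℤ (f ⊗ₜ g) =
      MvPolynomial.rename Sum.inl f * MvPolynomial.rename Sum.inr g := by
  have h1 : ((MvPolynomial.tensorEquivSum ℤ σ τ ℤ).toAlgHom.comp
      Algebra.TensorProduct.includeLeft) = MvPolynomial.rename Sum.inl :=
    MvPolynomial.algHom_ext fun i => by simp
  have h2 : ((MvPolynomial.tensorEquivSum ℤ σ τ ℤ).toAlgHom.comp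
      Algebra.TensorProduct.includeRight) = MvPolynomial.rename Sum.inr :=
    MvPolynomial.algHom_ext fun i => by simp
  rw [← h1, ← h2]
  simp [← map_mul]

/-- Evaluation of a polynomial in two commuting families, the values of the first family
being multiplied to the left of the values of the second family. -/
def nuEval (x : σ → R) (y : τ → R) : MvPolynomial (σ ⊕ τ) ℤ →ₗ[ℤ] R :=
  TensorProduct.lift ((LinearMap.mul ℤ R).compl₁₂ (ncEval x) (ncEval y)) ∘ₗ
    (MvPolynomial.tensorEquivSum ℤ σ τ ℤ).symm.toLinearMap

theorem nuEval_mul (x : σ → R) (y : τ → R) (f : MvPolynomial σ ℤ) (g : MvPolynomial τ ℤ) :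
    nuEval x y (MvPolynomial.rename Sum.inl f * MvPolynomial.rename Sum.inr g) =
      ncEval x f * ncEval y g := by
  have : (MvPolynomial.tensorEquivSum ℤ σ τ ℤ).symm
      (MvPolynomial.rename Sum.inl f * MvPolynomial.rename Sum.inr g) = f ⊗ₜ g := by
    rw [AlgEquiv.symm_apply_eq, tensorEquivSum_tmul]
  simp [nuEval, this]

theorem induction_sum {P : MvPolynomial (σ ⊕ τ) ℤ → Prop}
    (mul : ∀ f g, P (MvPolynomial.rename Sum.inl f * MvPolynomial.rename Sum.inr g))
    (add : ∀ q r, P q → P r → P (q + r)) (q : MvPolynomial (σ ⊕ τ) ℤ) : P q := by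
  obtain ⟨t, rfl⟩ := (MvPolynomial.tensorEquivSum ℤ σ τ ℤ).surjective q
  induction t with
  | zero => rw [map_zero]; simpa using mul 0 0
  | tmul f g => rw [tensorEquivSum_tmul]; exact mul f g
  | add a b ha hb => rw [map_add]; exact add _ _ ha hb

theorem map_nuEval (F : R →+* S) (x : σ → R) (y : τ → R) (q : MvPolynomial (σ ⊕ τ) ℤ) :
    F (nuEval x y q) = nuEval (fun s => F (x s)) (fun s => F (y s)) q := by
  induction q using induction_sum with
  | mul f g => simp only [nuEval_mul, map_mul, map_ncEval]
  | add q r hq hr => simp only [map_add, hq, hr]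

theorem ncEval_rename {σ' : Type*} (x : σ → R) (a : σ' → σ) (hx : ∀ s t, x s * x t = x t * x s)
    (f : MvPolynomial σ' ℤ) :
    ncEval x (MvPolynomial.rename a f) = ncEval (fun s => x (a s)) f := by
  rw [← commHom_apply x hx, ← commHom_apply (fun s => x (a s)) (fun _ _ => hx _ _)]
  refine DFunLike.congr_fun (f := (commHom x hx).comp (MvPolynomial.rename a).toRingHom) ?_ f
  refine MvPolynomial.ringHom_ext (fun r => by simp) fun s => ?_
  simp [commHom_apply, ncEval_X]

theorem nuEval_rename {σ' τ' : Type*} (x : σ → R) (y : τ → R) (a : σ' → σ) (b : τ' → τ)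
    (hx : ∀ s t, x s * x t = x t * x s) (hy : ∀ s t, y s * y t = y t * y s)
    (q : MvPolynomial (σ' ⊕ τ') ℤ) :
    nuEval x y (MvPolynomial.rename (Sum.map a b) q) =
      nuEval (fun s => x (a s)) (fun s => y (b s)) q := by
  induction q using induction_sum with
  | mul f g =>
    rw [nuEval_mul, map_mul, MvPolynomial.rename_rename, MvPolynomial.rename_rename,
      ← ncEval_rename _ _ hx, ← ncEval_rename _ _ hy, ← nuEval_mul, MvPolynomial.rename_rename,
      MvPolynomial.rename_rename]
    rfl
  | add q r hq hr => simp only [map_add, hq, hr]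

/-- Reordering: the subring generated by two commuting families is spanned by ordered products
as soon as the commutators lie in subrings generated by elements of lower level. -/
theorem mem_range_nuEval {x : σ → R} {y : τ → R} (lev : τ → ℕ)
    (hx : ∀ s t, x s * x t = x t * x s) (hy : ∀ s t, y s * y t = y t * y s)
    (hyx : ∀ t s, y t * x s - x s * y t ∈
      Subring.closure (Set.range x ∪ y '' {t' | lev t' < lev t}))
    {r : R} (hr : r ∈ Subring.closure (Set.range x ∪ Set.range y)) :
    ∃ q, nuEval x y q = r := by
  let M := LinearMap.range (nuEval x y)
  have gen (f g) : ncEval x f * ncEval y g ∈ M := ⟨_, nuEval_mul x y f g⟩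
  have ind {P : R → Prop} (h1 : ∀ f g, P (ncEval x f * ncEval y g))
      (h2 : ∀ a b, P a → P b → P (a + b)) (w : R) (hw : w ∈ M) : P w := by
    obtain ⟨q, rfl⟩ := hw
    induction q using induction_sum with
    | mul f g => rw [nuEval_mul]; exact h1 f g
    | add q r hq hr => rw [map_add]; exact h2 _ _ hq hr
  have XM (f) (w) (hw : w ∈ M) : ncEval x f * w ∈ M := by
    refine ind (P := fun w => ncEval x f * w ∈ M) (fun f' g => ?_) (fun a b ha hb => ?_) w hw
    · rw [← mul_assoc, ← ncEval_mul hx]; exact gen _ _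
    · rw [mul_add]; exact M.add_mem ha hb
  have MY (g) (w) (hw : w ∈ M) : w * ncEval y g ∈ M := by
    refine ind (P := fun w => w * ncEval y g ∈ M) (fun f' g' => ?_) (fun a b ha hb => ?_) w hw
    · rw [mul_assoc, ← ncEval_mul hy]; exact gen _ _
    · rw [add_mul]; exact M.add_mem ha hb
  let G : Subring R :=
    { carrier := {r | ∀ w ∈ M, r * w ∈ M}
      mul_mem' := fun {a b} ha hb w hw => by rw [mul_assoc]; exact ha _ (hb _ hw)
      one_mem' := fun w hw => by rwa [one_mul]
      add_mem' := fun {a b} ha hb w hw => by rw [add_mul]; exact M.add_mem (ha _ hw) (hb _ hw)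
      zero_mem' := fun w hw => by rw [zero_mul]; exact M.zero_mem
      neg_mem' := fun {a} ha w hw => by rw [neg_mul]; exact M.neg_mem (ha _ hw) }
  have xG (s) : x s ∈ G := fun w hw => by rw [← ncEval_X x s]; exact XM _ w hw
  have yG (k : ℕ) : ∀ t, lev t = k → y t ∈ G := by
    induction k using Nat.strong_induction_on with
    | _ k ih =>
      intro t ht w hw
      have hle : Subring.closure (Set.range x ∪ y '' {t' | lev t' < lev t}) ≤ G := by
        rw [Subring.closure_le]
        rintro _ (⟨s, rfl⟩ | ⟨t', h, rfl⟩)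
        · exact xG s
        · exact ih _ (ht ▸ h) t' rfl
      have yf (f) : y t * ncEval x f ∈ M := by
        induction f using MvPolynomial.induction_on with
        | C a =>
          have : y t * ncEval x (MvPolynomial.C a) = a • (ncEval x 1 * ncEval y (.X t)) := by
            rw [← mul_one (MvPolynomial.C a), ← MvPolynomial.smul_eq_C_mul, map_smul, ncEval_one,
              ncEval_X, one_mul, mul_smul_comm, mul_one]
          rw [this]
          exact M.smul_mem _ (gen _ _)
        | add f g hf hg => rw [map_add, mul_add]; exact M.add_mem hf hg
        | mul_X f s hf =>
          have : y t * ncEval x (f * .X s) = x s * (y t * ncEval x f) +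
              (y t * x s - x s * y t) * ncEval x f := by
            rw [mul_comm, ncEval_mul hx, ncEval_X]; noncomm_ring
          rw [this]
          refine M.add_mem (xG s _ hf) (hle (hyx t s) _ ?_)
          simpa [ncEval_one] using gen f 1
      refine ind (P := fun w => y t * w ∈ M) (fun f g => ?_) (fun a b ha hb => ?_) w hw
      · rw [← mul_assoc]; exact MY _ _ (yf f)
      · rw [mul_add]; exact M.add_mem ha hb
  have hle : Subring.closure (Set.range x ∪ Set.range y) ≤ G := by
    rw [Subring.closure_le]
    rintro _ (⟨s, rfl⟩ | ⟨t, rfl⟩)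
    · exact xG s
    · exact yG _ t rfl
  have := hle hr 1 (by simpa [ncEval_one] using gen 1 1)
  rwa [mul_one] at this

end Spanning

theorem ncEval_eq_aeval' {σ R : Type*} [CommRing R] [inst : Algebra ℤ R] (z : σ → R)
    (q : MvPolynomial σ ℤ) : ncEval z q = MvPolynomial.aeval z q := by
  obtain rfl := Subsingleton.elim inst (Ring.toIntAlgebra R)
  exact ncEval_eq_aeval z q

section Universal

variable (p : ℕ) [hp : Fact p.Prime] (I : Type)

/-- The polynomial ring on which the universal operators act. -/
abbrev UP : Type := MvPolynomial ((I × ℕ) ⊕ (I × ℕ)) ℚ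

/-- Polynomials with ghost components the first family of variables. -/
def uxi (b : I) : ℕ → UP I :=
  (exists_gh_eq p fun k => (MvPolynomial.X (Sum.inl (b, k)) : UP I)).choose

/-- Polynomials with ghost components the second family of variables. -/
def ueta (b : I) : ℕ → MvPolynomial (I × ℕ) ℚ :=
  (exists_gh_eq p fun k => (MvPolynomial.X (b, k) : MvPolynomial (I × ℕ) ℚ)).choose

/-- The universal operators `x`. -/
def ux (b : I) (k : ℕ) : Module.End ℚ (UP I) := Algebra.lmul ℚ (UP I) (uxi p I b k)

/-- The universal operators `y`. -/
def uy (b : I) : ℕ → Module.End ℚ (UP I) :=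
  (exists_gh_eq p fun k => weylV (fun t : I × ℕ => (p : ℚ) ^ t.2) (b, k)).choose

theorem gh_uxi (b : I) (k : ℕ) : gh p (uxi p I b) k = MvPolynomial.X (Sum.inl (b, k)) :=
  (exists_gh_eq p fun k => (MvPolynomial.X (Sum.inl (b, k)) : UP I)).choose_spec k

theorem gh_ueta (b : I) (k : ℕ) : gh p (ueta p I b) k = MvPolynomial.X (b, k) :=
  (exists_gh_eq p fun k => (MvPolynomial.X (b, k) : MvPolynomial (I × ℕ) ℚ)).choose_spec k

theorem gh_uy (b : I) (k : ℕ) :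
    gh p (uy p I b) k = weylV (fun t : I × ℕ => (p : ℚ) ^ t.2) (b, k) :=
  (exists_gh_eq p fun k => weylV (fun t : I × ℕ => (p : ℚ) ^ t.2) (b, k)).choose_spec k

theorem gh_ux (b : I) (k : ℕ) : gh p (ux p I b) k = weylW (b, k) := by
  rw [weylW, ← gh_uxi p]
  exact (map_gh p (Algebra.lmul ℚ (UP I)).toRingHom (uxi p I b) k).symm

theorem gh_ux_comm (b b' : I) (k l : ℕ) :
    Commute (gh p (ux p I b) k) (gh p (ux p I b') l) := by
  rw [gh_ux, gh_ux]; exact weylW_comm _ _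

theorem gh_uy_comm (b b' : I) (k l : ℕ) :
    Commute (gh p (uy p I b) k) (gh p (uy p I b') l) := by
  rw [gh_uy, gh_uy]; exact weylV_comm _ _ _

theorem gh_uy_ux [DecidableEq I] (b b' : I) (k l : ℕ) : gh p (uy p I b') l * gh p (ux p I b) k =
    gh p (ux p I b) k * gh p (uy p I b') l +
      if b = b' ∧ k = l then (p : Module.End ℚ (UP I)) ^ k else 0 := by
  rw [gh_uy, gh_ux, weylV_weylW]
  simp only [Prod.mk.injEq, eq_comm (a := b), eq_comm (a := k)]
  congr 1
  split_ifs with h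
  · obtain ⟨-, rfl⟩ := h; simp
  · rfl

theorem ux_comm (b b' : I) (k l : ℕ) : Commute (ux p I b k) (ux p I b' l) :=
  commute_of_gh_gh (gh_ux_comm p I b b') k l

theorem uy_comm (b b' : I) (k l : ℕ) : Commute (uy p I b k) (uy p I b' l) :=
  commute_of_gh_gh (gh_uy_comm p I b b') k l

theorem heisP_u (b : I) : HeisP p (ux p I b) (uy p I b) := by
  classical
  exact ⟨gh_ux_comm p I b b, gh_uy_comm p I b b, fun k l => by simpa using gh_uy_ux p I b b k l⟩

theorem uy_apply (b : I) (k : ℕ) (f : MvPolynomial (I × ℕ) ℚ) :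
    uy p I b k (MvPolynomial.rename Sum.inr f) =
      MvPolynomial.rename Sum.inr (ueta p I b k * f) := by
  let ρ : MvPolynomial (I × ℕ) ℚ →ₐ[ℚ] UP I := MvPolynomial.rename Sum.inr
  let S : Subalgebra ℚ (Module.End ℚ (UP I) × MvPolynomial (I × ℕ) ℚ) :=
    { carrier := {a | ∀ f, a.1 (ρ f) = ρ (a.2 * f)}
      mul_mem' := fun {a b} ha hb f => by
        simp only [Prod.fst_mul, Prod.snd_mul, Module.End.mul_apply]
        rw [hb, ha, mul_assoc]
      add_mem' := fun {a b} ha hb f => by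
        simp only [Prod.fst_add, Prod.snd_add, LinearMap.add_apply, add_mul, map_add]
        rw [hb, ha]
      algebraMap_mem' := fun r f => by
        simp [Algebra.algebraMap_eq_smul_one] }
  refine mem_of_gh_mem p S (x := fun k => (uy p I b k, ueta p I b k)) (N := k)
    (fun k _ f => ?_) k le_rfl f
  have h1 : (gh p (fun k => (uy p I b k, ueta p I b k)) k).1 = gh p (uy p I b) k :=
    map_gh p (RingHom.fst _ _) (fun k => (uy p I b k, ueta p I b k)) k
  have h2 : (gh p (fun k => (uy p I b k, ueta p I b k)) k).2 = gh p (ueta p I b) k :=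
    map_gh p (RingHom.snd _ _) (fun k => (uy p I b k, ueta p I b k)) k
  rw [h1, h2, gh_uy, gh_ueta, weylV_apply]
  have : MvPolynomial.pderiv (Sum.inl (b, k)) (ρ f) = 0 := by
    induction f using MvPolynomial.induction_on with
    | C a => simp [ρ]
    | add f g hf hg => simp [hf, hg]
    | mul_X f s hf => simp [hf, ρ, Derivation.leibniz] at hf ⊢
  rw [this]
  simp [ρ]

theorem ncEval_ux_apply (f : MvPolynomial (I × ℕ) ℤ) (w : UP I) :
    ncEval (fun t : I × ℕ => ux p I t.1 t.2) f w =
      MvPolynomial.aeval (fun t : I × ℕ => uxi p I t.1 t.2) f * w := by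
  rw [← ncEval_eq_aeval']
  have := map_ncEval (Algebra.lmul ℚ (UP I)).toRingHom (fun t : I × ℕ => uxi p I t.1 t.2) f
  exact (DFunLike.congr_fun this w).symm

theorem ncEval_uy_apply (f : MvPolynomial (I × ℕ) ℤ) (w : MvPolynomial (I × ℕ) ℚ) :
    ncEval (fun t : I × ℕ => uy p I t.1 t.2) f (MvPolynomial.rename Sum.inr w) =
      MvPolynomial.rename Sum.inr
        (MvPolynomial.aeval (fun t : I × ℕ => ueta p I t.1 t.2) f * w) := by
  have hc : ∀ s t : I × ℕ, uy p I s.1 s.2 * uy p I t.1 t.2 = uy p I t.1 t.2 * uy p I s.1 s.2 :=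
    fun s t => uy_comm p I _ _ _ _
  induction f using MvPolynomial.induction_on generalizing w with
  | C a =>
    rw [← mul_one (MvPolynomial.C a), ← MvPolynomial.smul_eq_C_mul, map_smul, ncEval_one]
    simp
  | add f g hf hg => simp [hf, hg, add_mul]
  | mul_X f s hf =>
    rw [ncEval_mul hc, ncEval_X, Module.End.mul_apply, uy_apply, hf, map_mul (MvPolynomial.aeval _),
      MvPolynomial.aeval_X, mul_assoc]

theorem nuEval_u_apply (q : MvPolynomial ((I × ℕ) ⊕ (I × ℕ)) ℤ) :
    nuEval (fun t : I × ℕ => ux p I t.1 t.2) (fun t : I × ℕ => uy p I t.1 t.2) q 1 =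
      MvPolynomial.aeval (Sum.elim (fun t : I × ℕ => uxi p I t.1 t.2)
        (fun t : I × ℕ => MvPolynomial.rename Sum.inr (ueta p I t.1 t.2))) q := by
  induction q using induction_sum with
  | mul f g =>
    have : (1 : UP I) = MvPolynomial.rename Sum.inr (1 : MvPolynomial (I × ℕ) ℚ) := by simp
    rw [nuEval_mul, Module.End.mul_apply, ncEval_ux_apply, this, ncEval_uy_apply, mul_one, map_mul,
      MvPolynomial.aeval_rename, MvPolynomial.aeval_rename]
    congr 1
    have := MvPolynomial.comp_aeval (R := ℤ) (fun t : I × ℕ => ueta p I t.1 t.2)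
      ((MvPolynomial.rename Sum.inr : MvPolynomial (I × ℕ) ℚ →ₐ[ℚ] UP I).restrictScalars ℤ)
    exact DFunLike.congr_fun this g
  | add q r hq hr => simp [hq, hr]

theorem nuEval_u_injective : Function.Injective
    (nuEval (fun t : I × ℕ => ux p I t.1 t.2) (fun t : I × ℕ => uy p I t.1 t.2)) := by
  let ψ : UP I →ₐ[ℚ] UP I := MvPolynomial.aeval (Sum.elim
    (fun t => gh p (fun k => MvPolynomial.X (Sum.inl (t.1, k))) t.2)
    (fun t => gh p (fun k => MvPolynomial.X (Sum.inr (t.1, k))) t.2))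
  have h1 (b k) : ψ (uxi p I b k) = MvPolynomial.X (Sum.inl (b, k)) := by
    refine eq_of_gh_eq p (x := fun k => ψ (uxi p I b k))
      (x' := fun k => MvPolynomial.X (Sum.inl (b, k))) (N := k) (fun k _ => ?_) k le_rfl
    refine (map_gh p ψ.toRingHom (uxi p I b) k).symm.trans ?_
    rw [gh_uxi]
    simp [ψ]
  have h2 (b k) : ψ (MvPolynomial.rename Sum.inr (ueta p I b k)) =
      MvPolynomial.X (Sum.inr (b, k)) := by
    refine eq_of_gh_eq p (x := fun k => ψ (MvPolynomial.rename Sum.inr (ueta p I b k)))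
      (x' := fun k => MvPolynomial.X (Sum.inr (b, k))) (N := k) (fun k _ => ?_) k le_rfl
    refine (map_gh p (ψ.comp (MvPolynomial.rename Sum.inr)).toRingHom (ueta p I b) k).symm.trans ?_
    rw [gh_ueta]
    simp [ψ]
  intro q q' h
  have h := congrArg (fun r => ψ (r 1)) h
  simp only [nuEval_u_apply] at h
  have key (q) : ψ (MvPolynomial.aeval (Sum.elim (fun t : I × ℕ => uxi p I t.1 t.2)
        (fun t : I × ℕ => MvPolynomial.rename Sum.inr (ueta p I t.1 t.2))) q) =
      MvPolynomial.map (Int.castRingHom ℚ) q := by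
    refine DFunLike.congr_fun (f := ψ.toRingHom.comp (MvPolynomial.aeval (R := ℤ) (Sum.elim
      (fun t : I × ℕ => uxi p I t.1 t.2)
        (fun t : I × ℕ => MvPolynomial.rename Sum.inr (ueta p I t.1 t.2)))).toRingHom) ?_ q
    refine MvPolynomial.ringHom_ext (fun r => by simp) ?_
    rintro (s | s)
    · simp [h1]
    · simp [h2]
  rw [key, key] at h
  exact MvPolynomial.map_injective _ Int.cast_injective h

end Universal

section Transfer

variable {p : ℕ} [hp : Fact p.Prime] {c : ℕ+ → ℕ+ → MvPolynomial (ℕ+ ⊕ₗ ℕ+) ℤ}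
variable {R S : Type*} [Ring R] [Ring S]

theorem IsB.of_subring (hc : IsCFamily c) {m n : ℕ} {x y : ℕ → R} {x' y' : ℕ → S}
    (h : IsB p c m n x' y') (G : Subring (R × S)) (hG : ∀ r, (r, 0) ∈ G → r = 0)
    (hx : ∀ i < m, (x i, x' i) ∈ G) (hy : ∀ j < n, (y j, y' j) ∈ G) : IsB p c m n x y := by
  refine ⟨fun i i' hi hi' => ?_, fun i i' hi hi' => ?_, fun i j hi hj => ?_⟩
  · refine sub_eq_zero.1 (hG _ ?_)
    convert G.sub_mem (G.mul_mem (hx i hi) (hx i' hi')) (G.mul_mem (hx i' hi') (hx i hi)) using 1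
    exact Prod.ext rfl (sub_eq_zero.2 (h.xx i i' hi hi')).symm
  · refine sub_eq_zero.1 (hG _ ?_)
    convert G.sub_mem (G.mul_mem (hy i hi) (hy i' hi')) (G.mul_mem (hy i' hi') (hy i hi)) using 1
    exact Prod.ext rfl (sub_eq_zero.2 (h.yy i i' hi hi')).symm
  · have hC : cEval (fun d => (x (padicValNat p d), x' (padicValNat p d)))
      (fun d => (y (padicValNat p d), y' (padicValNat p d))) (c (ppow p i) (ppow p j)) ∈ G :=
      cEval_mem G (fun d hd => hx _ ((hc.x_lt hd).trans hi))
        fun d hd => hy _ ((hc.y_lt hd).trans hj)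
    have h1 := map_cEval (RingHom.fst R S) (fun d => (x (padicValNat p d), x' (padicValNat p d)))
      (fun d => (y (padicValNat p d), y' (padicValNat p d))) (c (ppow p i) (ppow p j))
    have h2 := map_cEval (RingHom.snd R S) (fun d => (x (padicValNat p d), x' (padicValNat p d)))
      (fun d => (y (padicValNat p d), y' (padicValNat p d))) (c (ppow p i) (ppow p j))
    refine sub_eq_zero.1 (hG _ ?_)
    convert G.sub_mem (G.mul_mem (hy j hj) (hx i hi))
      (G.add_mem (G.mul_mem (hx i hi) (hy j hj)) hC) using 1
    refine Prod.ext ?_ ?_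
    · simp only [Prod.fst_sub, Prod.fst_add, Prod.fst_mul]
      rw [← RingHom.coe_fst, h1]; rfl
    · simp only [Prod.snd_sub, Prod.snd_add, Prod.snd_mul]
      rw [← RingHom.coe_snd, h2]
      exact (sub_eq_zero.2 (h.yx i j hi hj)).symm

theorem commute_of_subring (G : Subring (R × S)) (hG : ∀ r, (r, 0) ∈ G → r = 0) {a b : R}
    {a' b' : S} (ha : (a, a') ∈ G) (hb : (b, b') ∈ G) (h : Commute a' b') : Commute a b := by
  refine sub_eq_zero.1 (hG _ ?_)
  convert G.sub_mem (G.mul_mem ha hb) (G.mul_mem hb ha) using 1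
  exact Prod.ext rfl (sub_eq_zero.2 h).symm

omit hp in
theorem IsB.map {m n : ℕ} {x y : ℕ → R} (h : IsB p c m n x y) (f : R →+* S) :
    IsB p c m n (fun i => f (x i)) (fun j => f (y j)) := by
  refine ⟨fun i i' hi hi' => (h.xx i i' hi hi').map f, fun i i' hi hi' => (h.yy i i' hi hi').map f,
    fun i j hi hj => ?_⟩
  rw [← map_mul, h.yx i j hi hj, map_add, map_mul, map_cEval]

theorem IsB.congr (hc : IsCFamily c) {m n : ℕ} {x y x' y' : ℕ → R} (h : IsB p c m n x y)
    (hx : ∀ i < m, x i = x' i) (hy : ∀ j < n, y j = y' j) : IsB p c m n x' y' := by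
  refine ⟨fun i i' hi hi' => ?_, fun i i' hi hi' => ?_, fun i j hi hj => ?_⟩
  · rw [← hx i hi, ← hx i' hi']; exact h.xx i i' hi hi'
  · rw [← hy i hi, ← hy i' hi']; exact h.yy i i' hi hi'
  · rw [← hx i hi, ← hy j hj, h.yx i j hi hj]
    congr 1
    exact cEval_congr (fun d hd => hx _ ((hc.x_lt hd).trans hi))
        fun d hd => hy _ ((hc.y_lt hd).trans hj)

omit hp in
theorem IsB.mono {m n m' n' : ℕ} {x y : ℕ → R} (h : IsB p c m n x y) (hm : m' ≤ m) (hn : n' ≤ n) :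
    IsB p c m' n' x y :=
  ⟨fun i i' hi hi' => h.xx i i' (hi.trans_le hm) (hi'.trans_le hm),
    fun i i' hi hi' => h.yy i i' (hi.trans_le hn) (hi'.trans_le hn),
    fun i j hi hj => h.yx i j (hi.trans_le hm) (hj.trans_le hn)⟩

/-- Mutually commuting families of pairs of sequences satisfying the relations of `B_{m,n}`. -/
structure IsBFam {I : Type} (p : ℕ) (c : ℕ+ → ℕ+ → MvPolynomial (ℕ+ ⊕ₗ ℕ+) ℤ) (m n : I → ℕ)
    (x y : I → ℕ → R) : Prop where
  isB : ∀ b, IsB p c (m b) (n b) (x b) (y b)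
  xx : ∀ b b', b ≠ b' → ∀ i < m b, ∀ i' < m b', Commute (x b i) (x b' i')
  yy : ∀ b b', b ≠ b' → ∀ i < n b, ∀ i' < n b', Commute (y b i) (y b' i')
  yx : ∀ b b', b ≠ b' → ∀ i < n b, ∀ i' < m b', Commute (y b i) (x b' i')

variable {I : Type}

theorem isBFam_u (hc : IsCFamily c) (m n : I → ℕ) : IsBFam p c m n (ux p I) (uy p I) := by
  classical
  refine ⟨fun b => (heisP_u p I b).isB hc _ _, fun b b' _ _ _ _ _ => ux_comm p I _ _ _ _,
    fun b b' _ _ _ _ _ => uy_comm p I _ _ _ _, fun b b' h i _ i' _ =>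
      commute_of_gh_gh (p := p) (fun k l => ?_) i i'⟩
  have := gh_uy_ux p I b' b l k
  rwa [if_neg (fun h' => h h'.1.symm), add_zero] at this

variable (p I) in
/-- The subring of universal operators. -/
def uRing : Subring (Module.End ℚ (UP I)) :=
  Subring.closure (Set.range (fun t : I × ℕ => ux p I t.1 t.2) ∪
    Set.range (fun t : I × ℕ => uy p I t.1 t.2))

theorem ux_mem (b : I) (i : ℕ) : ux p I b i ∈ uRing p I :=
  Subring.subset_closure (Or.inl ⟨(b, i), rfl⟩)

theorem uy_mem (b : I) (i : ℕ) : uy p I b i ∈ uRing p I :=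
  Subring.subset_closure (Or.inr ⟨(b, i), rfl⟩)

omit hp in
theorem IsBFam.prod {m n : I → ℕ} {x y : I → ℕ → R} {x' y' : I → ℕ → S}
    (h : IsBFam p c m n x y) (h' : IsBFam p c m n x' y') :
    IsBFam p c m n (fun b i => (x b i, x' b i)) (fun b i => (y b i, y' b i)) := by
  refine ⟨fun b => ⟨fun i i' hi hi' => ?_, fun i i' hi hi' => ?_, fun i j hi hj => ?_⟩,
    fun b b' hb i hi i' hi' => ?_, fun b b' hb i hi i' hi' => ?_, fun b b' hb i hi i' hi' => ?_⟩
  · exact Prod.ext ((h.isB b).xx i i' hi hi') ((h'.isB b).xx i i' hi hi')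
  · exact Prod.ext ((h.isB b).yy i i' hi hi') ((h'.isB b).yy i i' hi hi')
  · have h1 := map_cEval (RingHom.fst R S)
      (fun d => (x b (padicValNat p d), x' b (padicValNat p d)))
      (fun d => (y b (padicValNat p d), y' b (padicValNat p d))) (c (ppow p i) (ppow p j))
    have h2 := map_cEval (RingHom.snd R S)
      (fun d => (x b (padicValNat p d), x' b (padicValNat p d)))
      (fun d => (y b (padicValNat p d), y' b (padicValNat p d))) (c (ppow p i) (ppow p j))
    refine Prod.ext ?_ ?_
    · exact ((h.isB b).yx i j hi hj).trans (congrArg _ h1.symm)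
    · exact ((h'.isB b).yx i j hi hj).trans (congrArg _ h2.symm)
  · exact Prod.ext (h.xx b b' hb i hi i' hi') (h'.xx b b' hb i hi i' hi')
  · exact Prod.ext (h.yy b b' hb i hi i' hi') (h'.yy b b' hb i hi i' hi')
  · exact Prod.ext (h.yx b b' hb i hi i' hi') (h'.yx b b' hb i hi i' hi')

/-- Reordering in the ring generated by families. -/
theorem IsBFam.mem_range (hc : IsCFamily c) {m n : I → ℕ} {x y : I → ℕ → R}
    (h : IsBFam p c m n x y) {r : R}
    (hr : r ∈ Subring.closure
      (Set.range (fun t : {t : I × ℕ // t.2 < m t.1} => x t.1.1 t.1.2) ∪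
        Set.range (fun t : {t : I × ℕ // t.2 < n t.1} => y t.1.1 t.1.2))) :
    ∃ q, nuEval (fun t : {t : I × ℕ // t.2 < m t.1} => x t.1.1 t.1.2)
      (fun t : {t : I × ℕ // t.2 < n t.1} => y t.1.1 t.1.2) q = r := by
  refine mem_range_nuEval (fun t => t.1.2) ?_ ?_ ?_ hr
  · rintro ⟨⟨b, i⟩, hi⟩ ⟨⟨b', i'⟩, hi'⟩
    by_cases e : b = b'
    · subst e; exact (h.isB b).xx i i' hi hi'
    · exact h.xx b b' e i hi i' hi'
  · rintro ⟨⟨b, i⟩, hi⟩ ⟨⟨b', i'⟩, hi'⟩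
    by_cases e : b = b'
    · subst e; exact (h.isB b).yy i i' hi hi'
    · exact h.yy b b' e i hi i' hi'
  · rintro ⟨⟨b, j⟩, hj⟩ ⟨⟨b', i⟩, hi⟩
    by_cases e : b = b'
    · subst e
      simp only
      rw [(h.isB b).yx i j hi hj, add_sub_cancel_left]
      refine cEval_mem _ (fun d hd => Subring.subset_closure (Or.inl ?_)) fun d hd =>
        Subring.subset_closure (Or.inr ?_)
      · exact ⟨⟨(b, padicValNat p d), (hc.x_lt hd).trans hi⟩, rfl⟩
      · exact ⟨⟨(b, padicValNat p d), (hc.y_lt hd).trans hj⟩, hc.y_lt hd, rfl⟩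
    · simp only
      rw [sub_eq_zero.2 (h.yx b b' e j hj i hi)]
      exact zero_mem _

/-- The key comparison: an identity between elements of families may be checked, modulo an
integer vanishing in the ring, on the universal operators. -/
theorem IsBFam.exists_subring (hc : IsCFamily c) {m n : I → ℕ} {x y : I → ℕ → R}
    (h : IsBFam p c m n x y) (k : ℕ) (hk : (k : R) = 0) :
    ∃ G : Subring (R × Module.End ℚ (UP I)), (∀ r, (r, 0) ∈ G → r = 0) ∧
      (∀ b, ∀ i < m b, (x b i, ux p I b i) ∈ G) ∧ (∀ b, ∀ j < n b, (y b j, uy p I b j) ∈ G) ∧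
      (∀ r u s, (r, u) ∈ G → s ∈ uRing p I → (r, u + k * s) ∈ G) := by
  let X (t : {t : I × ℕ // t.2 < m t.1}) : R × Module.End ℚ (UP I) :=
    (x t.1.1 t.1.2, ux p I t.1.1 t.1.2)
  let Y (t : {t : I × ℕ // t.2 < n t.1}) : R × Module.End ℚ (UP I) :=
    (y t.1.1 t.1.2, uy p I t.1.1 t.1.2)
  let T : Subring (R × Module.End ℚ (UP I)) := Subring.closure (Set.range X ∪ Set.range Y)
  have hT (w) (hw : w ∈ T) : w.2 ∈ uRing p I := by
    have : T ≤ (uRing p I).comap (RingHom.snd _ _) := by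
      rw [Subring.closure_le]
      rintro _ (⟨t, rfl⟩ | ⟨t, rfl⟩)
      · exact ux_mem _ _
      · exact uy_mem _ _
    exact this hw
  have hkU (s : Module.End ℚ (UP I)) (a) : a * ((k : Module.End ℚ (UP I)) * s) = k * (a * s) := by
    rw [← mul_assoc, ← (Nat.cast_commute k a).eq, mul_assoc]
  let G : Subring (R × Module.End ℚ (UP I)) :=
    { carrier := {a | ∃ w ∈ T, w.1 = a.1 ∧ ∃ s ∈ uRing p I, a.2 = w.2 + k * s}
      mul_mem' := by
        rintro ⟨r, u⟩ ⟨r', u'⟩ ⟨w, hw, rfl, s, hs, rfl⟩ ⟨w', hw', rfl, s', hs', rfl⟩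
        refine ⟨w * w', T.mul_mem hw hw', rfl, w.2 * s' + s * w'.2 + s * (k * s'), ?_, ?_⟩
        · exact add_mem (add_mem (mul_mem (hT w hw) hs') (mul_mem hs (hT w' hw')))
            (mul_mem hs (mul_mem (natCast_mem _ k) hs'))
        · simp only [add_mul, mul_add, hkU, Prod.snd_mul, mul_assoc]
          abel
      one_mem' := ⟨1, T.one_mem, rfl, 0, zero_mem _, by simp⟩
      add_mem' := by
        rintro ⟨r, u⟩ ⟨r', u'⟩ ⟨w, hw, rfl, s, hs, rfl⟩ ⟨w', hw', rfl, s', hs', rfl⟩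
        refine ⟨w + w', T.add_mem hw hw', rfl, s + s', add_mem hs hs', ?_⟩
        simp only [mul_add, Prod.snd_add]
        abel
      zero_mem' := ⟨0, T.zero_mem, rfl, 0, zero_mem _, by simp⟩
      neg_mem' := by
        rintro ⟨r, u⟩ ⟨w, hw, rfl, s, hs, rfl⟩
        refine ⟨-w, T.neg_mem hw, rfl, -s, neg_mem hs, ?_⟩
        change -(w.2 + k * s) = -w.2 + k * -s
        exact (neg_add _ _).trans (congrArg _ (mul_neg (k : Module.End ℚ (UP I)) s).symm) }
  refine ⟨G, ?_, ?_, ?_, ?_⟩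
  · rintro r ⟨w, hw, rfl, s, hs, e⟩
    obtain ⟨q, hq⟩ := (h.prod (isBFam_u hc m n)).mem_range hc hw
    obtain ⟨q', hq'⟩ := mem_range_nuEval (x := fun t : I × ℕ => ux p I t.1 t.2)
      (y := fun t : I × ℕ => uy p I t.1 t.2) (fun t => t.2)
      (fun s t => ux_comm p I _ _ _ _) (fun s t => uy_comm p I _ _ _ _)
      (by
        rintro ⟨b, j⟩ ⟨b', i⟩
        have hu := isBFam_u (p := p) hc (fun _ : I => i + 1) (fun _ : I => j + 1)
        by_cases e : b = b'
        · subst e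
          simp only
          rw [(hu.isB b).yx i j (by simp) (by simp), add_sub_cancel_left]
          refine cEval_mem _ (fun d hd => Subring.subset_closure (Or.inl ?_)) fun d hd =>
            Subring.subset_closure (Or.inr ?_)
          · exact ⟨(b, padicValNat p d), rfl⟩
          · exact ⟨(b, padicValNat p d), hc.y_lt hd, rfl⟩
        · simp only
          rw [sub_eq_zero.2 (hu.yx b b' e j (by simp) i (by simp))]
          exact zero_mem _) hs
    let κ : MvPolynomial ({t : I × ℕ // t.2 < m t.1} ⊕ {t : I × ℕ // t.2 < n t.1}) ℤ →ₐ[ℤ]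
      MvPolynomial ((I × ℕ) ⊕ (I × ℕ)) ℤ := MvPolynomial.rename (Sum.map Subtype.val Subtype.val)
    have hinj : Function.Injective (Sum.map (Subtype.val : {t : I × ℕ // t.2 < m t.1} → I × ℕ)
      (Subtype.val : {t : I × ℕ // t.2 < n t.1} → I × ℕ)) :=
      Sum.map_injective.2 ⟨Subtype.val_injective, Subtype.val_injective⟩
    have h2 : κ q = -(k : ℤ) • q' := by
      apply nuEval_u_injective p I
      rw [map_smul, hq', nuEval_rename _ _ _ _ (fun s t => ux_comm p I _ _ _ _)
        (fun s t => uy_comm p I _ _ _ _)]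
      have := congrArg Prod.snd hq
      rw [← RingHom.coe_snd, map_nuEval] at this
      refine this.trans ?_
      rw [RingHom.coe_snd, neg_smul, natCast_zsmul, nsmul_eq_mul]
      exact eq_neg_of_add_eq_zero_left e.symm
    have h3 : q = -(k : ℤ) • MvPolynomial.killCompl hinj q' := by
      rw [← map_smul, ← h2]
      exact (MvPolynomial.killCompl_rename_app hinj q).symm
    rw [← hq, h3, map_smul]
    simp [hk]
  · exact fun b i hi => ⟨X ⟨(b, i), hi⟩, Subring.subset_closure (Or.inl ⟨_, rfl⟩), rfl, 0,
      zero_mem _, by simp [X]⟩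
  · exact fun b i hi => ⟨Y ⟨(b, i), hi⟩, Subring.subset_closure (Or.inr ⟨_, rfl⟩), rfl, 0,
      zero_mem _, by simp [Y]⟩
  · rintro r u s ⟨w, hw, rfl, s', hs', rfl⟩ hs
    exact ⟨w, hw, rfl, s' + s, add_mem hs' hs, by simp only [mul_add]; abel⟩

end Transfer

section Witt

variable {R S : Type*} [Ring R] [Ring S]

/-- The sequence whose ghost components are those of `x` plus `ε` times those of `x'`. -/
def wlin (p : ℕ) [Fact p.Prime] (ε : ℤ) (x x' : ℕ → R) (i : ℕ) : R :=
  ncEval (fun t : Fin 2 × ℕ => ![x, x'] t.1 t.2)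
    (wittStructureInt p (MvPolynomial.X 0 + MvPolynomial.C ε * MvPolynomial.X 1) i)

/-- The Frobenius polynomials evaluated at a sequence. -/
def wfrob (p : ℕ) [Fact p.Prime] (x : ℕ → R) (i : ℕ) : R :=
  ncEval x (WittVector.frobeniusPoly p i)

variable {p : ℕ} [hp : Fact p.Prime]

omit hp in
theorem gh_eq_aeval {R : Type*} [CommRing R] [Algebra ℤ R] (g : ℕ → R) (k : ℕ) :
    gh p g k = MvPolynomial.aeval g (wittPolynomial p ℤ k) := by
  rw [gh, wittPolynomial_eq_sum_C_mul_X_pow]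
  simp

theorem gh_wlin (ε : ℤ) {x x' : ℕ → R} (hx : ∀ i j, Commute (x i) (x j))
    (hx' : ∀ i j, Commute (x' i) (x' j)) (hxx' : ∀ i j, Commute (x i) (x' j)) (k : ℕ) :
    gh p (wlin p ε x x') k = gh p x k + ε * gh p x' k := by
  let z : Fin 2 × ℕ → R := fun t => ![x, x'] t.1 t.2
  have hz (a b) : z a * z b = z b * z a := by
    obtain ⟨a, i⟩ := a
    obtain ⟨b, j⟩ := b
    fin_cases a <;> fin_cases b
    · exact hx i j
    · exact hxx' i j
    · exact (hxx' j i).symm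
    · exact hx' i j
  have h1 : wlin p ε x x' = fun i => commHom z hz
      (wittStructureInt p (MvPolynomial.X 0 + MvPolynomial.C ε * MvPolynomial.X 1) i) :=
    funext fun i => (commHom_apply z hz _).symm
  have h2 (b : Fin 2) : commHom z hz (MvPolynomial.rename (Prod.mk b) (wittPolynomial p ℤ k)) =
      gh p (![x, x'] b) k := by
    rw [MvPolynomial.rename_eq_aeval, ← gh_eq_aeval, map_gh]
    simp only [commHom_apply, Function.comp_apply, ncEval_X, z]
  have h3 := wittStructureInt_prop p
    (MvPolynomial.X 0 + MvPolynomial.C ε * MvPolynomial.X 1 : MvPolynomial (Fin 2) ℤ) k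
  rw [h1, ← map_gh, gh_eq_aeval, MvPolynomial.aeval_eq_bind₁, h3]
  simp only [map_add, map_mul, MvPolynomial.bind₁_X_right, h2, MvPolynomial.bind₁_C_right]
  congr 2
  rw [← MvPolynomial.algebraMap_eq]
  simp

theorem map_wlin (f : R →+* S) (ε : ℤ) (x x' : ℕ → R) (i : ℕ) :
    f (wlin p ε x x' i) = wlin p ε (fun i => f (x i)) (fun i => f (x' i)) i := by
  rw [wlin, map_ncEval, wlin]
  congr 2
  ext ⟨b, j⟩
  fin_cases b <;> rfl

theorem wlin_congr (ε : ℤ) {x x' z z' : ℕ → R} {i : ℕ} (h : ∀ j ≤ i, x j = z j)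
    (h' : ∀ j ≤ i, x' j = z' j) : wlin p ε x x' i = wlin p ε z z' i := by
  refine ncEval_congr fun v hv => ?_
  have := wittStructureInt_vars p _ i hv
  simp only [Finset.mem_product, Finset.mem_univ, true_and, Finset.mem_range,
    Nat.lt_succ_iff] at this
  obtain ⟨b, j⟩ := v
  fin_cases b
  · exact h j this
  · exact h' j this

theorem wlin_mem (G : Subring R) (ε : ℤ) {x x' : ℕ → R} {i : ℕ} (h : ∀ j ≤ i, x j ∈ G)
    (h' : ∀ j ≤ i, x' j ∈ G) : wlin p ε x x' i ∈ G := by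
  refine ncEval_mem G fun v hv => ?_
  have := wittStructureInt_vars p _ i hv
  simp only [Finset.mem_product, Finset.mem_univ, true_and, Finset.mem_range,
    Nat.lt_succ_iff] at this
  obtain ⟨b, j⟩ := v
  fin_cases b
  · exact h j this
  · exact h' j this

theorem wlin_mem_prod (G : Subring (R × S)) (ε : ℤ) {x x' : ℕ → R} {z z' : ℕ → S} {i : ℕ}
    (h : ∀ j ≤ i, (x j, z j) ∈ G) (h' : ∀ j ≤ i, (x' j, z' j) ∈ G) :
    (wlin p ε x x' i, wlin p ε z z' i) ∈ G := by
  have e : wlin p ε (fun j => (x j, z j)) (fun j => (x' j, z' j)) i =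
      (wlin p ε x x' i, wlin p ε z z' i) :=
    Prod.ext (map_wlin (RingHom.fst R S) ε _ _ i) (map_wlin (RingHom.snd R S) ε _ _ i)
  rw [← e]
  exact wlin_mem G ε h h'

theorem gh_wfrob {x : ℕ → R} (hx : ∀ i j, Commute (x i) (x j)) (k : ℕ) :
    gh p (wfrob p x) k = gh p x (k + 1) := by
  have hx (a b) : x a * x b = x b * x a := hx a b
  have h1 : wfrob p x = fun i => commHom x hx (WittVector.frobeniusPoly p i) :=
    funext fun i => (commHom_apply x hx _).symm
  have h2 : gh p x (k + 1) = commHom x hx (wittPolynomial p ℤ (k + 1)) := by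
    have := gh_eq_aeval (p := p) (MvPolynomial.X : ℕ → MvPolynomial ℕ ℤ) (k + 1)
    rw [MvPolynomial.aeval_X_left_apply] at this
    rw [← this, map_gh]
    simp [commHom_apply, ncEval_X]
  rw [h1, h2, ← map_gh, gh_eq_aeval, MvPolynomial.aeval_eq_bind₁,
    WittVector.bind₁_frobeniusPoly_wittPolynomial]

theorem wfrob_eq {x : ℕ → R} (hx : ∀ i j, Commute (x i) (x j)) (i : ℕ) :
    wfrob p x i = x i ^ p + p * ncEval x (WittVector.frobeniusPolyAux p i) := by
  have hx (a b) : x a * x b = x b * x a := hx a b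
  simp only [wfrob, ← commHom_apply x hx, WittVector.frobeniusPoly, map_add, map_mul, map_pow]
  congr 1
  · simp [commHom_apply, ncEval_X]
  · simp

end Witt

section Transfer

variable {R : Type*} [Ring R] {p : ℕ} [hp : Fact p.Prime]
  {c : ℕ+ → ℕ+ → MvPolynomial (ℕ+ ⊕ₗ ℕ+) ℤ}

omit hp in
theorem gh_succ (x : ℕ → R) (k : ℕ) :
    gh p x (k + 1) = x 0 ^ p ^ (k + 1) + p * gh p (fun i => x (i + 1)) k := by
  rw [gh, Finset.sum_range_succ', gh, Finset.mul_sum, add_comm]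
  congr 1
  · simp
  · refine Finset.sum_congr rfl fun i _ => ?_
    rw [pow_succ', mul_assoc, Nat.add_sub_add_right]

theorem natCast_mul_cancel [Algebra ℚ R] {a b : R} (h : (p : R) * a = p * b) : a = b := by
  have := congrArg (fun r => ((p : ℚ)⁻¹) • r) h
  have e (r : R) : ((p : ℚ)⁻¹) • ((p : R) * r) = r := by
    have : (p : R) = algebraMap ℚ R p := by simp
    rw [this, ← Algebra.smul_def, smul_smul, inv_mul_cancel₀ (by exact_mod_cast hp.out.ne_zero),
      one_smul]
  simpa only [e] using this

theorem gh_wlin_zero_neg {x : ℕ → R} (hx : ∀ i j, Commute (x i) (x j)) (k : ℕ) :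
    gh p (wlin p (-1) 0 x) k = - gh p x k := by
  rw [gh_wlin (x := (0 : ℕ → R)) (-1) (fun _ _ => Commute.zero_left _) hx
    (fun _ _ => Commute.zero_left _)]
  have : gh p (0 : ℕ → R) k = 0 := Finset.sum_eq_zero fun i _ => by
    rw [Pi.zero_apply, zero_pow (pow_ne_zero _ hp.out.ne_zero), mul_zero]
  simp [this]

theorem HeisP.swap {x y : ℕ → R} [Algebra ℚ R] (h : HeisP p x y) :
    HeisP p y (wlin p (-1) 0 x) := by
  have hx := commute_of_gh_gh h.xx
  refine ⟨h.yy, fun k l => ?_, fun k l => ?_⟩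
  · simp only [gh_wlin_zero_neg hx]
    exact (h.xx k l).neg_left.neg_right
  · rw [gh_wlin_zero_neg hx, neg_mul, mul_neg, h.yx l k]
    by_cases e : l = k
    · subst e; simp
    · simp [e, Ne.symm e]

theorem HeisP.shift_frob {x y : ℕ → R} [Algebra ℚ R] (h : HeisP p x y) :
    HeisP p (fun i => x (i + 1)) (wfrob p y) := by
  have hx := commute_of_gh_gh h.xx
  have hy := commute_of_gh_gh h.yy
  refine ⟨gh_commute p fun i j => hx _ _, fun k l => ?_, fun k l => ?_⟩
  · simp only [gh_wfrob hy]
    exact h.yy _ _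
  · rw [gh_wfrob hy]
    refine natCast_mul_cancel (p := p) ?_
    have h1 := h.yx (k + 1) (l + 1)
    have h2 : Commute (gh p y (l + 1)) (x 0 ^ p ^ (k + 1)) := by
      have := h.yx 0 (l + 1)
      rw [gh_zero, if_neg (by omega), add_zero] at this
      exact Commute.pow_right this _
    rw [gh_succ x, mul_add, add_mul, h2.eq, add_assoc, add_left_cancel_iff] at h1
    rw [← mul_assoc, (Nat.cast_commute p _).eq, mul_assoc, h1, mul_add, mul_assoc]
    congr 1
    by_cases e : k = l
    · simp [e, pow_succ']
    · simp [e]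

theorem HeisP.frob_shift {x y : ℕ → R} [Algebra ℚ R] (h : HeisP p x y) :
    HeisP p (wfrob p x) (fun i => y (i + 1)) := by
  have hx := commute_of_gh_gh h.xx
  have hy := commute_of_gh_gh h.yy
  refine ⟨fun k l => ?_, gh_commute p fun i j => hy _ _, fun k l => ?_⟩
  · simp only [gh_wfrob hx]
    exact h.xx _ _
  · rw [gh_wfrob hx]
    refine natCast_mul_cancel (p := p) ?_
    have h1 := h.yx (k + 1) (l + 1)
    have h2 : Commute (y 0 ^ p ^ (l + 1)) (gh p x (k + 1)) := by
      have := h.yx (k + 1) 0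
      rw [gh_zero, if_neg (by omega), add_zero] at this
      exact Commute.pow_left this _
    rw [gh_succ y, mul_add, add_mul, h2.eq, add_assoc, add_left_cancel_iff] at h1
    rw [← mul_assoc, h1, mul_add, ← mul_assoc, ← mul_assoc, (Nat.cast_commute p _).eq]
    congr 1
    by_cases e : k = l
    · simp [e, pow_succ']
    · simp [e]

omit hp in
theorem IsB.fam {m n : ℕ} {x y : ℕ → R} (h : IsB p c m n x y) :
    IsBFam (I := Unit) p c (fun _ => m) (fun _ => n) (fun _ => x)
    (fun _ => y) :=
  ⟨fun _ => h, fun _ _ h => (h rfl).elim, fun _ _ h => (h rfl).elim, fun _ _ h => (h rfl).elim⟩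

theorem IsB.swap (hc : IsCFamily c) {m n : ℕ} {x y : ℕ → R} (h : IsB p c m n x y) :
    IsB p c n m y (wlin p (-1) 0 x) := by
  obtain ⟨G, h0, hx, hy, -⟩ := h.fam.exists_subring hc 0 Nat.cast_zero
  refine IsB.of_subring hc ((heisP_u p Unit ()).swap.isB hc n m) G h0 (hy ()) fun i hi =>
    wlin_mem_prod G _ (fun j _ => G.zero_mem) fun j hj => hx () j (hj.trans_lt hi)

omit hp in
theorem commute_add_sub {a a' b b' d : R} (h1 : b' * a' = a' * b' + d) (h0 : b * a = a * b + d)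
    (h01 : Commute b a') (h10 : Commute b' a) (ε : ℤ) :
    Commute (b' + (-ε : ℤ) * b) (a + ε * a') := by
  rw [Commute, SemiconjBy, ← zsmul_eq_mul, ← zsmul_eq_mul, neg_zsmul, ← sub_eq_add_neg]
  simp only [mul_add, add_mul, mul_sub, sub_mul, smul_mul_assoc, mul_smul_comm, h1, h0,
    h01.eq, h10.eq, smul_add, smul_sub]
  abel

/-- Replacing `x` by `x + ε x'` and `y'` by `y' - ε y` (in the sense of Witt vectors) in a pair of
mutually commuting pairs of sequences. -/
theorem IsBFam.shear (hc : IsCFamily c) {m n : Bool → ℕ} {x y : Bool → ℕ → R}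
    (h : IsBFam p c m n x y) (ε : ℤ) :
    IsBFam p c (fun b => cond b (m true) (min (m false) (m true)))
      (fun b => cond b (min (n false) (n true)) (n false))
      (fun b => cond b (x true) (wlin p ε (x false) (x true)))
      (fun b => cond b (wlin p (-ε) (y true) (y false)) (y false)) := by
  obtain ⟨G, h0, hx, hy, -⟩ := h.exists_subring hc 0 Nat.cast_zero
  let x0 := ux p Bool false
  let x1 := ux p Bool true
  let y0 := uy p Bool false
  let y1 := uy p Bool true
  have c1 (k) : gh p (wlin p ε x0 x1) k = gh p x0 k + ε * gh p x1 k :=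
    gh_wlin ε (ux_comm p Bool _ _) (ux_comm p Bool _ _) (ux_comm p Bool _ _) k
  have c2 (k) : gh p (wlin p (-ε) y1 y0) k = gh p y1 k + (-ε : ℤ) * gh p y0 k :=
    gh_wlin (-ε) (uy_comm p Bool _ _) (uy_comm p Bool _ _) (uy_comm p Bool _ _) k
  have gx (b b' k l) : Commute (gh p (ux p Bool b) k) (gh p (ux p Bool b') l) :=
    gh_ux_comm p Bool b b' k l
  have gy (b b' k l) : Commute (gh p (uy p Bool b) k) (gh p (uy p Bool b') l) :=
    gh_uy_comm p Bool b b' k l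
  have gyx (b b' k l) := gh_uy_ux p Bool b b' k l
  have i1 (a : ℤ) (r : Module.End ℚ (UP Bool)) : Commute (a : Module.End ℚ (UP Bool)) r :=
    Int.cast_commute a r
  have e01 (k l) : Commute (gh p y0 l) (gh p x1 k) := by
    have := gyx true false k l
    rwa [if_neg (by simp), add_zero] at this
  have e10 (k l) : Commute (gh p y1 l) (gh p x0 k) := by
    have := gyx false true k l
    rwa [if_neg (by simp), add_zero] at this
  have k1 : HeisP p (wlin p ε x0 x1) y0 := by
    refine ⟨fun k l => ?_, fun k l => gy _ _ _ _, fun k l => ?_⟩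
    · rw [c1, c1]
      exact ((gx _ _ _ _).add_right ((i1 _ _).symm.mul_right (gx _ _ _ _))).add_left
        (((i1 _ _).mul_left (gx _ _ _ _)).add_right
          ((i1 _ _).mul_left ((i1 _ _).symm.mul_right (gx _ _ _ _))))
    · have e1 : gh p y0 l * gh p x0 k = _ := gyx false false k l
      rw [c1, mul_add, ← mul_assoc, ← (i1 ε _).eq, mul_assoc, (e01 k l).eq, e1, add_mul, mul_assoc]
      simp only [true_and]
      abel
  have k2 : HeisP p x1 (wlin p (-ε) y1 y0) := by
    refine ⟨fun k l => gx _ _ _ _, fun k l => ?_, fun k l => ?_⟩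
    · rw [c2, c2]
      exact ((gy _ _ _ _).add_right ((i1 _ _).symm.mul_right (gy _ _ _ _))).add_left
        (((i1 _ _).mul_left (gy _ _ _ _)).add_right
          ((i1 _ _).mul_left ((i1 _ _).symm.mul_right (gy _ _ _ _))))
    · have e1 : gh p y1 l * gh p x1 k = _ := gyx true true k l
      rw [c2, add_mul, mul_assoc, (e01 k l).eq, e1, mul_add, ← mul_assoc, ← mul_assoc, (i1 _ _).eq]
      simp only [true_and]
      abel
  have k3 (i j) : Commute (wlin p ε x0 x1 i) (x1 j) := by
    refine commute_of_gh_gh (p := p) (fun k l => ?_) i j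
    rw [c1]
    exact (gx _ _ _ _).add_left ((i1 _ _).mul_left (gx _ _ _ _))
  have k4 (i j) : Commute (y0 i) (wlin p (-ε) y1 y0 j) := by
    refine commute_of_gh_gh (p := p) (fun k l => ?_) i j
    rw [c2]
    exact (gy _ _ _ _).add_right ((i1 _ _).symm.mul_right (gy _ _ _ _))
  have k5 (i j) : Commute (y0 i) (x1 j) := commute_of_gh_gh (p := p) (fun k l => e01 l k) i j
  have k6 (i j) : Commute (wlin p (-ε) y1 y0 i) (wlin p ε x0 x1 j) := by
    refine commute_of_gh_gh (p := p) (fun l k => ?_) i j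
    have e1 : gh p y1 l * gh p x1 k = gh p x1 k * gh p y1 l +
        if k = l then (p : Module.End ℚ (UP Bool)) ^ k else 0 := by
      simpa only [true_and] using gyx true true k l
    have e2 : gh p y0 l * gh p x0 k = gh p x0 k * gh p y0 l +
        if k = l then (p : Module.End ℚ (UP Bool)) ^ k else 0 := by
      simpa only [true_and] using gyx false false k l
    rw [c1, c2]
    exact commute_add_sub e1 e2 (e01 k l) (e10 k l) ε
  have hmem0 (i) (hi : i < min (m false) (m true)) :
      (wlin p ε (x false) (x true) i, wlin p ε x0 x1 i) ∈ G :=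
    wlin_mem_prod G ε (fun j hj => hx _ _ (by omega)) (fun j hj => hx _ _ (by omega))
  have hmem1 (i) (hi : i < min (n false) (n true)) :
      (wlin p (-ε) (y true) (y false) i, wlin p (-ε) y1 y0 i) ∈ G :=
    wlin_mem_prod G _ (fun j hj => hy _ _ (by omega)) (fun j hj => hy _ _ (by omega))
  refine ⟨fun b => ?_, fun b b' hb i hi i' hi' => ?_, fun b b' hb i hi i' hi' => ?_,
    fun b b' hb i hi i' hi' => ?_⟩
  · cases b
    · exact (k1.isB hc _ _).of_subring hc G h0 hmem0 fun j hj => hy _ _ hj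
    · exact (k2.isB hc _ _).of_subring hc G h0 (fun j hj => hx _ _ hj) hmem1
  · cases b <;> cases b' <;> try exact (hb rfl).elim
    · exact commute_of_subring G h0 (hmem0 i hi) (hx _ _ hi') (k3 i i')
    · exact commute_of_subring G h0 (hx _ _ hi) (hmem0 i' hi') (k3 i' i).symm
  · cases b <;> cases b' <;> try exact (hb rfl).elim
    · exact commute_of_subring G h0 (hy _ _ hi) (hmem1 i' hi') (k4 i i')
    · exact commute_of_subring G h0 (hmem1 i hi) (hy _ _ hi') (k4 i' i).symm
  · cases b <;> cases b' <;> try exact (hb rfl).elim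
    · exact commute_of_subring G h0 (hy _ _ hi) (hx _ _ hi') (k5 i i')
    · exact commute_of_subring G h0 (hmem1 i hi) (hmem0 i' hi') (k6 i i')

omit hp in
theorem ncEval_mem_uRing {I : Type} (p : ℕ) [Fact p.Prime] {b : I} (q : MvPolynomial ℕ ℤ) :
    ncEval (ux p I b) q ∈ uRing p I ∧ ncEval (uy p I b) q ∈ uRing p I :=
  ⟨ncEval_mem _ fun _ _ => ux_mem b _, ncEval_mem _ fun _ _ => uy_mem b _⟩

theorem IsB.shift_frob (hc : IsCFamily c) (hR : (p : R) = 0) {m n : ℕ} {x y : ℕ → R}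
    (h : IsB p c (m + 1) n x y) :
    IsB p c m n (fun i => x (i + 1)) (fun j => y j ^ p) ∧ ∀ j < n, Commute (y j ^ p) (x 0) := by
  obtain ⟨G, h0, hx, hy, hs⟩ := h.fam.exists_subring hc p hR
  have H := heisP_u p Unit ()
  have cx := commute_of_gh_gh H.xx
  have cy := commute_of_gh_gh H.yy
  have hmem (j) (hj : j < n) : (y j ^ p, wfrob p (uy p Unit ()) j) ∈ G := by
    rw [wfrob_eq cy]
    exact hs _ _ _ (G.pow_mem (hy () j hj) p) (ncEval_mem_uRing p _).2
  refine ⟨IsB.of_subring hc (H.shift_frob.isB hc m n) G h0 (fun i hi => hx () _ (by omega)) hmem,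
    fun j hj => commute_of_subring G h0 (hmem j hj) (hx () 0 (by omega)) ?_⟩
  refine (commute_of_gh p (fun k => ?_) j).symm
  rw [gh_wfrob cy]
  have := H.yx 0 (k + 1)
  rw [gh_zero, if_neg (by omega), add_zero] at this
  exact this.symm

theorem IsB.frob_shift (hc : IsCFamily c) (hR : (p : R) = 0) {m n : ℕ} {x y : ℕ → R}
    (h : IsB p c m (n + 1) x y) :
    IsB p c m n (fun i => x i ^ p) (fun j => y (j + 1)) ∧ ∀ i < m, Commute (y 0) (x i ^ p) := by
  obtain ⟨G, h0, hx, hy, hs⟩ := h.fam.exists_subring hc p hR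
  have H := heisP_u p Unit ()
  have cx := commute_of_gh_gh H.xx
  have cy := commute_of_gh_gh H.yy
  have hmem (i) (hi : i < m) : (x i ^ p, wfrob p (ux p Unit ()) i) ∈ G := by
    rw [wfrob_eq cx]
    exact hs _ _ _ (G.pow_mem (hx () i hi) p) (ncEval_mem_uRing p _).1
  refine ⟨IsB.of_subring hc (H.frob_shift.isB hc m n) G h0 hmem (fun i hi => hy () _ (by omega)),
    fun i hi => commute_of_subring G h0 (hy () 0 (by omega)) (hmem i hi) ?_⟩
  refine commute_of_gh p (fun k => ?_) i
  rw [gh_wfrob cx]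
  have := H.yx (k + 1) 0
  rw [gh_zero, if_neg (by omega), add_zero] at this
  exact this

/-- In characteristic `p`, the element `x_i ^ p ^ n` commutes with `y_0, …, y_{n-1}`. -/
theorem IsB.commute_pow_x (hc : IsCFamily c) (hR : (p : R) = 0) {m n : ℕ} {x y : ℕ → R}
    (h : IsB p c m n x y) : ∀ i < m, ∀ j < n, Commute (y j) (x i ^ p ^ n) := by
  induction n generalizing x y with
  | zero => intro _ _ j hj; omega
  | succ n ih =>
    obtain ⟨h1, h2⟩ := h.frob_shift hc hR
    intro i hi j hj
    rw [pow_succ' p, pow_mul]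
    cases j with
    | zero => exact (h2 i hi).pow_right _
    | succ j => exact ih h1 i hi j (by omega)

/-- In characteristic `p`, the element `y_j ^ p ^ m` commutes with `x_0, …, x_{m-1}`. -/
theorem IsB.commute_pow_y (hc : IsCFamily c) (hR : (p : R) = 0) {m n : ℕ} {x y : ℕ → R}
    (h : IsB p c m n x y) : ∀ i < m, ∀ j < n, Commute (y j ^ p ^ m) (x i) := by
  induction m generalizing x y with
  | zero => intro i hi; omega
  | succ m ih =>
    obtain ⟨h1, h2⟩ := h.shift_frob hc hR
    intro i hi j hj
    rw [pow_succ' p, pow_mul]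
    cases i with
    | zero => exact (h2 j hj).pow_left _
    | succ i => exact ih h1 i (by omega) j hj

end Transfer

section Independence

variable {R : Type*} [Ring R] {p : ℕ} [hp : Fact p.Prime]
  {c : ℕ+ → ℕ+ → MvPolynomial (ℕ+ ⊕ₗ ℕ+) ℤ}

theorem IsB.yx_zero (hc : IsCFamily c) {m n : ℕ} {x y : ℕ → R} (h : IsB p c m n x y) (hm : 0 < m)
    (hn : 0 < n) : y 0 * x 0 = x 0 * y 0 + 1 := by
  obtain ⟨G, h0, hx, hy, -⟩ := h.fam.exists_subring hc 0 Nat.cast_zero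
  refine sub_eq_zero.1 (h0 _ ?_)
  convert G.sub_mem (G.mul_mem (hy () 0 hn) (hx () 0 hm))
    (G.add_mem (G.mul_mem (hx () 0 hm) (hy () 0 hn)) G.one_mem) using 1
  refine Prod.ext rfl (sub_eq_zero.2 ?_).symm
  simpa [gh_zero] using (heisP_u p Unit ()).yx 0 0

theorem IsB.yx_pow (hc : IsCFamily c) (hR : (p : R) = 0) {m n : ℕ} {x y : ℕ → R}
    (h : IsB p c m n x y) {i s : ℕ} (hi : i < m) (hs : s < n) :
    y s ^ p ^ i * x i ^ p ^ s = x i ^ p ^ s * y s ^ p ^ i + 1 := by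
  induction i generalizing m x y with
  | zero =>
    induction s generalizing n x y with
    | zero => simpa using h.yx_zero hc hi hs
    | succ s ih =>
      obtain ⟨n, rfl⟩ : ∃ n', n = n' + 1 := ⟨n - 1, by omega⟩
      simpa [pow_succ', pow_mul] using ih (n := n) (by omega) (h.frob_shift hc hR).1
  | succ i ih =>
    obtain ⟨m, rfl⟩ : ∃ m', m = m' + 1 := ⟨m - 1, by omega⟩
    simpa [pow_succ', pow_mul] using ih (h.shift_frob hc hR).1 (by omega)

omit hp in
theorem commutator_pow {u v : R} (h : v * u = u * v + 1) (e : ℕ) :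
    v * u ^ (e + 1) = u ^ (e + 1) * v + (e + 1 : ℕ) * u ^ e := by
  induction e with
  | zero => simpa using h
  | succ e ih =>
    rw [pow_succ u (e + 1), ← mul_assoc, ih, add_mul, mul_assoc, h, mul_add, mul_one, mul_assoc,
      mul_assoc, ← pow_succ, Nat.cast_succ (e + 1), add_mul, one_mul]
    abel

omit hp in
theorem eq_zero_of_sum_pow_mul (K : Type*) [Field K] [CharP K p] [Algebra K R] {u v : R}
    (h : v * u = u * v + 1) {d : ℕ} (hd : d ≤ p) {s : ℕ → R}
    (hs : ∀ e < d, Commute v (s e)) (h0 : ∑ e ∈ Finset.range d, u ^ e * s e = 0) :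
    ∀ e < d, s e = 0 := by
  induction d generalizing s with
  | zero => intro e he; omega
  | succ d ih =>
    have h1 : ∑ e ∈ Finset.range d, u ^ e * ((e + 1 : ℕ) * s (e + 1)) = 0 := by
      have h2 : v * (∑ e ∈ Finset.range (d + 1), u ^ e * s e) -
        (∑ e ∈ Finset.range (d + 1), u ^ e * s e) * v = 0 := by rw [h0]; simp
      rw [Finset.sum_range_succ', mul_add, add_mul, pow_zero, one_mul, (hs 0 (by omega)).eq,
        add_sub_add_right_eq_sub, Finset.mul_sum, Finset.sum_mul, ← Finset.sum_sub_distrib] at h2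
      rw [← h2]
      refine Finset.sum_congr rfl fun e he => ?_
      rw [Finset.mem_range] at he
      rw [← mul_assoc v, commutator_pow h, mul_assoc _ _ v, ← (hs (e + 1) (by omega)).eq, add_mul,
        ← mul_assoc, ← mul_assoc, add_sub_cancel_left, (Nat.cast_commute (e + 1) (u ^ e)).eq]
    have h3 : ∀ e < d, s (e + 1) = 0 := by
      intro e he
      have := ih (by omega) (s := fun e => (e + 1 : ℕ) * s (e + 1))
        (fun e he => (Nat.commute_cast _ _).mul_right (hs _ (by omega))) h1 e he
      have hne : ((e + 1 : ℕ) : K) ≠ 0 := fun h' => by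
        have := Nat.le_of_dvd (by omega) ((CharP.cast_eq_zero_iff K p (e + 1)).1 h')
        omega
      have e1 : ((e + 1 : ℕ) : R) = algebraMap K R (e + 1 : ℕ) := by simp
      rw [e1, ← Algebra.smul_def] at this
      exact (smul_eq_zero.1 this).resolve_left hne
    intro e he
    cases e with
    | zero =>
      rw [Finset.sum_range_succ', Finset.sum_eq_zero, zero_add] at h0
      · simpa using h0
      · intro e he
        rw [h3 e (Finset.mem_range.1 he), mul_zero]
    | succ e => exact h3 e (by omega)

variable {K : Type*} [Field K] [CharP K p] [Algebra K R]

omit hp in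
theorem exists_submodule_of_list [FiniteDimensional K R] (l : List (R × R))
    (h : ∀ q ∈ l, q.2 * q.1 = q.1 * q.2 + 1) (h' : l.Pairwise fun q q' => Commute q.2 q'.1)
    (V : Submodule K R) (hV : ∀ q ∈ l, ∀ r ∈ V, Commute q.2 r) :
    ∃ W : Submodule K R, Module.finrank K W = p ^ l.length * Module.finrank K V ∧
      ∀ z, (∀ q ∈ l, Commute z q.1) → (∀ r ∈ V, Commute z r) → ∀ r ∈ W, Commute z r := by
  induction l with
  | nil => exact ⟨V, by simp, fun z _ hz => hz⟩
  | cons q l ih =>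
    rw [List.pairwise_cons] at h'
    simp only [List.forall_mem_cons] at h hV
    obtain ⟨W, hW, hc⟩ := ih h.2 h'.2 hV.2
    have hW' := hc q.2 h'.1 hV.1
    let f : (Fin p → W) →ₗ[K] R :=
      ∑ e : Fin p, LinearMap.mulLeft K (q.1 ^ (e : ℕ)) ∘ₗ W.subtype ∘ₗ LinearMap.proj e
    have hf (s : Fin p → W) : f s = ∑ e : Fin p, q.1 ^ (e : ℕ) * (s e : R) := by
      simp [f, LinearMap.sum_apply]
    have hinj : Function.Injective f := by
      rw [injective_iff_map_eq_zero]
      intro s hs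
      rw [hf] at hs
      let s' (e : ℕ) : R := if he : e < p then s ⟨e, he⟩ else 0
      have h1 := eq_zero_of_sum_pow_mul K h.1 le_rfl (s := s')
        (fun e he => hW' _ (by simp only [s', he, dite_true]; exact (s _).2))
        (by rw [← hs, Finset.sum_range]; exact Finset.sum_congr rfl fun e _ => by simp [s'])
      ext e
      simpa [s'] using h1 e e.2
    refine ⟨LinearMap.range f, ?_, ?_⟩
    · rw [LinearMap.finrank_range_of_inj hinj, Module.finrank_pi_fintype]
      simp [hW, pow_succ']
      ring
    · rintro z hz hz' _ ⟨s, rfl⟩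
      rw [List.forall_mem_cons] at hz
      rw [hf]
      exact Commute.sum_right _ _ _ fun e _ =>
        (hz.1.pow_right _).mul_right (hc z hz.2 hz' _ (s e).2)

theorem IsB.le_finrank (hc : IsCFamily c) [Nontrivial R] [FiniteDimensional K R] {m n : ℕ}
    {x y : ℕ → R} (h : IsB p c m n x y) : p ^ (m * n) * p ^ (m * n) ≤ Module.finrank K R := by
  have hR : (p : R) = 0 := by
    rw [← map_natCast (algebraMap K R), CharP.cast_eq_zero, map_zero]
  let idx : List (ℕ × ℕ) := (List.range m).reverse.flatMap fun i => (List.range n).map (Prod.mk i)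
  have hidx (t) (ht : t ∈ idx) : t.1 < m ∧ t.2 < n := by
    obtain ⟨i, hi, ht⟩ := List.mem_flatMap.1 ht
    obtain ⟨s, hs, rfl⟩ := List.mem_map.1 ht
    exact ⟨by simpa using hi, by simpa using hs⟩
  have hlen : idx.length = m * n := by simp [idx, List.length_flatMap]
  have hP : idx.Pairwise fun t t' => t'.1 < t.1 ∨ t.2 < t'.2 := by
    rw [List.pairwise_flatMap, List.pairwise_reverse]
    refine ⟨fun i _ => ?_, List.pairwise_lt_range.imp fun {i i'} hlt => ?_⟩
    · rw [List.pairwise_map]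
      exact List.pairwise_lt_range.imp fun h => Or.inr h
    · simp only [List.forall_mem_map]
      exact fun _ _ _ _ => Or.inl hlt
  have hcomm {i s i' s' : ℕ} (hi : i < m) (hi' : i' < m) (hs : s < n) (hs' : s' < n)
      (hlt : i' < i ∨ s < s') : Commute (y s ^ p ^ i) (x i' ^ p ^ s') := by
    rcases hlt with hlt | hlt
    · exact ((h.mono hi.le le_rfl).commute_pow_y hc hR i' hlt s hs).pow_right _
    · exact ((h.mono le_rfl hs'.le).commute_pow_x hc hR i' hi' s hlt).pow_left _
  obtain ⟨V, hV, hVc⟩ := exists_submodule_of_list (p := p) (K := K)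
    (idx.reverse.map fun t => (y t.2 ^ p ^ t.1, -x t.1 ^ p ^ t.2))
    (by
      simp only [List.forall_mem_map, List.mem_reverse]
      intro t ht
      have := h.yx_pow hc hR (hidx t ht).1 (hidx t ht).2
      rw [mul_neg, this]
      simp)
    (by
      rw [List.pairwise_map, List.pairwise_reverse]
      refine (List.Pairwise.and_mem.1 hP).imp ?_
      rintro t t' ⟨ht, ht', hlt⟩
      exact (hcomm (hidx _ ht).1 (hidx _ ht').1 (hidx _ ht).2 (hidx _ ht').2 hlt).symm.neg_left)
    (K ∙ (1 : R))
    (by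
      intro q _ r hr
      obtain ⟨k, rfl⟩ := Submodule.mem_span_singleton.1 hr
      exact (Commute.one_right _).smul_right _)
  obtain ⟨W, hW, -⟩ := exists_submodule_of_list (p := p) (K := K)
    (idx.map fun t => (x t.1 ^ p ^ t.2, y t.2 ^ p ^ t.1))
    (by
      simp only [List.forall_mem_map]
      exact fun t ht => h.yx_pow hc hR (hidx t ht).1 (hidx t ht).2)
    (by
      rw [List.pairwise_map]
      refine (List.Pairwise.and_mem.1 hP).imp ?_
      rintro t t' ⟨ht, ht', hlt⟩
      exact hcomm (hidx _ ht).1 (hidx _ ht').1 (hidx _ ht).2 (hidx _ ht').2 hlt)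
    V
    (by
      simp only [List.forall_mem_map]
      intro t ht
      refine hVc _ ?_ ?_
      · simp only [List.forall_mem_map, List.mem_reverse]
        exact fun t' ht' => (h.yy _ _ (hidx _ ht).2 (hidx _ ht').2).pow_pow _ _
      · intro r hr
        obtain ⟨k, rfl⟩ := Submodule.mem_span_singleton.1 hr
        exact (Commute.one_right _).smul_right _)
  rw [hV, finrank_span_singleton one_ne_zero] at hW
  simp only [List.length_map, List.length_reverse, hlen, mul_one] at hW
  rw [← hW]
  exact W.finrank_le

end Independence

section Intertwine

variable {A B M N : Type*} [CommRing A] [CommRing B] [AddCommGroup M] [AddCommGroup N] [Module A M]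
  [Module B N]

/-- Pairs of operators compatible with an additive map. -/
def intertwine (φ : M →+ N) : Subring (Module.End A M × Module.End B N) where
  carrier := {u | ∀ q, φ (u.1 q) = u.2 (φ q)}
  mul_mem' {u v} hu hv q := by simp [hu _, hv _]
  one_mem' q := rfl
  add_mem' {u v} hu hv q := by simp [hu _, hv _]
  zero_mem' q := by simp
  neg_mem' {u} hu q := by simp [hu _]

end Intertwine

section SplitModel

variable (p : ℕ) [hp : Fact p.Prime]

/-- Polynomials with ghost components the variables. -/
def sxi : ℕ → MvPolynomial ℕ ℚ := (exists_gh_eq p MvPolynomial.X).choose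

theorem gh_sxi (k : ℕ) : gh p (sxi p) k = MvPolynomial.X k :=
  (exists_gh_eq p (MvPolynomial.X (R := ℚ) (σ := ℕ))).choose_spec k

/-- Operators with ghost components the scaled derivations. -/
def sy : ℕ → Module.End ℚ (MvPolynomial ℕ ℚ) :=
  (exists_gh_eq p fun k =>
    (p : ℚ) ^ k • (MvPolynomial.pderiv (R := ℚ) k).toLinearMap).choose

theorem gh_sy (k : ℕ) : gh p (sy p) k = (p : ℚ) ^ k • (MvPolynomial.pderiv k).toLinearMap :=
  (exists_gh_eq p fun k =>
    (p : ℚ) ^ k • (MvPolynomial.pderiv (R := ℚ) (σ := ℕ) k).toLinearMap).choose_spec k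

/-- Multiplication operators. -/
def sx (k : ℕ) : Module.End ℚ (MvPolynomial ℕ ℚ) := Algebra.lmul ℚ _ (sxi p k)

theorem gh_sx (k : ℕ) : gh p (sx p) k = Algebra.lmul ℚ _ (MvPolynomial.X k) := by
  rw [← gh_sxi p k]
  exact (map_gh p (Algebra.lmul ℚ (MvPolynomial ℕ ℚ)).toRingHom (sxi p) k).symm

theorem heisP_s : HeisP p (sx p) (sy p) where
  xx k l := by
    rw [gh_sx, gh_sx]
    exact (Commute.all _ _).map _
  yy k l := by
    rw [gh_sy, gh_sy]
    refine (Commute.smul_right ?_ _).smul_left _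
    exact LinearMap.ext fun f => pderiv_pderiv_comm _ _ _
  yx k l := by
    rw [gh_sy, gh_sx]
    refine LinearMap.ext fun f => ?_
    simp only [Module.End.mul_apply, LinearMap.smul_apply, LinearMap.add_apply,
      Algebra.coe_lmul_eq_mul,
      LinearMap.mul_apply', Derivation.coeFn_coe, Derivation.leibniz,
      MvPolynomial.pderiv_X, smul_eq_mul, smul_add, mul_smul_comm]
    congr 1
    split_ifs with h
    · subst h
      rw [← Nat.cast_pow (α := Module.End ℚ (MvPolynomial ℕ ℚ)), Module.End.natCast_apply]
      simp [Algebra.smul_def, mul_comm]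
    · rw [Pi.single_apply, if_neg h]
      simp

theorem sy_one (j : ℕ) : sy p j 1 = 0 := by
  induction j using Nat.strong_induction_on with
  | _ j ih =>
    rw [eq_smul_gh p (sy p) j, gh_sy]
    simp only [LinearMap.smul_apply, LinearMap.sub_apply, LinearMap.sum_apply,
      Derivation.coeFn_coe, Derivation.map_one_eq_zero, smul_zero,
      zero_sub, smul_neg, neg_eq_zero]
    rw [Finset.sum_eq_zero, smul_zero]
    intro i hi
    rw [Finset.mem_range] at hi
    obtain ⟨r, hr⟩ : ∃ r, p ^ (j - i) = r + 1 :=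
      ⟨_, (Nat.succ_pred_eq_of_pos (pow_pos hp.out.pos _)).symm⟩
    rw [hr, pow_succ, Module.End.mul_apply, Module.End.mul_apply, ih i hi]
    simp

variable (m n : ℕ)

/-- The embedding of integral polynomials given by `sxi`. -/
def sEmb : MvPolynomial (Fin m) ℤ →ₐ[ℤ] MvPolynomial ℕ ℚ :=
  MvPolynomial.aeval fun i => sxi p i

theorem sEmb_injective : Function.Injective (sEmb p m) := by
  let ψ : MvPolynomial ℕ ℚ →ₐ[ℚ] MvPolynomial ℕ ℚ := MvPolynomial.aeval (gh p MvPolynomial.X)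
  have h1 (k) : ψ (sxi p k) = MvPolynomial.X k := by
    refine eq_of_gh_eq p (x := fun k => ψ (sxi p k))
      (x' := MvPolynomial.X) (N := k) (fun k _ => ?_) k le_rfl
    refine (map_gh p ψ.toRingHom (sxi p) k).symm.trans ?_
    rw [gh_sxi]
    simp [ψ]
  have key (q) : ψ (sEmb p m q) =
      MvPolynomial.rename Fin.val (MvPolynomial.map (Int.castRingHom ℚ) q) := by
    refine DFunLike.congr_fun (f := ψ.toRingHom.comp (sEmb p m).toRingHom)
      (g := (MvPolynomial.rename (R := ℚ) (Fin.val : Fin m → ℕ)).toRingHom.comp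
        (MvPolynomial.map (Int.castRingHom ℚ))) ?_ q
    refine MvPolynomial.ringHom_ext (fun r => by simp) fun i => ?_
    simp [sEmb, h1]
  intro q q' h
  have h := congrArg ψ h
  rw [key, key] at h
  exact MvPolynomial.map_injective _ Int.cast_injective
    (MvPolynomial.rename_injective _ Fin.val_injective h)

variable {p} {c : ℕ+ → ℕ+ → MvPolynomial (ℕ+ ⊕ₗ ℕ+) ℤ}

theorem sy_sEmb_mem (hc : IsCFamily c) {n j : ℕ} (hj : j < n) (q : MvPolynomial (Fin m) ℤ) :
    ∃ q', sEmb p m q' = sy p j (sEmb p m q) := by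
  have hfam := ((heisP_s p).isB hc m n).fam
  have hx1 : ∀ f, ncEval (fun t : {t : Unit × ℕ // t.2 < m} => sx p t.1.2) f 1 =
      MvPolynomial.aeval (fun t : {t : Unit × ℕ // t.2 < m} => sxi p t.1.2) f := by
    intro f
    rw [← ncEval_eq_aeval']
    have := map_ncEval (Algebra.lmul ℚ (MvPolynomial ℕ ℚ)).toRingHom
      (fun t : {t : Unit × ℕ // t.2 < m} => sxi p t.1.2) f
    refine (congrArg (fun g : Module.End ℚ (MvPolynomial ℕ ℚ) => g 1) this.symm).trans ?_
    simp
  have hy1 : ∀ g, ncEval (fun t : {t : Unit × ℕ // t.2 < n} => sy p t.1.2) g 1 =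
      algebraMap ℤ _ (MvPolynomial.constantCoeff g) := by
    have hcomm : ∀ a b : {t : Unit × ℕ // t.2 < n}, sy p a.1.2 * sy p b.1.2 =
        sy p b.1.2 * sy p a.1.2 := fun a b =>
      ((heisP_s p).isB hc m n).yy _ _ a.2 b.2
    intro g
    induction g using MvPolynomial.induction_on with
    | C a =>
      rw [← mul_one (MvPolynomial.C a), ← MvPolynomial.smul_eq_C_mul, map_smul, ncEval_one]
      simp
    | add f g hf hg => simp [hf, hg]
    | mul_X f s hf =>
      rw [ncEval_mul hcomm, ncEval_X, Module.End.mul_apply, sy_one]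
      simp
  have hT : ∀ r ∈ Subring.closure
      (Set.range (fun t : {t : Unit × ℕ // t.2 < m} => sx p t.1.2) ∪
        Set.range (fun t : {t : Unit × ℕ // t.2 < n} => sy p t.1.2)),
      ∃ q', sEmb p m q' = r 1 := by
    intro r hr
    obtain ⟨Q, rfl⟩ := hfam.mem_range hc hr
    clear hr
    induction Q using induction_sum with
    | mul f g =>
      rw [nuEval_mul, Module.End.mul_apply, hy1]
      refine ⟨MvPolynomial.rename (fun t => ⟨t.1.2, t.2⟩) f *
        MvPolynomial.C (MvPolynomial.constantCoeff g), ?_⟩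
      rw [← mul_one (algebraMap ℤ _ _), ← Algebra.smul_def, map_zsmul, hx1, map_mul, sEmb,
        MvPolynomial.aeval_rename, MvPolynomial.aeval_C, Algebra.smul_def, mul_comm]
      rfl
    | add q r hq hr =>
      obtain ⟨a, ha⟩ := hq
      obtain ⟨b, hb⟩ := hr
      exact ⟨a + b, by simp [ha, hb]⟩
  have hq : sEmb p m q = ncEval (fun t : {t : Unit × ℕ // t.2 < m} => sx p t.1.2)
      (MvPolynomial.rename (fun i => ⟨((), i), i.2⟩) q) 1 := by
    rw [hx1, MvPolynomial.aeval_rename]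
    rfl
  rw [hq, ← Module.End.mul_apply]
  refine hT _ (mul_mem (Subring.subset_closure (Or.inr ⟨⟨((), j), hj⟩, rfl⟩)) (ncEval_mem _ ?_))
  exact fun v _ => Subring.subset_closure (Or.inl ⟨v, rfl⟩)

/-- Multiplication by the variables, extended by zero. -/
def mulVar (K : Type*) [CommRing K] (m i : ℕ) : Module.End K (MvPolynomial (Fin m) K) :=
  if h : i < m then Algebra.lmul K _ (MvPolynomial.X ⟨i, h⟩) else 0

theorem exists_isB_int (hc : IsCFamily c) (m n : ℕ) :
    ∃ y : ℕ → Module.End ℤ (MvPolynomial (Fin m) ℤ),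
    IsB p c m n (mulVar ℤ m) y ∧ ∀ j < n, y j 1 = 0 := by
  choose f hf using fun j : Fin n => sy_sEmb_mem (p := p) m hc j.2
  have hinj := sEmb_injective p m
  let y (j : Fin n) : Module.End ℤ (MvPolynomial (Fin m) ℤ) :=
    (AddMonoidHom.mk' (f j) fun a b => hinj (by simp only [map_add, hf])).toIntLinearMap
  have hy j q : sEmb p m (y j q) = sy p j (sEmb p m q) := hf j q
  let y' (j : ℕ) := if h : j < n then y ⟨j, h⟩ else 0
  refine ⟨y', ((heisP_s p).isB hc m n).of_subring hc
    (intertwine (sEmb p m : MvPolynomial (Fin m) ℤ →+ MvPolynomial ℕ ℚ)) ?_ ?_ ?_, ?_⟩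
  · intro r hr
    refine LinearMap.ext fun q => hinj ?_
    exact (hr q).trans (by simp)
  · intro i hi q
    simp [mulVar, hi, sEmb, sx]
  · intro j hj q
    simp only [y', hj, dite_true]
    exact hy _ _
  · intro j hj
    refine hinj ?_
    simp only [y', hj, dite_true, hy, map_one, sy_one, map_zero]

end SplitModel

section RadicalQuotient

variable {K : Type*} [Field K] {m : ℕ} (q : ℕ) (a : Fin m → K)

/-- The ideal generated by the elements `X_i ^ q - a_i`. -/
def radIdeal : Ideal (MvPolynomial (Fin m) K) :=
  Ideal.span (Set.range fun i => MvPolynomial.X i ^ q - MvPolynomial.C (a i))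

/-- The quotient of the polynomial ring by the elements `X_i ^ q - a_i`, as a vector space. -/
abbrev RadQuot := MvPolynomial (Fin m) K ⧸ (radIdeal q a).restrictScalars K

variable {q}

theorem radQuot_nontrivial (hq : 0 < q) : Nontrivial (RadQuot q a) := by
  choose r hr using fun i => IsAlgClosed.exists_pow_nat_eq
    (algebraMap K (AlgebraicClosure K) (a i)) hq
  have hle : radIdeal q a ≤ RingHom.ker (MvPolynomial.aeval (R := K) r) := by
    rw [radIdeal, Ideal.span_le]
    rintro _ ⟨i, rfl⟩
    simp [hr]
  refine Submodule.Quotient.nontrivial_iff.2 fun h => ?_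
  have h1 : (1 : MvPolynomial (Fin m) K) ∈ (radIdeal q a).restrictScalars K := h ▸ trivial
  have := hle h1
  simp at this

theorem mkQ_monomial_mem (hq : 0 < q) (e : Fin m →₀ ℕ) :
    ((radIdeal q a).restrictScalars K).mkQ (MvPolynomial.monomial e 1) ∈
      Submodule.span K (Set.range fun e : Fin m → Fin q =>
        ((radIdeal q a).restrictScalars K).mkQ
          (MvPolynomial.monomial (Finsupp.equivFunOnFinite.symm fun i => (e i : ℕ)) 1)) := by
  induction hd : e.degree using Nat.strong_induction_on generalizing e with
  | _ d ih =>
    by_cases h : ∀ i, e i < q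
    · refine Submodule.subset_span ⟨fun i => ⟨e i, h i⟩, ?_⟩
      simp only
      congr 3
      ext i
      rfl
    · push Not at h
      obtain ⟨i, hi⟩ := h
      have he : e = Finsupp.single i q + (e - Finsupp.single i q) := by
        rw [add_tsub_cancel_of_le]
        simpa using hi
      set e' := e - Finsupp.single i q
      have hdeg : e'.degree < d := by
        rw [← hd, he, map_add, Finsupp.degree_single]
        omega
      have : ((radIdeal q a).restrictScalars K).mkQ (MvPolynomial.monomial e 1) =
          a i • ((radIdeal q a).restrictScalars K).mkQ (MvPolynomial.monomial e' 1) := by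
        rw [← map_smul, ← sub_eq_zero, ← map_sub, Submodule.mkQ_apply,
          Submodule.Quotient.mk_eq_zero, Submodule.restrictScalars_mem]
        have : MvPolynomial.monomial e (1 : K) - a i • MvPolynomial.monomial e' 1 =
            MvPolynomial.monomial e' 1 * (MvPolynomial.X i ^ q - MvPolynomial.C (a i)) := by
          rw [mul_sub, mul_comm _ (MvPolynomial.C _), ← MvPolynomial.smul_eq_C_mul,
            MvPolynomial.X_pow_eq_monomial, MvPolynomial.monomial_mul, add_comm e', ← he, one_mul]
        rw [this]
        exact Ideal.mul_mem_left _ _ (Ideal.subset_span ⟨i, rfl⟩)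
      rw [this]
      exact Submodule.smul_mem _ _ (ih _ hdeg e' rfl)

theorem radQuot_span (hq : 0 < q) : Submodule.span K (Set.range fun e : Fin m → Fin q =>
    ((radIdeal q a).restrictScalars K).mkQ
      (MvPolynomial.monomial (Finsupp.equivFunOnFinite.symm fun i => (e i : ℕ)) 1)) = ⊤ := by
  rw [eq_top_iff]
  rintro r -
  obtain ⟨f, rfl⟩ := Submodule.mkQ_surjective _ r
  induction f using MvPolynomial.induction_on' with
  | monomial e s =>
    rw [← mul_one s, ← smul_eq_mul, ← MvPolynomial.smul_monomial, map_smul]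
    exact Submodule.smul_mem _ _ (mkQ_monomial_mem a hq e)
  | add f g hf hg =>
    rw [map_add]
    exact add_mem hf hg

theorem radQuot_finite (hq : 0 < q) : Module.Finite K (RadQuot q a) :=
  ⟨radQuot_span a hq ▸ Submodule.fg_span (Set.finite_range _)⟩

theorem finrank_radQuot_le (hq : 0 < q) : Module.finrank K (RadQuot q a) ≤ q ^ m := by
  rw [← finrank_top, ← radQuot_span a hq]
  exact (finrank_range_le_card _).trans (by simp)

end RadicalQuotient

section SplitField

variable {p : ℕ} [hp : Fact p.Prime] {c : ℕ+ → ℕ+ → MvPolynomial (ℕ+ ⊕ₗ ℕ+) ℤ}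
  (K : Type*) [Field K]

/-- Base change of operators on integral polynomials. -/
def endBaseChange (m : ℕ) : Module.End ℤ (MvPolynomial (Fin m) ℤ) →+*
    Module.End K (MvPolynomial (Fin m) K) :=
  (MvPolynomial.algebraTensorAlgEquiv ℤ K).toLinearEquiv.conjRingEquiv.toRingHom.comp
    (Module.End.baseChangeHom ℤ K (MvPolynomial (Fin m) ℤ)).toRingHom

theorem endBaseChange_apply {m : ℕ} (f : Module.End ℤ (MvPolynomial (Fin m) ℤ))
    (q : MvPolynomial (Fin m) ℤ) : endBaseChange K m f (MvPolynomial.map (algebraMap ℤ K) q) =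
      MvPolynomial.map (algebraMap ℤ K) (f q) := by
  change MvPolynomial.algebraTensorAlgEquiv ℤ K (f.baseChange K
    ((MvPolynomial.algebraTensorAlgEquiv ℤ K).symm _)) = _
  rw [MvPolynomial.algebraTensorAlgEquiv_symm_map, LinearMap.baseChange_tmul,
    MvPolynomial.algebraTensorAlgEquiv_tmul, one_smul]

theorem endBaseChange_mulVar (m i : ℕ) : endBaseChange K m (mulVar ℤ m i) = mulVar K m i := by
  by_cases h : i < m
  · refine MvPolynomial.basisMonomials _ _ |>.ext fun e => ?_
    have : MvPolynomial.basisMonomials (Fin m) K e =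
        MvPolynomial.map (algebraMap ℤ K) (MvPolynomial.monomial e 1) := by simp
    rw [this, endBaseChange_apply]
    simp [mulVar, h]
  · simp [mulVar, h]

theorem exists_isB_field (hc : IsCFamily c) (m n : ℕ) :
    ∃ y : ℕ → Module.End K (MvPolynomial (Fin m) K),
      IsB p c m n (mulVar K m) y ∧ ∀ j < n, y j 1 = 0 := by
  obtain ⟨y, hy, hy1⟩ := exists_isB_int (p := p) hc m n
  refine ⟨_, (hy.map (endBaseChange K m)).congr hc
    (fun i _ => endBaseChange_mulVar K m i) (fun j _ => rfl), fun j hj => ?_⟩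
  rw [← map_one (MvPolynomial.map (algebraMap ℤ K)), endBaseChange_apply, hy1 j hj, map_zero]

variable [CharP K p]

theorem exists_isB_radQuot (hc : IsCFamily c) {m n : ℕ} (a : Fin m → K) :
    ∃ x y : ℕ → Module.End K (RadQuot (p ^ n) a), IsB p c m n x y ∧
      (∀ i : Fin m, x i ^ p ^ n = algebraMap K _ (a i)) ∧ ∀ j < n, y j ^ p ^ m = 0 := by
  obtain ⟨y, hB, hy1⟩ := exists_isB_field (p := p) K hc m n
  have hR : (p : Module.End K (MvPolynomial (Fin m) K)) = 0 := by
    rw [← map_natCast (algebraMap K _), CharP.cast_eq_zero, map_zero]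
  have hlmul (T : Module.End K (MvPolynomial (Fin m) K)) (hT : ∀ i < m, Commute T (mulVar K m i))
      (f) : Commute T (Algebra.lmul K _ f) := by
    induction f using MvPolynomial.induction_on with
    | C r =>
      rw [← MvPolynomial.algebraMap_eq, AlgHom.commutes]
      exact (Algebra.commutes r T).symm
    | add f g hf hg =>
      rw [map_add]
      exact hf.add_right hg
    | mul_X f i hf =>
      rw [map_mul]
      refine hf.mul_right ?_
      have := hT i i.2
      simpa only [mulVar, i.2, dite_true] using this
  have hyp (j) (hj : j < n) : y j ^ p ^ m = 0 := by
    refine LinearMap.ext fun f => ?_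
    have h := hlmul (y j ^ p ^ m) (fun i hi => hB.commute_pow_y hc hR i hi j hj) f
    have h := LinearMap.congr_fun h.eq 1
    obtain ⟨r, hr⟩ : ∃ r, p ^ m = r + 1 :=
      ⟨_, (Nat.succ_pred_eq_of_pos (pow_pos hp.out.pos _)).symm⟩
    rw [Module.End.mul_apply, Module.End.mul_apply, hr, pow_succ, Module.End.mul_apply,
      Module.End.mul_apply, hy1 j hj] at h
    rw [hr, pow_succ]
    simpa using h
  have hgen (T : Module.End K (MvPolynomial (Fin m) K))
      (hT : ∀ i : Fin m, Commute T (Algebra.lmul K _ (MvPolynomial.X i ^ p ^ n))) :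
      (radIdeal (p ^ n) a).restrictScalars K ≤
        ((radIdeal (p ^ n) a).restrictScalars K).comap T := by
    intro f hf
    rw [Submodule.restrictScalars_mem, radIdeal, Ideal.mem_span_range_iff_exists_fun] at hf
    obtain ⟨r, rfl⟩ := hf
    rw [Submodule.mem_comap, Submodule.restrictScalars_mem, map_sum]
    refine sum_mem fun i _ => ?_
    have h := LinearMap.congr_fun ((hT i).sub_right (Algebra.commutes (a i) T).symm).eq (r i)
    rw [← AlgHom.commutes (Algebra.lmul K _), ← map_sub, MvPolynomial.algebraMap_eq] at h
    simp only [Module.End.mul_apply, Algebra.coe_lmul_eq_mul, LinearMap.mul_apply'] at h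
    rw [mul_comm, h]
    exact Ideal.mul_mem_right _ _ (Ideal.subset_span ⟨i, rfl⟩)
  have hx (i : ℕ) := hgen (mulVar K m i) fun k => by
    unfold mulVar
    split_ifs with h
    · exact (Commute.all _ _).map _
    · exact Commute.zero_left _
  have hy (j : Fin n) := hgen (y j) fun i => by
    have := hB.commute_pow_x hc hR i i.2 j j.2
    simpa only [mulVar, i.2, dite_true, ← map_pow] using this
  let J := (radIdeal (p ^ n) a).restrictScalars K
  let x' (i : ℕ) : Module.End K (RadQuot (p ^ n) a) := J.mapQ J _ (hx i)
  let y' (j : ℕ) : Module.End K (RadQuot (p ^ n) a) :=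
    if h : j < n then J.mapQ J _ (hy ⟨j, h⟩) else 0
  have hx' (i f) : x' i (J.mkQ f) = J.mkQ (mulVar K m i f) := rfl
  have hy' {j} (hj : j < n) (f) : y' j (J.mkQ f) = J.mkQ (y j f) := by
    simp only [y', hj, dite_true]
    rfl
  have hpow (T : Module.End K (MvPolynomial (Fin m) K)) (T' : Module.End K (RadQuot (p ^ n) a))
      (hT : ∀ f, T' (J.mkQ f) = J.mkQ (T f)) (k : ℕ) (f) :
      (T' ^ k) (J.mkQ f) = J.mkQ ((T ^ k) f) := by
    induction k generalizing f with
    | zero => rfl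
    | succ k ih => rw [pow_succ, pow_succ, Module.End.mul_apply, hT, ih, Module.End.mul_apply]
  let G : Subring (Module.End K (RadQuot (p ^ n) a) × Module.End K (MvPolynomial (Fin m) K)) :=
    (intertwine J.mkQ.toAddMonoidHom).comap (RingEquiv.prodComm.toRingHom)
  refine ⟨x', y', hB.of_subring hc G ?_ (fun i _ f => (hx' i f).symm)
    (fun j hj f => (hy' hj f).symm),
    fun i => ?_, fun j hj => ?_⟩
  · intro r hr
    refine LinearMap.ext fun f => ?_
    obtain ⟨f, rfl⟩ := J.mkQ_surjective f
    exact (hr f).symm.trans (map_zero J.mkQ)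
  · refine LinearMap.ext fun f => ?_
    obtain ⟨f, rfl⟩ := J.mkQ_surjective f
    rw [hpow _ _ (hx' i)]
    have : (mulVar K m i ^ p ^ n) f = MvPolynomial.X i ^ p ^ n * f := by
      simp only [mulVar, i.2, dite_true, ← map_pow]
      rfl
    rw [this, Module.algebraMap_end_apply, ← map_smul, ← sub_eq_zero, ← map_sub,
      Submodule.mkQ_apply, Submodule.Quotient.mk_eq_zero, Submodule.restrictScalars_mem,
      MvPolynomial.smul_eq_C_mul, ← sub_mul]
    exact Ideal.mul_mem_right _ _ (Ideal.subset_span ⟨i, rfl⟩)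
  · refine LinearMap.ext fun f => ?_
    obtain ⟨f, rfl⟩ := J.mkQ_surjective f
    rw [hpow _ _ (hy' hj), hyp j hj]
    simp

end SplitField

section WittLinear

variable {R : Type*} [Ring R] {p : ℕ} [hp : Fact p.Prime]

theorem wlin_eq_coeff {ε : ℤ} (hε : ε = 1 ∨ ε = -1) {R : Type*} [CommRing R] (x x' : ℕ → R)
    (i : ℕ) : wlin p ε x x' i = (WittVector.mk p x + ε • WittVector.mk p x').coeff i := by
  rw [wlin, ncEval_eq_aeval]
  have hu : (fun t : Fin 2 × ℕ => ![x, x'] t.1 t.2) = Function.uncurry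
    ![(WittVector.mk p x).coeff, (WittVector.mk p x').coeff] := rfl
  rcases hε with rfl | rfl
  · rw [one_smul, WittVector.add_coeff, WittVector.peval, WittVector.wittAdd, hu]
    simp
  · rw [neg_smul, one_smul, ← sub_eq_add_neg, WittVector.sub_coeff, WittVector.peval,
      WittVector.wittSub, hu]
    simp [sub_eq_add_neg]

theorem wlin_neg_wlin_comm {ε : ℤ} (hε : ε = 1 ∨ ε = -1) {R : Type*} [CommRing R] (x x' : ℕ → R)
    (i : ℕ) : wlin p (-ε) (wlin p ε x x') x' i = x i := by
  rw [wlin_eq_coeff (by omega), show wlin p ε x x' = _ from funext (wlin_eq_coeff hε x x')]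
  change (WittVector.mk p x + ε • WittVector.mk p x' + -ε • WittVector.mk p x').coeff i = x i
  simp

theorem wlin_zero_wlin_zero_comm {R : Type*} [CommRing R] (x : ℕ → R) (i : ℕ) :
    wlin p (-1) 0 (wlin p (-1) 0 x) i = x i := by
  have h0 : WittVector.mk p (0 : ℕ → R) = 0 := by
    ext i
    simp
  rw [wlin_eq_coeff (.inr rfl), show wlin p (-1) 0 x = _ from funext (wlin_eq_coeff (.inr rfl) 0 x),
    h0]
  change (0 + (-1 : ℤ) • (0 + (-1 : ℤ) • WittVector.mk p x)).coeff i = x i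
  simp

/-- Truncation of a sequence. -/
def trunc (m : ℕ) (x : ℕ → R) (i : ℕ) : R := if i < m then x i else 0

omit hp in
theorem trunc_of_lt {m i : ℕ} (x : ℕ → R) (h : i < m) : trunc m x i = x i := if_pos h

theorem wlin_trunc (ε : ℤ) (x x' : ℕ → R) {m i : ℕ} (h : i < m) :
    wlin p ε (trunc m x) (trunc m x') i = wlin p ε x x' i :=
  wlin_congr ε (fun _ hj => trunc_of_lt x (hj.trans_lt h))
    (fun _ hj => trunc_of_lt x' (hj.trans_lt h))

omit hp in
theorem trunc_commute {m : ℕ} {x x' : ℕ → R} (h : ∀ i < m, ∀ j < m, Commute (x i) (x' j))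
    (i j : ℕ) :
    Commute (trunc m x i) (trunc m x' j) := by
  unfold trunc
  split_ifs with hi hj
  · exact h i hi j hj
  · exact Commute.zero_right _
  · exact Commute.zero_left _
  · exact Commute.zero_left _

omit hp in
theorem pair_commute {x x' : ℕ → R} (hx : ∀ i j, Commute (x i) (x j))
    (hx' : ∀ i j, Commute (x' i) (x' j)) (hxx' : ∀ i j, Commute (x i) (x' j)) (s t : Fin 2 × ℕ) :
    ![x, x'] s.1 s.2 * ![x, x'] t.1 t.2 = ![x, x'] t.1 t.2 * ![x, x'] s.1 s.2 := by
  obtain ⟨b, i⟩ := s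
  obtain ⟨b', j⟩ := t
  fin_cases b <;> fin_cases b'
  · exact hx i j
  · exact hxx' i j
  · exact (hxx' j i).symm
  · exact hx' i j

theorem wlin_neg_wlin {ε : ℤ} (hε : ε = 1 ∨ ε = -1) {m : ℕ} {x x' : ℕ → R}
    (hx : ∀ i < m, ∀ j < m, Commute (x i) (x j))
    (hx' : ∀ i < m, ∀ j < m, Commute (x' i) (x' j)) (hxx' : ∀ i < m, ∀ j < m, Commute (x i) (x' j))
    {i : ℕ} (hi : i < m) : wlin p (-ε) (wlin p ε x x') x' i = x i := by
  have hz := pair_commute (trunc_commute hx) (trunc_commute hx') (trunc_commute hxx')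
  have h := congrArg (commHom _ hz) (wlin_neg_wlin_comm (p := p) hε (fun k => MvPolynomial.X (0, k))
    (fun k => MvPolynomial.X ((1 : Fin 2), k)) i)
  rw [map_wlin, show (fun i => commHom _ hz (wlin p ε (fun k => MvPolynomial.X (0, k))
    (fun k => MvPolynomial.X ((1 : Fin 2), k)) i)) = _ from funext fun i => map_wlin _ _ _ _ i] at h
  simp only [commHom_apply, ncEval_X, Matrix.cons_val_zero, Matrix.cons_val_one] at h
  rw [trunc_of_lt x hi] at h
  rw [← h]
  exact wlin_congr _ (fun j hj => (wlin_trunc ε x x' (hj.trans_lt hi)).symm)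
    (fun j hj => (trunc_of_lt x' (hj.trans_lt hi)).symm)

theorem wlin_zero_wlin_zero {m : ℕ} {x : ℕ → R} (hx : ∀ i < m, ∀ j < m, Commute (x i) (x j))
    {i : ℕ} (hi : i < m) : wlin p (-1) 0 (wlin p (-1) 0 x) i = x i := by
  have hz (i j) : trunc m x i * trunc m x j = trunc m x j * trunc m x i := trunc_commute hx i j
  have h := congrArg (commHom _ hz) (wlin_zero_wlin_zero_comm (p := p) MvPolynomial.X i)
  rw [map_wlin, show (fun i => commHom _ hz (wlin p (-1) 0 MvPolynomial.X i)) = _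
    from funext fun i => map_wlin _ _ _ _ i] at h
  simp only [commHom_apply, ncEval_X, Pi.zero_apply, map_zero] at h
  rw [trunc_of_lt x hi] at h
  rw [← h]
  exact wlin_congr _ (fun _ _ => rfl) fun j hj => wlin_congr _ (fun _ _ => rfl)
    fun k hk => (trunc_of_lt x (hk.trans_lt (hj.trans_lt hi))).symm

theorem ncEval_pow_char (K : Type*) [Field K] [CharP K p] [Algebra K R] {σ : Type*}
    {z : σ → R} (hz : ∀ a b, z a * z b = z b * z a) (N : ℕ)
    (q : MvPolynomial σ ℤ) : ncEval z q ^ p ^ N = ncEval (fun t => z t ^ p ^ N) q := by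
  cases subsingleton_or_nontrivial R with
  | inl h => exact Subsingleton.elim _ _
  | inr h =>
    have : CharP R p := charP_of_injective_algebraMap (algebraMap K R).injective p
    have hz' (a b) : z a ^ p ^ N * z b ^ p ^ N = z b ^ p ^ N * z a ^ p ^ N :=
      Commute.pow_pow (hz a b) _ _
    induction q using MvPolynomial.induction_on with
    | C a =>
      rw [← mul_one (MvPolynomial.C a), ← MvPolynomial.smul_eq_C_mul, map_smul, map_smul,
        ncEval_one, ncEval_one, zsmul_one]
      have h := congrArg (algebraMap K R) (map_intCast (iterateFrobenius K p N) a)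
      rw [iterateFrobenius_def, map_pow, map_intCast] at h
      exact h
    | add f g hf hg =>
      have hc : Commute (ncEval z f) (ncEval z g) := by
        rw [← commHom_apply z hz, ← commHom_apply z hz]
        exact (Commute.all f g).map _
      rw [map_add, map_add, add_pow_char_pow_of_commute _ _ hc, hf, hg]
    | mul_X f s hf =>
      have hc : Commute (ncEval z f) (z s) := by
        rw [← ncEval_X z s, ← commHom_apply z hz, ← commHom_apply z hz]
        exact (Commute.all _ _).map _
      rw [ncEval_mul hz, ncEval_mul hz', ncEval_X, ncEval_X, hc.mul_pow, hf]

variable {K : Type*} [Field K] [CharP K p] [Algebra K R]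

theorem wlin_pow (ε : ℤ) {m N : ℕ} {x x' : ℕ → R} {α α' : ℕ → K}
    (hx : ∀ i < m, ∀ j < m, Commute (x i) (x j))
    (hx' : ∀ i < m, ∀ j < m, Commute (x' i) (x' j)) (hxx' : ∀ i < m, ∀ j < m, Commute (x i) (x' j))
    (hα : ∀ i < m, x i ^ p ^ N = algebraMap K R (α i))
    (hα' : ∀ i < m, x' i ^ p ^ N = algebraMap K R (α' i)) {i : ℕ} (hi : i < m) :
    wlin p ε x x' i ^ p ^ N = algebraMap K R (wlin p ε α α' i) := by
  have hz := pair_commute (trunc_commute hx) (trunc_commute hx') (trunc_commute hxx')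
  rw [← wlin_trunc ε x x' hi, ← wlin_trunc ε α α' hi, wlin, ncEval_pow_char K hz N, wlin,
    map_ncEval]
  congr 2
  have h0 : p ^ N ≠ 0 := pow_ne_zero _ hp.out.ne_zero
  ext ⟨b, j⟩
  fin_cases b
  · by_cases hj : j < m
    · simp [trunc, hj, hα]
    · simpa [trunc, hj] using zero_pow h0
  · by_cases hj : j < m
    · simp [trunc, hj, hα']
    · simpa [trunc, hj] using zero_pow h0

omit [CharP K p] in
theorem wlin_out {m : ℕ} {ε : ℤ} (hε : ε = 1 ∨ ε = -1) (a a' : TruncatedWittVector p m K)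
    (i : Fin m) : wlin p ε a.out.coeff a'.out.coeff i = (a + ε • a').coeff i := by
  have : a + ε • a' = WittVector.truncate m (a.out + ε • a'.out) := by
    rw [map_add, map_zsmul]
    congr
    · exact a.truncateFun_out.symm
    · exact a'.truncateFun_out.symm
  rw [this, WittVector.coeff_truncate, wlin_eq_coeff hε]
  rfl

end WittLinear

section Symbols

set_option maxSynthPendingDepth 3

variable {p : ℕ} [hp : Fact p.Prime] {c : ℕ+ → ℕ+ → MvPolynomial (ℕ+ ⊕ₗ ℕ+) ℤ}
  {K : Type*} [Field K] {R S : Type*} [Ring R] [Algebra K R] [Ring S] [Algebra K S]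

/-- Sequences satisfying the defining relations of a symbol algebra. -/
structure IsSym (p : ℕ) [Fact p.Prime] (c : ℕ+ → ℕ+ → MvPolynomial (ℕ+ ⊕ₗ ℕ+) ℤ) {m n : ℕ}
    {K : Type*} [Field K] {R : Type*} [Ring R] [Algebra K R]
    (a : TruncatedWittVector p m K) (b : TruncatedWittVector p n K) (x y : ℕ → R) : Prop where
  isB : IsB p c m n x y
  xpow : ∀ i : Fin m, x i ^ p ^ n = algebraMap K R (a.coeff i)
  ypow : ∀ j : Fin n, y j ^ p ^ m = algebraMap K R (b.coeff j)

variable {m n : ℕ} {a a₂ : TruncatedWittVector p m K} {b b₂ : TruncatedWittVector p n K}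
  {x y x' y' : ℕ → R}

theorem IsSym.map (h : IsSym p c a b x y) (f : R →ₐ[K] S) :
    IsSym p c a b (fun i => f (x i)) (fun j => f (y j)) where
  isB := h.isB.map f.toRingHom
  xpow i := by rw [← map_pow, h.xpow, f.commutes]
  ypow j := by rw [← map_pow, h.ypow, f.commutes]

theorem IsSym.congr (hc : IsCFamily c) (h : IsSym p c a b x y) (hx : ∀ i < m, x i = x' i)
    (hy : ∀ j < n, y j = y' j) : IsSym p c a b x' y' where
  isB := h.isB.congr hc hx hy
  xpow i := by rw [← hx i i.2, h.xpow]
  ypow j := by rw [← hy j j.2, h.ypow]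

variable (p c a b) in
/-- The generators of the first kind, extended by zero. -/
def symX (i : ℕ) : Asymb K p c m n a b := if h : i < m then aX K p c m n a b ⟨i, h⟩ else 0

variable (p c a b) in
/-- The generators of the second kind, extended by zero. -/
def symY (j : ℕ) : Asymb K p c m n a b := if h : j < n then aY K p c m n a b ⟨j, h⟩ else 0

theorem symX_of_lt {i : ℕ} (h : i < m) : symX p c a b i = aX K p c m n a b ⟨i, h⟩ := dif_pos h

theorem symY_of_lt {i : ℕ} (h : i < n) : symY p c a b i = aY K p c m n a b ⟨i, h⟩ := dif_pos h

theorem isSym_sym : IsSym p c a b (symX p c a b) (symY p c a b) where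
  isB := by
    let φ := (RingQuot.mkAlgHom K (ASRel K p c m n a b)).comp
      (RingQuot.mkAlgHom K (BmnRel K p c m n))
    have hφx (i : Fin m) : symX p c a b i = φ (FreeAlgebra.ι K (Sum.inl i)) := symX_of_lt i.2
    have hφy (j : Fin n) : symY p c a b j = φ (FreeAlgebra.ι K (Sum.inr j)) := symY_of_lt j.2
    have hφ {u v} (h : BmnRel K p c m n u v) : φ u = φ v :=
      congrArg (RingQuot.mkAlgHom K (ASRel K p c m n a b)) (RingQuot.mkAlgHom_rel K h)
    refine ⟨fun i i' hi hi' => ?_, fun j j' hj hj' => ?_, fun i j hi hj => ?_⟩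
    · have h := hφ (.xx ⟨i, hi⟩ ⟨i', hi'⟩)
      rw [map_mul, map_mul, ← hφx, ← hφx] at h
      exact h
    · have h := hφ (.yy ⟨j, hj⟩ ⟨j', hj'⟩)
      rw [map_mul, map_mul, ← hφy, ← hφy] at h
      exact h
    · have h := hφ (.yx ⟨i, hi⟩ ⟨j, hj⟩)
      rw [map_mul, map_add, map_mul, ← hφx, ← hφy] at h
      refine h.trans (congrArg _ ?_)
      refine (map_cEval φ.toRingHom _ _ _).trans ?_
      congr 1
      · ext d
        unfold sxm symX
        split_ifs
        · rfl
        · exact map_zero φ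
      · ext d
        unfold syn symY
        split_ifs
        · rfl
        · exact map_zero φ
  xpow i := by
    rw [symX_of_lt i.2]
    have h := RingQuot.mkAlgHom_rel K (ASRel.xa (c := c) (a := a) (b := b) i)
    rwa [map_pow, AlgHom.commutes] at h
  ypow i := by
    rw [symY_of_lt i.2]
    have h := RingQuot.mkAlgHom_rel K (ASRel.yb (c := c) (a := a) (b := b) i)
    rwa [map_pow, AlgHom.commutes] at h

theorem IsSym.exists_lift (hc : IsCFamily c) (h : IsSym p c a b x y) :
    ∃ f : Asymb K p c m n a b →ₐ[K] R, (∀ i < m, f (symX p c a b i) = x i) ∧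
      ∀ j < n, f (symY p c a b j) = y j := by
  let f₀ : FreeAlgebra K (Fin m ⊕ Fin n) →ₐ[K] R :=
    FreeAlgebra.lift K (Sum.elim (fun i => x i) fun j => y j)
  let f₁ : Bmn K p c m n →ₐ[K] R := RingQuot.liftAlgHom K ⟨f₀, by
    rintro _ _ (⟨i, i'⟩ | ⟨j, j'⟩ | ⟨i, j⟩)
    · simpa [f₀] using (h.isB.xx i i' i.2 i'.2).eq
    · simpa [f₀] using (h.isB.yy j j' j.2 j'.2).eq
    · have := h.isB.yx i j i.2 j.2
      simp only [map_mul, map_add, f₀, FreeAlgebra.lift_ι_apply, Sum.elim_inl, Sum.elim_inr]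
      rw [this]
      congr 1
      refine (Eq.trans (map_cEval f₀.toRingHom _ _ _) ?_).symm
      refine cEval_congr (fun d hd => ?_) (fun d hd => ?_)
      · simp [sxm, (hc.x_lt hd).trans i.2, f₀]
      · simp [syn, (hc.y_lt hd).trans j.2, f₀]⟩
  have hx₁ (i : Fin m) : f₁ (gx K p c m n i) = x i := by
    simp [f₁, gx, f₀]
  have hy₁ (i : Fin n) : f₁ (gy K p c m n i) = y i := by
    simp [f₁, gy, f₀]
  refine ⟨RingQuot.liftAlgHom K ⟨f₁, ?_⟩, fun i hi => ?_, fun j hj => ?_⟩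
  · rintro _ _ (i | j)
    · rw [map_pow, hx₁, AlgHom.commutes, h.xpow]
    · rw [map_pow, hy₁, AlgHom.commutes, h.ypow]
  · rw [symX_of_lt hi, aX, RingQuot.liftAlgHom_mkAlgHom_apply, hx₁]
  · rw [symY_of_lt hj, aY, RingQuot.liftAlgHom_mkAlgHom_apply, hy₁]

theorem Asymb.hom_ext {f g : Asymb K p c m n a b →ₐ[K] R}
    (hX : ∀ i < m, f (symX p c a b i) = g (symX p c a b i))
    (hY : ∀ j < n, f (symY p c a b j) = g (symY p c a b j)) : f = g := by
  refine RingQuot.ringQuot_ext' K _ _ (RingQuot.ringQuot_ext' K _ _ (FreeAlgebra.hom_ext ?_))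
  funext s
  rcases s with i | j
  · have := hX i i.2
    rwa [symX_of_lt i.2] at this
  · have := hY j j.2
    rwa [symY_of_lt j.2] at this

theorem Asymb.adjoin_eq_top (hc : IsCFamily c) : Algebra.adjoin K
    (Set.range (fun i : Fin m => symX p c a b i) ∪ Set.range fun j : Fin n => symY p c a b j) =
      ⊤ := by
  set T := Algebra.adjoin K
    (Set.range (fun i : Fin m => symX p c a b i) ∪ Set.range fun j : Fin n => symY p c a b j)
  have hX (i : ℕ) : symX p c a b i ∈ T := by
    by_cases hi : i < m
    · exact Algebra.subset_adjoin (Or.inl ⟨⟨i, hi⟩, rfl⟩)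
    · simp [symX, hi]
  have hY (i : ℕ) : symY p c a b i ∈ T := by
    by_cases hi : i < n
    · exact Algebra.subset_adjoin (Or.inr ⟨⟨i, hi⟩, rfl⟩)
    · simp [symY, hi]
  have hT : IsSym p c a b (fun i => (⟨symX p c a b i, hX i⟩ : T))
      (fun i => (⟨symY p c a b i, hY i⟩ : T)) := by
    refine ⟨isSym_sym.isB.of_subring hc (RingHom.eqLocus (T.val.toRingHom.comp (RingHom.fst T _))
      (RingHom.snd T (Asymb K p c m n a b))) (fun r hr => Subtype.ext hr) (fun i _ => rfl)
      (fun j _ => rfl), fun i => Subtype.ext (isSym_sym.xpow i),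
      fun j => Subtype.ext (isSym_sym.ypow j)⟩
  obtain ⟨f, hfX, hfY⟩ := hT.exists_lift hc
  have : T.val.comp f = AlgHom.id K _ :=
    Asymb.hom_ext (fun i hi => by simp [hfX i hi]) (fun i hi => by simp [hfY i hi])
  rw [eq_top_iff]
  rintro u -
  rw [← AlgHom.id_apply (R := K) u, ← this]
  exact (f u).2

end Symbols

section Dimension

variable {K : Type*} [Field K] {R : Type*} [Ring R] [Algebra K R]

open scoped IsMulCommutative in
theorem finrank_adjoin_le {m q : ℕ} (hq : 0 < q) {z : Fin m → R}
    (hz : ∀ i j, z i * z j = z j * z i) {a : Fin m → K}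
    (ha : ∀ i, z i ^ q = algebraMap K R (a i)) :
    Module.Finite K (Algebra.adjoin K (Set.range z)) ∧
      Module.finrank K (Algebra.adjoin K (Set.range z)) ≤ q ^ m := by
  have := Algebra.isMulCommutative_adjoin K (s := Set.range z)
    (by rintro _ ⟨i, rfl⟩ _ ⟨j, rfl⟩; exact hz i j)
  let z' (i : Fin m) : Algebra.adjoin K (Set.range z) := ⟨z i, Algebra.subset_adjoin ⟨i, rfl⟩⟩
  let φ := MvPolynomial.aeval (R := K) z'
  have hφ : Function.Surjective φ := by
    have h : Algebra.adjoin K (Set.range z) ≤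
        ((Algebra.adjoin K (Set.range z)).val.comp φ).range := by
      refine Algebra.adjoin_le ?_
      rintro _ ⟨i, rfl⟩
      exact ⟨MvPolynomial.X i, by simp [φ, z']⟩
    intro s
    obtain ⟨f, hf⟩ := h s.2
    exact ⟨f, Subtype.ext hf⟩
  have hker : radIdeal q a ≤ RingHom.ker φ := by
    rw [radIdeal, Ideal.span_le]
    rintro _ ⟨i, rfl⟩
    simp only [φ, SetLike.mem_coe, RingHom.mem_ker, map_sub, map_pow, MvPolynomial.aeval_X,
      MvPolynomial.aeval_C, sub_eq_zero]
    exact Subtype.ext (ha i)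
  let ψ : RadQuot q a →ₗ[K] Algebra.adjoin K (Set.range z) :=
    Submodule.liftQ _ φ.toLinearMap fun f hf => hker hf
  have hψ : Function.Surjective ψ := fun s => by
    obtain ⟨f, rfl⟩ := hφ s
    exact ⟨Submodule.Quotient.mk f, rfl⟩
  have := radQuot_finite a hq
  exact ⟨Module.Finite.of_surjective ψ hψ,
    (LinearMap.finrank_le_finrank_of_surjective hψ).trans (finrank_radQuot_le a hq)⟩

variable {p : ℕ} [hp : Fact p.Prime] {c : ℕ+ → ℕ+ → MvPolynomial (ℕ+ ⊕ₗ ℕ+) ℤ}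
  {m n : ℕ} {a : TruncatedWittVector p m K} {b : TruncatedWittVector p n K} {x y : ℕ → R}

theorem IsSym.finrank_le (hc : IsCFamily c) (h : IsSym p c a b x y) (hgen : Algebra.adjoin K
    (Set.range (fun i : Fin m => x i) ∪ Set.range fun j : Fin n => y j) = ⊤) :
    Module.Finite K R ∧ Module.finrank K R ≤ p ^ (m * n) * p ^ (m * n) := by
  obtain ⟨hXf, hX⟩ := finrank_adjoin_le (pow_pos hp.out.pos n) (z := fun i : Fin m => x i)
    (fun i j => h.isB.xx i j i.2 j.2) h.xpow
  obtain ⟨hYf, hY⟩ := finrank_adjoin_le (pow_pos hp.out.pos m) (z := fun i : Fin n => y i)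
    (fun i j => h.isB.yy i j i.2 j.2) h.ypow
  set X := Algebra.adjoin K (Set.range fun i : Fin m => x i)
  set Y := Algebra.adjoin K (Set.range fun i : Fin n => y i)
  have htop : Subalgebra.toSubmodule X * Subalgebra.toSubmodule Y = ⊤ := by
    rw [eq_top_iff, ← Algebra.top_toSubmodule, ← hgen, Algebra.adjoin_eq_span, Submodule.span_le]
    intro r hr
    have hr' : r ∈ Subring.closure
        (Set.range (fun t : {t : Unit × ℕ // t.2 < m} => x t.1.2) ∪
          Set.range (fun t : {t : Unit × ℕ // t.2 < n} => y t.1.2)) := by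
      refine Submonoid.closure_le (S := (Subring.closure _).toSubmonoid).2 ?_ hr
      rintro _ (⟨i, rfl⟩ | ⟨i, rfl⟩)
      · exact Subring.subset_closure (Or.inl ⟨⟨((), i), i.2⟩, rfl⟩)
      · exact Subring.subset_closure (Or.inr ⟨⟨((), i), i.2⟩, rfl⟩)
    obtain ⟨q, rfl⟩ := h.isB.fam.mem_range hc hr'
    clear hr hr'
    induction q using induction_sum with
    | mul f g =>
      rw [nuEval_mul]
      refine Submodule.mul_mem_mul ?_ ?_
      · exact ncEval_mem X.toSubring fun t _ => Algebra.subset_adjoin ⟨⟨t.1.2, t.2⟩, rfl⟩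
      · exact ncEval_mem Y.toSubring fun t _ => Algebra.subset_adjoin ⟨⟨t.1.2, t.2⟩, rfl⟩
    | add q r hq hr =>
      rw [map_add]
      exact add_mem hq hr
  have hsurj : Function.Surjective
      (Submodule.mulMap (Subalgebra.toSubmodule X) (Subalgebra.toSubmodule Y)) := by
    rw [← LinearMap.range_eq_top, Submodule.mulMap_range, htop]
  have h1 : Module.Finite K (Subalgebra.toSubmodule X) := hXf
  have h2 : Module.Finite K (Subalgebra.toSubmodule Y) := hYf
  refine ⟨Module.Finite.of_surjective _ hsurj,
    (LinearMap.finrank_le_finrank_of_surjective hsurj).trans ?_⟩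
  rw [Module.finrank_tensorProduct]
  refine Nat.mul_le_mul (hX.trans_eq ?_) (hY.trans_eq ?_)
  · rw [← pow_mul, mul_comm]
  · rw [← pow_mul]

end Dimension

section Split

set_option maxSynthPendingDepth 3

variable {K : Type*} [Field K] {p : ℕ} [hp : Fact p.Prime] [CharP K p]
  {c : ℕ+ → ℕ+ → MvPolynomial (ℕ+ ⊕ₗ ℕ+) ℤ} {m n : ℕ}

theorem Asymb.exists_matrix (hc : IsCFamily c) (a : TruncatedWittVector p m K) :
    ∃ d, 0 < d ∧ Nonempty (Asymb K p c m n a 0 ≃ₐ[K] Matrix (Fin d) (Fin d) K) := by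
  have hq : 0 < p ^ n := pow_pos hp.out.pos n
  obtain ⟨x, y, hB, hx, hy⟩ := exists_isB_radQuot K hc (m := m) (n := n) (p := p) a.coeff
  have h : IsSym p c a (0 : TruncatedWittVector p n K) x y :=
    ⟨hB, hx, fun j => by simp [hy j j.2]⟩
  obtain ⟨f, hfx, hfy⟩ := h.exists_lift hc
  obtain ⟨hfin, hle⟩ := (isSym_sym (a := a) (b := (0 : TruncatedWittVector p n K))).finrank_le hc
    (Asymb.adjoin_eq_top hc)
  have := radQuot_finite a.coeff hq
  have := radQuot_nontrivial a.coeff hq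
  have hinj : Function.Injective f := by
    have hr : IsB p c m n (fun i => f.rangeRestrict (symX p c a 0 i))
      (fun i => f.rangeRestrict (symY p c a 0 i)) := isSym_sym.isB.map f.rangeRestrict.toRingHom
    have h1 := hr.le_finrank (K := K) hc
    have h2 := LinearMap.finrank_range_add_finrank_ker f.toLinearMap
    have h3 : Module.finrank K f.range = Module.finrank K (LinearMap.range f.toLinearMap) := rfl
    have h4 : LinearMap.ker f.toLinearMap = ⊥ := by
      rw [← Submodule.finrank_eq_zero]
      omega
    exact LinearMap.ker_eq_bot.1 h4
  have hd : Module.finrank K (RadQuot (p ^ n) a.coeff) ≤ p ^ (m * n) := by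
    rw [mul_comm, pow_mul]
    exact finrank_radQuot_le a.coeff hq
  have hN : p ^ (m * n) * p ^ (m * n) ≤ Module.finrank K (Asymb K p c m n a 0) := by
    have : Nontrivial (Asymb K p c m n a 0) := f.domain_nontrivial
    exact isSym_sym.isB.le_finrank hc
  have hbij : Function.Bijective f := by
    refine ⟨hinj, LinearMap.range_eq_top.1 (Submodule.eq_top_of_finrank_eq
      (S := LinearMap.range f.toLinearMap) ?_)⟩
    refine le_antisymm (Submodule.finrank_le _) ?_
    rw [LinearMap.finrank_range_of_inj hinj, Module.finrank_linearMap]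
    exact (Nat.mul_le_mul hd hd).trans hN
  refine ⟨_, Module.finrank_pos (R := K) (M := RadQuot (p ^ n) a.coeff),
    ⟨(AlgEquiv.ofBijective f hbij).trans (algEquivMatrix (Module.finBasis K _))⟩⟩

end Split

section Isomorphisms

set_option maxSynthPendingDepth 3

variable {K : Type*} [Field K] {p : ℕ} [hp : Fact p.Prime] [CharP K p]
  {c : ℕ+ → ℕ+ → MvPolynomial (ℕ+ ⊕ₗ ℕ+) ℤ} {m n : ℕ} {R : Type*} [Ring R] [Algebra K R]
  {a a' : TruncatedWittVector p m K} {b b' : TruncatedWittVector p n K} {x y x' y' : ℕ → R}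

omit [CharP K p] in
theorem twFrob_iterate_coeff (k : ℕ) (d : TruncatedWittVector p m K) (i : Fin m) :
    (twFrob^[k] d).coeff i = d.coeff i ^ p ^ k := by
  induction k with
  | zero => simp
  | succ k ih =>
    rw [Function.iterate_succ_apply', twFrob, TruncatedWittVector.coeff_mk, ih, pow_succ, pow_mul]

theorem wlin_pow_eq {N : ℕ} {ε : ℤ} (hε : ε = 1 ∨ ε = -1) {d : TruncatedWittVector p m K}
    (ha : a' = a + ε • d) (hx : ∀ i < m, ∀ j < m, Commute (x i) (x j))
    (hx' : ∀ i < m, ∀ j < m, Commute (x' i) (x' j)) (hxx' : ∀ i < m, ∀ j < m, Commute (x i) (x' j))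
    (hα : ∀ i : Fin m, x i ^ p ^ N = algebraMap K R (a.coeff i))
    (hα' : ∀ i : Fin m, x' i ^ p ^ N = algebraMap K R (d.coeff i)) (i : Fin m) :
    wlin p ε x x' i ^ p ^ N = algebraMap K R (a'.coeff i) := by
  rw [ha, ← wlin_out hε, ← wlin_pow ε hx hx' hxx' (fun i hi => ?_) (fun i hi => ?_) i.2]
  · exact (hα ⟨i, hi⟩).trans (by rw [← TruncatedWittVector.coeff_out a ⟨i, hi⟩])
  · exact (hα' ⟨i, hi⟩).trans (by rw [← TruncatedWittVector.coeff_out d ⟨i, hi⟩])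

variable (R) in
/-- The coefficients of a truncated Witt vector as scalars of an algebra. -/
def scalarSeq (d : TruncatedWittVector p m K) (i : ℕ) : R := algebraMap K R (d.out.coeff i)

omit [CharP K p] in
theorem scalarSeq_pow (k : ℕ) (d : TruncatedWittVector p m K) (i : Fin m) :
    scalarSeq R d i ^ p ^ k = algebraMap K R ((twFrob^[k] d).coeff i) := by
  rw [twFrob_iterate_coeff, scalarSeq, TruncatedWittVector.coeff_out, map_pow]

omit hp [CharP K p] in
theorem scalarSeq_commute (d : TruncatedWittVector p m K) (i : ℕ) (r : R) :
    Commute (scalarSeq R d i) r :=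
  Algebra.commutes _ _

omit hp [CharP K p] in
theorem map_scalarSeq {S : Type*} [Ring S] [Algebra K S] (f : R →ₐ[K] S)
    (d : TruncatedWittVector p m K) (i : ℕ) : f (scalarSeq R d i) = scalarSeq S d i :=
  f.commutes _

theorem IsSym.shiftX (hc : IsCFamily c) (h : IsSym p c a b x y) {ε : ℤ} (hε : ε = 1 ∨ ε = -1)
    {d : TruncatedWittVector p m K} (ha : a' = a + ε • twFrob^[n] d) :
    IsSym p c a' b (wlin p ε x (scalarSeq R d)) y where
  isB := by
    have hF : IsBFam p c (fun _ => m) (fun b => cond b 0 n) (fun b => cond b (scalarSeq R d) x)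
        (fun b => cond b 0 y) := by
      refine ⟨?_, ?_, ?_, ?_⟩
      · rintro (_ | _)
        · exact h.isB
        · exact ⟨fun i i' _ _ => scalarSeq_commute d i _, fun _ _ h => by simp at h,
            fun _ _ _ h => by simp at h⟩
      · rintro (_ | _) (_ | _) hb i _ j _
        · exact (hb rfl).elim
        · exact (scalarSeq_commute d _ _).symm
        · exact scalarSeq_commute d _ _
        · exact (hb rfl).elim
      · rintro (_ | _) (_ | _) hb i hi j hj
        · exact (hb rfl).elim
        · exact (Commute.zero_right _)
        · exact (Commute.zero_left _)
        · exact (hb rfl).elim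
      · rintro (_ | _) (_ | _) hb i hi j hj
        · exact (hb rfl).elim
        · exact (scalarSeq_commute d _ _).symm
        · exact (Commute.zero_left _)
        · exact (hb rfl).elim
    simpa using (hF.shear hc ε).isB false
  xpow := wlin_pow_eq hε ha (fun i hi j hj => h.isB.xx i j hi hj)
    (fun _ _ _ _ => scalarSeq_commute d _ _) (fun _ _ _ _ => (scalarSeq_commute d _ _).symm)
    h.xpow (scalarSeq_pow n d)
  ypow := h.ypow

theorem IsSym.shiftY (hc : IsCFamily c) (h : IsSym p c a b x y) {ε : ℤ} (hε : ε = 1 ∨ ε = -1)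
    {d : TruncatedWittVector p n K} (hb : b' = b + ε • twFrob^[m] d) :
    IsSym p c a b' x (wlin p ε y (scalarSeq R d)) where
  isB := by
    have hF : IsBFam p c (fun b => cond b m 0) (fun _ => n) (fun b => cond b x 0)
        (fun b => cond b y (scalarSeq R d)) := by
      refine ⟨?_, ?_, ?_, ?_⟩
      · rintro (_ | _)
        · exact ⟨fun _ _ h => by simp at h, fun i i' _ _ => scalarSeq_commute d i _,
            fun _ _ h => by simp at h⟩
        · exact h.isB
      · rintro (_ | _) (_ | _) hb i hi j hj
        · exact (hb rfl).elim
        · exact (Commute.zero_left _)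
        · exact (Commute.zero_right _)
        · exact (hb rfl).elim
      · rintro (_ | _) (_ | _) hb i _ j _
        · exact (hb rfl).elim
        · exact scalarSeq_commute d _ _
        · exact (scalarSeq_commute d _ _).symm
        · exact (hb rfl).elim
      · rintro (_ | _) (_ | _) hb i hi j hj
        · exact (hb rfl).elim
        · exact scalarSeq_commute d _ _
        · exact (Commute.zero_right _)
        · exact (hb rfl).elim
    simpa using (hF.shear hc (-ε)).isB true
  xpow := h.xpow
  ypow := wlin_pow_eq hε hb (fun i hi j hj => h.isB.yy i j hi hj)
    (fun _ _ _ _ => scalarSeq_commute d _ _) (fun _ _ _ _ => (scalarSeq_commute d _ _).symm)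
    h.ypow (scalarSeq_pow m d)

theorem IsSym.swap (hc : IsCFamily c) (h : IsSym p c a b x y) (ha : a' = -a) :
    IsSym p c b a' y (wlin p (-1) 0 x) where
  isB := h.isB.swap hc
  xpow := h.ypow
  ypow := by
    refine wlin_pow_eq (a := 0) (d := a) (.inr rfl) (by simpa using ha)
      (fun _ _ _ _ => Commute.zero_left _) (fun i hi j hj => h.isB.xx i j hi hj)
      (fun _ _ _ _ => Commute.zero_left _) (fun i => ?_) h.xpow
    simp [hp.out.ne_zero]

omit [CharP K p] in
theorem Asymb.comp_shiftX {ε : ℤ} (hε : ε = 1 ∨ ε = -1) (d : TruncatedWittVector p m K)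
    {f : Asymb K p c m n a b →ₐ[K] Asymb K p c m n a' b}
    {g : Asymb K p c m n a' b →ₐ[K] Asymb K p c m n a b}
    (hfX : ∀ i < m, f (symX p c a b i) = wlin p (-ε) (symX p c a' b) (scalarSeq _ d) i)
    (hfY : ∀ j < n, f (symY p c a b j) = symY p c a' b j)
    (hgX : ∀ i < m, g (symX p c a' b i) = wlin p ε (symX p c a b) (scalarSeq _ d) i)
    (hgY : ∀ j < n, g (symY p c a' b j) = symY p c a b j) : g.comp f = AlgHom.id K _ := by
  refine Asymb.hom_ext (fun i hi => ?_) (fun j hj => ?_)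
  · rw [AlgHom.comp_apply, hfX i hi, AlgHom.id_apply]
    refine (map_wlin g.toRingHom _ _ _ _).trans ?_
    refine (wlin_congr _ (fun j hj => hgX j (hj.trans_lt hi))
      fun j _ => map_scalarSeq g d j).trans ?_
    exact wlin_neg_wlin hε (fun i hi j hj => isSym_sym.isB.xx i j hi hj)
      (fun _ _ _ _ => scalarSeq_commute d _ _) (fun _ _ _ _ => (scalarSeq_commute d _ _).symm) hi
  · rw [AlgHom.comp_apply, hfY j hj, hgY j hj, AlgHom.id_apply]

omit [CharP K p] in
theorem Asymb.comp_shiftY {ε : ℤ} (hε : ε = 1 ∨ ε = -1) (d : TruncatedWittVector p n K)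
    {f : Asymb K p c m n a b →ₐ[K] Asymb K p c m n a b'}
    {g : Asymb K p c m n a b' →ₐ[K] Asymb K p c m n a b}
    (hfX : ∀ i < m, f (symX p c a b i) = symX p c a b' i)
    (hfY : ∀ j < n, f (symY p c a b j) = wlin p (-ε) (symY p c a b') (scalarSeq _ d) j)
    (hgX : ∀ i < m, g (symX p c a b' i) = symX p c a b i)
    (hgY : ∀ j < n, g (symY p c a b' j) = wlin p ε (symY p c a b) (scalarSeq _ d) j) :
    g.comp f = AlgHom.id K _ := by
  refine Asymb.hom_ext (fun i hi => ?_) (fun j hi => ?_)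
  · rw [AlgHom.comp_apply, hfX i hi, hgX i hi, AlgHom.id_apply]
  · rw [AlgHom.comp_apply, hfY j hi, AlgHom.id_apply]
    refine (map_wlin g.toRingHom _ _ _ _).trans ?_
    refine (wlin_congr _ (fun j hj => hgY j (hj.trans_lt hi))
      fun j _ => map_scalarSeq g d j).trans ?_
    exact wlin_neg_wlin hε (fun i hi j hj => isSym_sym.isB.yy i j hi hj)
      (fun _ _ _ _ => scalarSeq_commute d _ _) (fun _ _ _ _ => (scalarSeq_commute d _ _).symm) hi

variable (a b) in
theorem Asymb.nonempty_shiftX (hc : IsCFamily c) (d : TruncatedWittVector p m K) :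
    Nonempty (Asymb K p c m n a b ≃ₐ[K] Asymb K p c m n (a + twFrob^[n] d) b) := by
  obtain ⟨g, hgX, hgY⟩ := ((isSym_sym (a := a) (b := b)).shiftX hc (.inl rfl) (d := d)
    (a' := a + twFrob^[n] d) (by simp)).exists_lift hc
  obtain ⟨f, hfX, hfY⟩ := ((isSym_sym (a := a + twFrob^[n] d) (b := b)).shiftX hc (.inr rfl)
    (d := d) (a' := a) (by simp)).exists_lift hc
  exact ⟨AlgEquiv.ofAlgHom f g (comp_shiftX (.inr rfl) d hgX hgY hfX hfY)
    (comp_shiftX (.inl rfl) d hfX hfY hgX hgY)⟩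

variable (a b) in
theorem Asymb.nonempty_shiftY (hc : IsCFamily c) (d : TruncatedWittVector p n K) :
    Nonempty (Asymb K p c m n a b ≃ₐ[K] Asymb K p c m n a (b + twFrob^[m] d)) := by
  obtain ⟨g, hgX, hgY⟩ := ((isSym_sym (a := a) (b := b)).shiftY hc (.inl rfl) (d := d)
    (b' := b + twFrob^[m] d) (by simp)).exists_lift hc
  obtain ⟨f, hfX, hfY⟩ := ((isSym_sym (a := a) (b := b + twFrob^[m] d)).shiftY hc (.inr rfl)
    (d := d) (b' := b) (by simp)).exists_lift hc
  exact ⟨AlgEquiv.ofAlgHom f g (comp_shiftY (.inr rfl) d hgX hgY hfX hfY)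
    (comp_shiftY (.inl rfl) d hfX hfY hgX hgY)⟩

variable (a b) in
theorem Asymb.nonempty_swap (hc : IsCFamily c) (ha : a' = -a) :
    Nonempty (Asymb K p c m n a b ≃ₐ[K] Asymb K p c n m b a') := by
  obtain ⟨g, hgX, hgY⟩ := ((isSym_sym (a := a) (b := b)).swap hc ha).exists_lift hc
  have hB := (isSym_sym (p := p) (c := c) (a := b) (b := a')).isB
  obtain ⟨f, hfX, hfY⟩ := (((((isSym_sym (a := b) (b := a')).swap hc rfl).swap hc (a' := a)
    (by rw [ha, neg_neg])).swap hc (neg_neg b).symm).congr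
    (x' := wlin p (-1) 0 (symY p c b a')) (y' := symX p c b a') hc (fun _ _ => rfl)
      fun j hj => wlin_zero_wlin_zero (fun i hi j hj => hB.xx i j hi hj) hj).exists_lift hc
  refine ⟨AlgEquiv.ofAlgHom f g ?_ ?_⟩
  · refine Asymb.hom_ext (fun i hi => ?_) (fun j hj => ?_)
    · rw [AlgHom.comp_apply, hgX i hi, hfY i hi, AlgHom.id_apply]
    · rw [AlgHom.comp_apply, hgY j hj, AlgHom.id_apply]
      refine (map_wlin f.toRingHom _ _ _ _).trans ?_
      refine (wlin_congr _ (fun _ _ => map_zero f) fun i hi => hfX i (hi.trans_lt hj)).trans ?_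
      exact wlin_zero_wlin_zero (fun i hi j hj => hB.yy i j hi hj) hj
  · refine Asymb.hom_ext (fun i hi => ?_) (fun j hj => ?_)
    · rw [AlgHom.comp_apply, hfX i hi, AlgHom.id_apply]
      refine (map_wlin g.toRingHom _ _ _ _).trans ?_
      refine (wlin_congr _ (fun _ _ => map_zero g) fun j hj => hgY j (hj.trans_lt hi)).trans ?_
      exact wlin_zero_wlin_zero (fun i hi j hj => isSym_sym.isB.xx i j hi hj) hi
    · rw [AlgHom.comp_apply, hfY j hj, hgX j hj, AlgHom.id_apply]

end Isomorphisms

section Brauer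

variable {K : Type*} [Field K] {A B C D : Type*} [Ring A] [Algebra K A] [Ring B] [Algebra K B]
  [Ring C] [Algebra K C] [Ring D] [Algebra K D]

theorem BrauerEquiv.of_equiv (e : A ≃ₐ[K] B) : BrauerEquiv K A B :=
  ⟨1, 1, one_pos, one_pos, ⟨e.mapMatrix⟩⟩

theorem BrauerEquiv.symm (h : BrauerEquiv K A B) : BrauerEquiv K B A := by
  obtain ⟨r, s, hr, hs, ⟨e⟩⟩ := h
  exact ⟨s, r, hs, hr, ⟨e.symm⟩⟩

theorem BrauerEquiv.congr (h : BrauerEquiv K A B) (e : C ≃ₐ[K] A) (f : B ≃ₐ[K] D) :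
    BrauerEquiv K C D := by
  obtain ⟨r, s, hr, hs, ⟨g⟩⟩ := h
  exact ⟨r, s, hr, hs, ⟨e.mapMatrix.trans (g.trans f.mapMatrix)⟩⟩

theorem BrauerEquiv.matrix_right {d : ℕ} (hd : 0 < d)
    (h : BrauerEquiv K A (Matrix (Fin d) (Fin d) B)) : BrauerEquiv K A B := by
  obtain ⟨r, s, hr, hs, ⟨g⟩⟩ := h
  exact ⟨r, s * d, hr, Nat.mul_pos hs hd, ⟨(g.trans (Matrix.compAlgEquiv (Fin s) (Fin d) B K)).trans
    (Matrix.reindexAlgEquiv K B finProdFinEquiv)⟩⟩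

theorem BrauerEquiv.of_tensor {d : ℕ} (hd : 0 < d) (e : A ≃ₐ[K] B ⊗[K] C)
    (f : C ≃ₐ[K] Matrix (Fin d) (Fin d) K) : BrauerEquiv K A B :=
  (of_equiv (e.trans ((Algebra.TensorProduct.congr AlgEquiv.refl f).trans
    (matrixEquivTensor (Fin d) K B).symm))).matrix_right hd

end Brauer

section Pairs

set_option maxSynthPendingDepth 3

variable {K : Type*} [Field K] {p : ℕ} [hp : Fact p.Prime]
  {c : ℕ+ → ℕ+ → MvPolynomial (ℕ+ ⊕ₗ ℕ+) ℤ} {m n : ℕ} {R : Type*} [Ring R] [Algebra K R]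
  {a a₂ a' : TruncatedWittVector p m K} {b b₂ b' : TruncatedWittVector p n K}
  {x y x' y' : ℕ → R}

/-- Two commuting pairs of sequences satisfying the defining relations of symbol algebras. -/
structure IsSymPair (p : ℕ) [Fact p.Prime] (c : ℕ+ → ℕ+ → MvPolynomial (ℕ+ ⊕ₗ ℕ+) ℤ) {m n : ℕ}
    {K : Type*} [Field K] {R : Type*} [Ring R] [Algebra K R]
    (a a₂ : TruncatedWittVector p m K) (b b₂ : TruncatedWittVector p n K)
    (x y x' y' : ℕ → R) : Prop where
  left : IsSym p c a b x y
  right : IsSym p c a₂ b₂ x' y'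
  xx : ∀ i < m, ∀ j < m, Commute (x i) (x' j)
  yy : ∀ i < n, ∀ j < n, Commute (y i) (y' j)
  yx : ∀ i < n, ∀ j < m, Commute (y i) (x' j)
  xy : ∀ i < m, ∀ j < n, Commute (x i) (y' j)

theorem IsSymPair.fam (h : IsSymPair p c a a₂ b b₂ x y x' y') :
    IsBFam p c (fun _ => m) (fun _ => n) (fun b => cond b x' x) (fun b => cond b y' y) := by
  refine ⟨?_, ?_, ?_, ?_⟩
  · rintro (_ | _)
    · exact h.left.isB
    · exact h.right.isB
  · rintro (_ | _) (_ | _) hb i hi j hj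
    · exact (hb rfl).elim
    · exact h.xx i hi j hj
    · exact (h.xx j hj i hi).symm
    · exact (hb rfl).elim
  · rintro (_ | _) (_ | _) hb i hi j hj
    · exact (hb rfl).elim
    · exact h.yy i hi j hj
    · exact (h.yy j hj i hi).symm
    · exact (hb rfl).elim
  · rintro (_ | _) (_ | _) hb i hi j hj
    · exact (hb rfl).elim
    · exact h.yx i hi j hj
    · exact (h.xy j hj i hi).symm
    · exact (hb rfl).elim

theorem IsSymPair.shear [CharP K p] (hc : IsCFamily c) (h : IsSymPair p c a a₂ b b₂ x y x' y')
    {ε : ℤ} (hε : ε = 1 ∨ ε = -1) (ha : a' = a + ε • a₂) (hb : b' = b₂ + (-ε) • b) :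
    IsSymPair p c a' a₂ b b' (wlin p ε x x') y x' (wlin p (-ε) y' y) := by
  have hF := h.fam.shear hc ε
  simp only [min_self, Bool.cond_self] at hF
  exact {
    left := ⟨hF.isB false, wlin_pow_eq hε ha (fun i hi j hj => h.left.isB.xx i j hi hj)
      (fun i hi j hj => h.right.isB.xx i j hi hj) h.xx h.left.xpow h.right.xpow, h.left.ypow⟩
    right := ⟨hF.isB true, h.right.xpow, wlin_pow_eq (by omega) hb
      (fun i hi j hj => h.right.isB.yy i j hi hj) (fun i hi j hj => h.left.isB.yy i j hi hj)
      (fun i hi j hj => (h.yy j hj i hi).symm) h.right.ypow h.left.ypow⟩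
    xx := hF.xx false true (by simp)
    yy := hF.yy false true (by simp)
    yx := hF.yx false true (by simp)
    xy := fun i hi j hj => (hF.yx true false (by simp) j hj i hi).symm }

theorem Asymb.commute_map (hc : IsCFamily c) (f : Asymb K p c m n a b →ₐ[K] R) {z : R}
    (hX : ∀ i < m, Commute z (f (symX p c a b i))) (hY : ∀ j < n, Commute z (f (symY p c a b j)))
    (u : Asymb K p c m n a b) : Commute z (f u) := by
  have h : u ∈ Algebra.adjoin K (Set.range (fun i : Fin m => symX p c a b i) ∪
      Set.range fun j : Fin n => symY p c a b j) := by
    rw [Asymb.adjoin_eq_top hc]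
    trivial
  induction h using Algebra.adjoin_induction with
  | mem u hu =>
    rcases hu with ⟨i, rfl⟩ | ⟨j, rfl⟩
    · exact hX i i.2
    · exact hY j j.2
  | algebraMap r =>
    rw [f.commutes]
    exact (Algebra.commutes r z).symm
  | add u v _ _ hu hv =>
    rw [map_add]
    exact hu.add_right hv
  | mul u v _ _ hu hv =>
    rw [map_mul]
    exact hu.mul_right hv

variable (p c a a₂ b b₂) in
theorem isSymPair_tensor : IsSymPair p c a a₂ b b₂
    (fun i => (symX p c a b i ⊗ₜ[K] 1 : Asymb K p c m n a b ⊗[K] Asymb K p c m n a₂ b₂))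
    (fun j => symY p c a b j ⊗ₜ[K] 1) (fun i => 1 ⊗ₜ[K] symX p c a₂ b₂ i)
    (fun j => 1 ⊗ₜ[K] symY p c a₂ b₂ j) where
  left := isSym_sym.map (Algebra.TensorProduct.includeLeft (S := K))
  right := isSym_sym.map (Algebra.TensorProduct.includeRight :
    Asymb K p c m n a₂ b₂ →ₐ[K] Asymb K p c m n a b ⊗[K] Asymb K p c m n a₂ b₂)
  xx _ _ _ _ := by simp [Commute, SemiconjBy]
  yy _ _ _ _ := by simp [Commute, SemiconjBy]
  yx _ _ _ _ := by simp [Commute, SemiconjBy]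
  xy _ _ _ _ := by simp [Commute, SemiconjBy]

theorem IsSymPair.exists_lift (hc : IsCFamily c) (h : IsSymPair p c a a₂ b b₂ x y x' y') :
    ∃ f : Asymb K p c m n a b ⊗[K] Asymb K p c m n a₂ b₂ →ₐ[K] R,
      (∀ i < m, f (symX p c a b i ⊗ₜ 1) = x i) ∧ (∀ j < n, f (symY p c a b j ⊗ₜ 1) = y j) ∧
      (∀ i < m, f (1 ⊗ₜ symX p c a₂ b₂ i) = x' i) ∧
      ∀ j < n, f (1 ⊗ₜ symY p c a₂ b₂ j) = y' j := by
  obtain ⟨f, hfX, hfY⟩ := h.left.exists_lift hc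
  obtain ⟨g, hgX, hgY⟩ := h.right.exists_lift hc
  refine ⟨Algebra.TensorProduct.lift f g fun u v => ?_, fun i hi => ?_, fun i hi => ?_,
    fun i hi => ?_, fun i hi => ?_⟩
  · refine Asymb.commute_map hc g (fun i hi => ?_) (fun j hj => ?_) v
    · rw [hgX i hi]
      refine (Asymb.commute_map hc f (fun k hk => ?_) (fun k hk => ?_) u).symm
      · rw [hfX k hk]
        exact (h.xx k hk i hi).symm
      · rw [hfY k hk]
        exact (h.yx k hk i hi).symm
    · rw [hgY j hj]
      refine (Asymb.commute_map hc f (fun k hk => ?_) (fun k hk => ?_) u).symm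
      · rw [hfX k hk]
        exact (h.xy k hk j hj).symm
      · rw [hfY k hk]
        exact (h.yy k hk j hj).symm
  · simp [hfX i hi]
  · simp [hfY i hi]
  · simp [hgX i hi]
  · simp [hgY i hi]

theorem Asymb.tensor_hom_ext {f g : Asymb K p c m n a b ⊗[K] Asymb K p c m n a₂ b₂ →ₐ[K] R}
    (h₁ : ∀ i < m, f (symX p c a b i ⊗ₜ 1) = g (symX p c a b i ⊗ₜ 1))
    (h₂ : ∀ j < n, f (symY p c a b j ⊗ₜ 1) = g (symY p c a b j ⊗ₜ 1))
    (h₃ : ∀ i < m, f (1 ⊗ₜ symX p c a₂ b₂ i) = g (1 ⊗ₜ symX p c a₂ b₂ i))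
    (h₄ : ∀ j < n, f (1 ⊗ₜ symY p c a₂ b₂ j) = g (1 ⊗ₜ symY p c a₂ b₂ j)) : f = g :=
  Algebra.TensorProduct.ext (Asymb.hom_ext h₁ h₂) (Asymb.hom_ext h₃ h₄)

theorem Asymb.comp_shear {ε : ℤ} (hε : ε = 1 ∨ ε = -1)
    {f : Asymb K p c m n a b ⊗[K] Asymb K p c m n a₂ b₂ →ₐ[K]
      Asymb K p c m n a' b ⊗[K] Asymb K p c m n a₂ b'}
    {g : Asymb K p c m n a' b ⊗[K] Asymb K p c m n a₂ b' →ₐ[K]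
      Asymb K p c m n a b ⊗[K] Asymb K p c m n a₂ b₂}
    (hf₁ : ∀ i < m, f (symX p c a b i ⊗ₜ 1) =
      wlin p (-ε) (fun i => symX p c a' b i ⊗ₜ 1) (fun i => 1 ⊗ₜ symX p c a₂ b' i) i)
    (hf₂ : ∀ j < n, f (symY p c a b j ⊗ₜ 1) = symY p c a' b j ⊗ₜ 1)
    (hf₃ : ∀ i < m, f (1 ⊗ₜ symX p c a₂ b₂ i) = 1 ⊗ₜ symX p c a₂ b' i)
    (hf₄ : ∀ j < n, f (1 ⊗ₜ symY p c a₂ b₂ j) =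
      wlin p ε (fun i => 1 ⊗ₜ symY p c a₂ b' i) (fun i => symY p c a' b i ⊗ₜ 1) j)
    (hg₁ : ∀ i < m, g (symX p c a' b i ⊗ₜ 1) =
      wlin p ε (fun i => symX p c a b i ⊗ₜ 1) (fun i => 1 ⊗ₜ symX p c a₂ b₂ i) i)
    (hg₂ : ∀ j < n, g (symY p c a' b j ⊗ₜ 1) = symY p c a b j ⊗ₜ 1)
    (hg₃ : ∀ i < m, g (1 ⊗ₜ symX p c a₂ b' i) = 1 ⊗ₜ symX p c a₂ b₂ i)
    (hg₄ : ∀ j < n, g (1 ⊗ₜ symY p c a₂ b' j) =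
      wlin p (-ε) (fun i => 1 ⊗ₜ symY p c a₂ b₂ i) (fun i => symY p c a b i ⊗ₜ 1) j) :
    g.comp f = AlgHom.id K _ := by
  have hP := isSymPair_tensor p c a a₂ b b₂
  refine Asymb.tensor_hom_ext (fun i hi => ?_) (fun i hi => ?_) (fun i hi => ?_) (fun i hi => ?_)
  · rw [AlgHom.comp_apply, hf₁ i hi, AlgHom.id_apply]
    refine (map_wlin g.toRingHom _ _ _ _).trans ?_
    refine (wlin_congr _ (fun j hj => hg₁ j (hj.trans_lt hi))
      fun j hj => hg₃ j (hj.trans_lt hi)).trans ?_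
    exact wlin_neg_wlin hε (fun i hi j hj => hP.left.isB.xx i j hi hj)
      (fun i hi j hj => hP.right.isB.xx i j hi hj) hP.xx hi
  · rw [AlgHom.comp_apply, hf₂ i hi, hg₂ i hi, AlgHom.id_apply]
  · rw [AlgHom.comp_apply, hf₃ i hi, hg₃ i hi, AlgHom.id_apply]
  · rw [AlgHom.comp_apply, hf₄ i hi, AlgHom.id_apply]
    refine (map_wlin g.toRingHom _ _ _ _).trans ?_
    refine (wlin_congr _ (fun j hj => hg₄ j (hj.trans_lt hi))
      fun j hj => hg₂ j (hj.trans_lt hi)).trans ?_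
    have := wlin_neg_wlin (p := p) (ε := -ε) (by omega)
      (fun i hi j hj => hP.right.isB.yy i j hi hj) (fun i hi j hj => hP.left.isB.yy i j hi hj)
      (fun i hi j hj => (hP.yy j hj i hi).symm) hi
    rwa [neg_neg] at this

variable [CharP K p]

variable (a a₂ b) in
theorem Asymb.nonempty_tensor (hc : IsCFamily c) :
    Nonempty (Asymb K p c m n a b ⊗[K] Asymb K p c m n a₂ b ≃ₐ[K]
      Asymb K p c m n (a + a₂) b ⊗[K] Asymb K p c m n a₂ (0 : TruncatedWittVector p n K)) := by
  obtain ⟨g, hg₁, hg₂, hg₃, hg₄⟩ := ((isSymPair_tensor p c a a₂ b b).shear hc (.inl rfl)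
    (a' := a + a₂) (b' := 0) (by simp) (by simp)).exists_lift hc
  obtain ⟨f, hf₁, hf₂, hf₃, hf₄⟩ := ((isSymPair_tensor p c (a + a₂) a₂ b 0).shear hc (.inr rfl)
    (a' := a) (b' := b) (by simp) (by simp)).exists_lift hc
  rw [neg_neg] at hf₄
  exact ⟨AlgEquiv.ofAlgHom f g
    (comp_shear (.inr rfl) hg₁ hg₂ hg₃ hg₄ hf₁ hf₂ hf₃ hf₄)
    (comp_shear (.inl rfl) hf₁ hf₂ hf₃ hf₄ hg₁ hg₂ hg₃ hg₄)⟩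

variable (a a₂ b) in
theorem Asymb.brauerEquiv_add_left (hc : IsCFamily c) :
    BrauerEquiv K (Asymb K p c m n (a + a₂) b)
      (Asymb K p c m n a b ⊗[K] Asymb K p c m n a₂ b) := by
  obtain ⟨e⟩ := Asymb.nonempty_tensor a a₂ b hc
  obtain ⟨d, hd, ⟨f⟩⟩ := Asymb.exists_matrix (n := n) hc a₂
  exact (BrauerEquiv.of_tensor hd e f).symm

variable (a b b₂) in
theorem Asymb.brauerEquiv_add_right (hc : IsCFamily c) :
    BrauerEquiv K (Asymb K p c m n a (b + b₂))
      (Asymb K p c m n a b ⊗[K] Asymb K p c m n a b₂) := by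
  obtain ⟨e⟩ := Asymb.nonempty_swap a (b + b₂) hc rfl
  obtain ⟨e₁⟩ := Asymb.nonempty_swap a b hc rfl
  obtain ⟨e₂⟩ := Asymb.nonempty_swap a b₂ hc rfl
  exact (Asymb.brauerEquiv_add_left b b₂ (-a) hc).congr e
    (Algebra.TensorProduct.congr e₁.symm e₂.symm)

variable (a b) in
theorem Asymb.brauerEquiv_tensor_swap (hc : IsCFamily c) :
    BrauerEquiv K (Asymb K p c m n a b ⊗[K] Asymb K p c n m b a) K := by
  obtain ⟨e⟩ := Asymb.nonempty_swap b a hc rfl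
  have h := (Asymb.brauerEquiv_add_right a b (-b) hc).symm
  rw [add_neg_cancel] at h
  obtain ⟨d, hd, ⟨f⟩⟩ := Asymb.exists_matrix (n := n) hc a
  exact (h.congr (Algebra.TensorProduct.congr AlgEquiv.refl e) f).matrix_right hd

end Pairs

set_option maxSynthPendingDepth 3 in
set_option synthInstance.maxHeartbeats 1000000 in
set_option maxHeartbeats 1000000 in
/-- Let `p` be a prime, `K` a field of characteristic `p` and `m, n ∈ ℕ`.  The symbol
`((a,b))_{p^m,p^n} := [A_{((a,b))_{p^m,p^n}}] ∈ Br(K)` satisfies (equalities in the Brauer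
group being expressed by Brauer equivalence of central simple algebras, and sums by tensor
products):
(i) `((a,b)) = ((a + F^n c, b + F^m d))` for all `a, c ∈ W_m(K)`, `b, d ∈ W_n(K)`;
(ii) `((·,·))_{p^m,p^n}` is additive in each variable;
(iii) `((a,b))_{p^m,p^n} = −((b,a))_{p^n,p^m}`, i.e. the tensor product
`A_{((a,b))_{p^m,p^n}} ⊗ A_{((b,a))_{p^n,p^m}}` is split; in particular
`((·,·))_{p^n} = ((·,·))_{p^n,p^n}` is skew-symmetric. -/
theorem symbol_properties (p : ℕ) [Fact p.Prime] (K : Type*) [Field K] [CharP K p]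
    (m n : ℕ) (c : ℕ+ → ℕ+ → MvPolynomial (ℕ+ ⊕ₗ ℕ+) ℤ) (hc : IsCFamily c) :
    (∀ (a a₂ : TruncatedWittVector p m K) (b b₂ : TruncatedWittVector p n K),
      BrauerEquiv K (Asymb K p c m n a b)
        (Asymb K p c m n (a + twFrob^[n] a₂) (b + twFrob^[m] b₂))) ∧
    (∀ (a a₂ : TruncatedWittVector p m K) (b : TruncatedWittVector p n K),
      BrauerEquiv K (Asymb K p c m n (a + a₂) b)
        (Asymb K p c m n a b ⊗[K] Asymb K p c m n a₂ b)) ∧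
    (∀ (a : TruncatedWittVector p m K) (b b₂ : TruncatedWittVector p n K),
      BrauerEquiv K (Asymb K p c m n a (b + b₂))
        (Asymb K p c m n a b ⊗[K] Asymb K p c m n a b₂)) ∧
    (∀ (a : TruncatedWittVector p m K) (b : TruncatedWittVector p n K),
      BrauerEquiv K (Asymb K p c m n a b ⊗[K] Asymb K p c n m b a) K) := by
  refine ⟨fun a a₂ b b₂ => ?_, fun a a₂ b => Asymb.brauerEquiv_add_left a a₂ b hc,
    fun a b b₂ => Asymb.brauerEquiv_add_right a b b₂ hc,
    fun a b => Asymb.brauerEquiv_tensor_swap a b hc⟩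
  obtain ⟨e⟩ := Asymb.nonempty_shiftX a b hc a₂
  obtain ⟨f⟩ := Asymb.nonempty_shiftY (a + twFrob^[n] a₂) b hc b₂
  exact .of_equiv (e.trans f)

end
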